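/- arXiv:math/0605211 — 2 statements merged into one kernel-verified Lean document; each statement's English description precedes it below -/
import Mathlib

section
/- Let X be a geodesic metric space and 𝓐 a collection of subsets of X satisfying properties (α1), (α2), (Q) and (β3). Then X is asymptotically tree-graded with respect to 𝓐; in particular property (α3) holds. -/
open Set Metric

/-! ### Basic metric notions: tubular neighborhoods, geodesics -/

variable {X : Type*} [MetricSpace X]

/-- Open `δ`-tubular neighborhood of a subset. -/
def tubN (δ : ℝ) (A : Set X) : Set X := {x | Metric.infDist x A < δ}

/-- Closed `δ`-tubular neighborhood of a subset. -/
def ctubN (δ : ℝ) (A : Set X) : Set X := {x | Metric.infDist x A ≤ δ}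

/-- `γ` parametrizes a geodesic of length `ℓ` (an isometric embedding of `[0,ℓ]`). -/
def IsGeodesicParam (γ : ℝ → X) (ℓ : ℝ) : Prop :=
  0 ≤ ℓ ∧ ∀ s ∈ Set.Icc (0:ℝ) ℓ, ∀ t ∈ Set.Icc (0:ℝ) ℓ, dist (γ s) (γ t) = |s - t|

/-- A metric space is geodesic if every two points are joined by a geodesic. -/
def GeodesicSpace (X : Type*) [MetricSpace X] : Prop :=
  ∀ x y : X, ∃ (γ : ℝ → X) (ℓ : ℝ), IsGeodesicParam γ ℓ ∧ γ 0 = x ∧ γ ℓ = y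

/-- The cyclic successor of an index in `Fin k`. -/
def finCycSucc {k : ℕ} (i : Fin k) : Fin k := ⟨(i.val + 1) % k, Nat.mod_lt _ i.pos⟩

/-! ### Polygons -/

/-- The data of a `k`-gon: `k` parametrized paths with their lengths. -/
structure PrePolygon (X : Type*) (k : ℕ) where
  edge : Fin k → ℝ → X
  len : Fin k → ℝ

namespace PrePolygon

variable {k : ℕ}

/-- The `i`-th edge, as a subset. -/
def edgeSet (P : PrePolygon X k) (i : Fin k) : Set X := P.edge i '' Set.Icc 0 (P.len i)

/-- The polygon, as a subset (union of its edges). -/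
def carrier (P : PrePolygon X k) : Set X := ⋃ i, P.edgeSet i

/-- The `i`-th vertex (the origin of the `i`-th edge). -/
def vertex (P : PrePolygon X k) (i : Fin k) : X := P.edge i 0

/-- The union `O_x` of the edges not adjacent to the `i`-th vertex. -/
def opp (P : PrePolygon X k) (i : Fin k) : Set X :=
  ⋃ j ∈ {j : Fin k | j ≠ i ∧ finCycSucc j ≠ i}, P.edgeSet j

/-- The edges close up cyclically (the endpoint of each edge is the origin of the next). -/
def IsClosedPolygon (P : PrePolygon X k) : Prop :=
  (∀ i, 0 ≤ P.len i) ∧ ∀ i, P.edge i (P.len i) = P.edge (finCycSucc i) 0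

/-- A geodesic `k`-gon. -/
def IsGeodesicPolygon (P : PrePolygon X k) : Prop :=
  P.IsClosedPolygon ∧ ∀ i, IsGeodesicParam (P.edge i) (P.len i)

/-- The polygon is `(θ,σ,ν)`-fat:  (F1) every point of an edge at distance at least `σθ`
from both endpoints of the edge is at distance at least `θ` from the rest of the polygon;
(F2) every vertex is at distance at least `νθ` from the union of the non-adjacent edges. -/
def IsFat (P : PrePolygon X k) (θ σ ν : ℝ) : Prop :=
  (∀ i : Fin k, ∀ p ∈ P.edgeSet i,
      σ * θ ≤ dist p (P.edge i 0) → σ * θ ≤ dist p (P.edge i (P.len i)) →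
      θ ≤ Metric.infDist p (P.carrier \ P.edgeSet i)) ∧
  (∀ i : Fin k, ν * θ ≤ Metric.infDist (P.vertex i) (P.opp i))

/-- `(θ,ν)`-fat means `(θ,2,ν)`-fat. -/
def IsFat2 (P : PrePolygon X k) (θ ν : ℝ) : Prop := P.IsFat θ 2 ν

end PrePolygon

/-! ### Gromov hyperbolicity (thin triangles) -/

/-- A geodesic metric space is Gromov hyperbolic if there is `δ ≥ 0` such that every geodesic
triangle is `δ`-thin: each side lies in the closed `δ`-neighborhood of the other two sides. -/
def GromovHyperbolic (X : Type*) [MetricSpace X] : Prop :=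
  ∃ δ : ℝ, 0 ≤ δ ∧ ∀ T : PrePolygon X 3, T.IsGeodesicPolygon →
    ∀ i : Fin 3, ∀ p ∈ T.edgeSet i,
      Metric.infDist p (T.edgeSet (finCycSucc i) ∪ T.edgeSet (finCycSucc (finCycSucc i))) ≤ δ

/-! ### The Druţu–Sapir properties of a pair `(X, 𝓐)` -/

/-- Property (α₁): uniformly bounded intersections of tubular neighborhoods. -/
def Alpha1 (𝓐 : Set (Set X)) : Prop :=
  ∀ δ : ℝ, 0 < δ → ∃ D : ℝ, ∀ A ∈ 𝓐, ∀ A' ∈ 𝓐, A ≠ A' →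
    ∀ x ∈ tubN δ A ∩ tubN δ A', ∀ y ∈ tubN δ A ∩ tubN δ A', dist x y ≤ D

/-- Property (α₂) with given constants `ε`, `M`. -/
def Alpha2With (𝓐 : Set (Set X)) (ε M : ℝ) : Prop :=
  ∀ (γ : ℝ → X) (ℓ : ℝ), IsGeodesicParam γ ℓ → ∀ A ∈ 𝓐,
    γ 0 ∈ tubN (ε * ℓ) A → γ ℓ ∈ tubN (ε * ℓ) A →
    ∃ t ∈ Set.Icc (0:ℝ) ℓ, γ t ∈ tubN M A

/-- Property (α₂). -/
def Alpha2 (𝓐 : Set (Set X)) : Prop :=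
  ∃ ε M : ℝ, 0 ≤ ε ∧ ε < 1/2 ∧ 0 < M ∧ Alpha2With 𝓐 ε M

/-- Property (α₃): fat geodesic `k`-gons lie in tubular neighborhoods of pieces. -/
def Alpha3 (𝓐 : Set (Set X)) : Prop :=
  ∀ k : ℕ, 2 ≤ k → ∃ θ : ℝ, 0 < θ ∧ ∃ ν : ℝ, 8 ≤ ν ∧ ∃ χ : ℝ, 0 < χ ∧
    ∀ P : PrePolygon X k, P.IsGeodesicPolygon → P.IsFat2 θ ν →
      ∃ A ∈ 𝓐, P.carrier ⊆ tubN χ A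

/-- Property (β₂) with given constants `ε`, `M`: middle thirds of geodesics with endpoints
close to a piece stay close to the piece. -/
def Beta2With (𝓐 : Set (Set X)) (ε M : ℝ) : Prop :=
  ∀ (γ : ℝ → X) (ℓ : ℝ), IsGeodesicParam γ ℓ → ∀ A ∈ 𝓐,
    γ 0 ∈ tubN (ε * ℓ) A → γ ℓ ∈ tubN (ε * ℓ) A →
    ∀ t ∈ Set.Icc (ℓ/3) (2*ℓ/3), γ t ∈ tubN M A

/-- Property (β₂). -/
def Beta2 (𝓐 : Set (Set X)) : Prop := ∃ ε M : ℝ, 0 < ε ∧ 0 ≤ M ∧ Beta2With 𝓐 ε M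

/-- Property (β₃) with given constants: fat geodesic hexagons lie in tubular
neighborhoods of pieces. -/
def Beta3With (𝓐 : Set (Set X)) (θ ν χ : ℝ) : Prop :=
  ∀ P : PrePolygon X 6, P.IsGeodesicPolygon → P.IsFat2 θ ν → ∃ A ∈ 𝓐, P.carrier ⊆ tubN χ A

/-- Property (β₃). -/
def Beta3 (𝓐 : Set (Set X)) : Prop :=
  ∃ θ : ℝ, 0 < θ ∧ ∃ ν : ℝ, 8 ≤ ν ∧ ∃ χ : ℝ, 0 < χ ∧ Beta3With 𝓐 θ ν χ

/-- Property (Q), uniform quasi-convexity of pieces, with given constants `t`, `K₀`. -/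
def PropQWith (𝓐 : Set (Set X)) (t K₀ : ℝ) : Prop :=
  ∀ A ∈ 𝓐, ∀ K : ℝ, K₀ ≤ K → ∀ (γ : ℝ → X) (ℓ : ℝ), IsGeodesicParam γ ℓ →
    γ 0 ∈ tubN K A → γ ℓ ∈ tubN K A → ∀ s ∈ Set.Icc (0:ℝ) ℓ, γ s ∈ tubN (t * K) A

/-- Property (Q), uniform quasi-convexity of pieces. -/
def PropQ (𝓐 : Set (Set X)) : Prop :=
  ∃ t : ℝ, 0 < t ∧ ∃ K₀ : ℝ, 0 ≤ K₀ ∧ PropQWith 𝓐 t K₀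

/-- `X` is asymptotically tree-graded with respect to `𝓐` (Druţu–Sapir metric
characterization, taken as the definition): (α₁), (α₂) and (α₃) hold. -/
def ATG (𝓐 : Set (Set X)) : Prop := Alpha1 𝓐 ∧ Alpha2 𝓐 ∧ Alpha3 𝓐

/-! ### Entrance and exit points, almost geodesics, the (*) property -/

/-- The entrance point of the path `p : [0,ℓ] → X` in the set `S`. -/
noncomputable def entrancePoint (p : ℝ → X) (ℓ : ℝ) (S : Set X) : X :=
  p (sInf {t | t ∈ Set.Icc (0:ℝ) ℓ ∧ p t ∈ S})

/-- The exit point of the path `p : [0,ℓ] → X` from the set `S`. -/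
noncomputable def exitPoint (p : ℝ → X) (ℓ : ℝ) (S : Set X) : X :=
  p (sSup {t | t ∈ Set.Icc (0:ℝ) ℓ ∧ p t ∈ S})

/-- `q` is a `(1,C)`-almost geodesic on `[0,ℓ]`: a `1`-Lipschitz `(1,C)`-quasi-geodesic. -/
def IsAlmostGeodesic (C : ℝ) (q : ℝ → X) (ℓ : ℝ) : Prop :=
  0 ≤ ℓ ∧ ∀ s ∈ Set.Icc (0:ℝ) ℓ, ∀ t ∈ Set.Icc (0:ℝ) ℓ,
    |s - t| - C ≤ dist (q s) (q t) ∧ dist (q s) (q t) ≤ |s - t|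

/-- The `(*)` alternative for triangles with `(1,C)`-almost geodesic edges,
with constants `σ`, `δ`. -/
def StarATGWith (𝓐 : Set (Set X)) (C σ δ : ℝ) : Prop :=
  ∀ T : PrePolygon X 3, T.IsClosedPolygon →
    (∀ i, IsAlmostGeodesic C (T.edge i) (T.len i)) →
    (∃ a : X, ∀ i : Fin 3, (Metric.closedBall a σ ∩ T.edgeSet i).Nonempty) ∨
    (∃ A ∈ 𝓐, (∀ i : Fin 3, (ctubN σ A ∩ T.edgeSet i).Nonempty) ∧
      ∀ i : Fin 3, dist (exitPoint (T.edge i) (T.len i) (ctubN σ A))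
        (entrancePoint (T.edge (finCycSucc i)) (T.len (finCycSucc i)) (ctubN σ A)) < δ)

/-- `X` is `(*)`-asymptotically tree-graded with respect to `𝓐`. -/
def StarATG (𝓐 : Set (Set X)) : Prop :=
  ∀ C : ℝ, 0 ≤ C → ∃ σ δ : ℝ, StarATGWith 𝓐 C σ δ

/-! ### Helper notions: isometric paths, segments, good corners -/

/-- `γ` is isometric on `[lo,hi]`. -/
def IsoOn (γ : ℝ → X) (lo hi : ℝ) : Prop :=
  ∀ s ∈ Icc lo hi, ∀ t ∈ Icc lo hi, dist (γ s) (γ t) = |s - t|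

/-- `S` is (the image of) a geodesic from `p` to `q`. -/
def IsSeg (S : Set X) (p q : X) : Prop :=
  ∃ (γ : ℝ → X) (ℓ : ℝ), IsGeodesicParam γ ℓ ∧ γ 0 = p ∧ γ ℓ = q ∧ S = γ '' Icc 0 ℓ

/-- Two segments meeting at `v` diverge at least at speed one half. -/
def Good (S S' : Set X) (v : X) : Prop :=
  ∀ p ∈ S, ∀ q ∈ S', dist p v ≤ 2 * dist p q ∧ dist q v ≤ 2 * dist p q

/-- Two sets are `H`-separated. -/
def FarSep (H : ℝ) (S S' : Set X) : Prop := ∀ x ∈ S, ∀ y ∈ S', H ≤ dist x y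

theorem Good.symm {S S' : Set X} {v : X} (h : Good S S' v) : Good S' S v := by
  intro p hp q hq
  have := h q hq p hp
  rw [dist_comm p q]
  exact ⟨this.2, this.1⟩

theorem Good.mono {S S' R R' : Set X} {v : X} (h : Good S S' v) (h1 : R ⊆ S) (h2 : R' ⊆ S') :
    Good R R' v := fun p hp q hq => h p (h1 hp) q (h2 hq)

theorem FarSep.symm {H : ℝ} {S S' : Set X} (h : FarSep H S S') : FarSep H S' S := by
  intro p hp q hq
  rw [dist_comm]
  exact h q hq p hp

theorem FarSep.mono {H H' : ℝ} {S S' R R' : Set X} (h : FarSep H S S') (h1 : R ⊆ S) (h2 : R' ⊆ S')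
    (hH : H' ≤ H) : FarSep H' R R' := fun p hp q hq => hH.trans (h p (h1 hp) q (h2 hq))

theorem IsoOn.mono {γ : ℝ → X} {lo hi a b : ℝ} (h : IsoOn γ lo hi) (h1 : lo ≤ a) (h2 : b ≤ hi) :
    IsoOn γ a b := fun s hs t ht =>
  h s ⟨h1.trans hs.1, hs.2.trans h2⟩ t ⟨h1.trans ht.1, ht.2.trans h2⟩

theorem IsoOn.continuousOn {γ : ℝ → X} {lo hi : ℝ} (h : IsoOn γ lo hi) :
    ContinuousOn γ (Icc lo hi) := by
  have : LipschitzOnWith 1 γ (Icc lo hi) := by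
    apply LipschitzOnWith.of_dist_le_mul
    intro s hs t ht
    rw [h s hs t ht, Real.dist_eq]; simp
  exact this.continuousOn

theorem IsoOn.isSeg {γ : ℝ → X} {lo hi a b : ℝ} (h : IsoOn γ lo hi) (h1 : lo ≤ a) (hab : a ≤ b)
    (h2 : b ≤ hi) : IsSeg (γ '' Icc a b) (γ a) (γ b) := by
  refine ⟨fun t => γ (a + t), b - a, ⟨by linarith, ?_⟩, by simp, by simp, ?_⟩
  · intro s hs t ht
    rw [h (a + s) ⟨by linarith [hs.1], by linarith [hs.2]⟩ (a + t)
      ⟨by linarith [ht.1], by linarith [ht.2]⟩]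
    congr 1; ring
  · ext x; constructor
    · rintro ⟨t, ht, rfl⟩
      exact ⟨t - a, ⟨by linarith [ht.1], by linarith [ht.2]⟩, by simp⟩
    · rintro ⟨t, ht, rfl⟩
      exact ⟨a + t, ⟨by linarith [ht.1], by linarith [ht.2]⟩, rfl⟩

theorem IsSeg.symm {S : Set X} {p q : X} (h : IsSeg S p q) : IsSeg S q p := by
  obtain ⟨γ, ℓ, hγ, h0, h1, rfl⟩ := h
  refine ⟨fun t => γ (ℓ - t), ℓ, ⟨hγ.1, ?_⟩, by simpa using h1, by simpa using h0, ?_⟩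
  · intro s hs t ht
    rw [hγ.2 (ℓ - s) ⟨by linarith [hs.2], by linarith [hs.1]⟩ (ℓ - t)
      ⟨by linarith [ht.2], by linarith [ht.1]⟩, abs_sub_comm]
    congr 1; ring
  · ext x; constructor
    · rintro ⟨t, ht, rfl⟩
      exact ⟨ℓ - t, ⟨by linarith [ht.2], by linarith [ht.1]⟩, by simp⟩
    · rintro ⟨t, ht, rfl⟩
      exact ⟨ℓ - t, ⟨by linarith [ht.2], by linarith [ht.1]⟩, rfl⟩

theorem GeodesicSpace.exists_seg (hX : GeodesicSpace X) (p q : X) : ∃ S, IsSeg S p q := by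
  obtain ⟨γ, ℓ, hγ, h0, h1⟩ := hX p q
  exact ⟨_, γ, ℓ, hγ, h0, h1, rfl⟩

/-- arclength description of a segment -/
theorem IsSeg.param {S : Set X} {p q : X} (h : IsSeg S p q) :
    ∃ γ : ℝ → X, IsoOn γ 0 (dist p q) ∧ γ 0 = p ∧ γ (dist p q) = q ∧
      S = γ '' Icc 0 (dist p q) := by
  obtain ⟨γ, ℓ, hγ, h0, h1, rfl⟩ := h
  have : dist p q = ℓ := by
    rw [← h0, ← h1, hγ.2 0 ⟨le_rfl, hγ.1⟩ ℓ ⟨hγ.1, le_rfl⟩, zero_sub, abs_neg, abs_of_nonneg hγ.1]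
  rw [this]
  exact ⟨γ, hγ.2, h0, h1, rfl⟩

theorem IsSeg.left_mem {S : Set X} {p q : X} (h : IsSeg S p q) : p ∈ S := by
  obtain ⟨γ, hγ, h0, h1, rfl⟩ := h.param
  exact ⟨0, ⟨le_rfl, dist_nonneg⟩, h0⟩

theorem IsSeg.right_mem {S : Set X} {p q : X} (h : IsSeg S p q) : q ∈ S := h.symm.left_mem

theorem IsSeg.isCompact {S : Set X} {p q : X} (h : IsSeg S p q) : IsCompact S := by
  obtain ⟨γ, hγ, h0, h1, rfl⟩ := h.param
  exact isCompact_Icc.image_of_continuousOn hγ.continuousOn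

theorem IsSeg.dist_add {S : Set X} {p q z : X} (h : IsSeg S p q) (hz : z ∈ S) :
    dist p z + dist z q = dist p q := by
  obtain ⟨γ, hγ, h0, h1, hS⟩ := h.param
  rw [hS] at hz
  obtain ⟨t, ht, rfl⟩ := hz
  have e1 : dist p (γ t) = t := by
    rw [← h0, hγ 0 ⟨le_rfl, dist_nonneg⟩ t ht, zero_sub, abs_neg, abs_of_nonneg ht.1]
  have e2 : dist (γ t) q = dist p q - t := by
    nth_rw 1 [← h1]
    rw [hγ t ht _ ⟨dist_nonneg, le_rfl⟩, abs_sub_comm, abs_of_nonneg (by linarith [ht.2])]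
  rw [e1, e2]; ring

theorem IsSeg.split {S : Set X} {p q z : X} (h : IsSeg S p q) (hz : z ∈ S) :
    ∃ S1 S2, IsSeg S1 p z ∧ IsSeg S2 z q ∧ S = S1 ∪ S2 := by
  obtain ⟨γ, hγ, h0, h1, hS⟩ := h.param
  rw [hS] at hz
  obtain ⟨t, ht, rfl⟩ := hz
  refine ⟨γ '' Icc 0 t, γ '' Icc t (dist p q), ?_, ?_, ?_⟩
  · have := hγ.isSeg le_rfl ht.1 ht.2
    rwa [h0] at this
  · have := hγ.isSeg ht.1 ht.2 le_rfl
    rwa [h1] at this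
  · rw [← image_union, Icc_union_Icc_eq_Icc ht.1 ht.2, hS]

theorem IsSeg.sub {S : Set X} {p q x y : X} (h : IsSeg S p q) (hx : x ∈ S) (hy : y ∈ S) :
    ∃ S', S' ⊆ S ∧ IsSeg S' x y := by
  obtain ⟨γ, hγ, h0, h1, hS⟩ := h.param
  rw [hS] at hx hy
  obtain ⟨s, hs, rfl⟩ := hx
  obtain ⟨t, ht, rfl⟩ := hy
  rcases le_total s t with hst | hst
  · refine ⟨γ '' Icc s t, ?_, hγ.isSeg hs.1 hst ht.2⟩
    rw [hS]; exact image_mono (Icc_subset_Icc hs.1 ht.2)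
  · refine ⟨γ '' Icc t s, ?_, (hγ.isSeg ht.1 hst hs.2).symm⟩
    rw [hS]; exact image_mono (Icc_subset_Icc ht.1 hs.2)

/-- The sub-segment between a point and the end; it is closer to the end. -/
theorem IsSeg.split_good {S S1 S2 : Set X} {p q z : X} (h : IsSeg S p q) (hz : z ∈ S)
    (h1 : IsSeg S1 p z) (h2 : IsSeg S2 z q) : Good S1 S2 z := by
  intro a ha b hb
  have e1 := h1.dist_add ha
  have e2 := h2.dist_add hb
  have e3 := h.dist_add hz
  have t1 := dist_triangle4 p a b q
  have t2 := dist_comm b z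
  have n1 := dist_nonneg (x := a) (y := z)
  have n2 := dist_nonneg (x := z) (y := b)
  constructor <;> linarith

/-- perpendicular corner: if `g` is a segment from `v` to `σ` and no point of `S` is closer to
`σ` than `v`, the corner is good. -/
theorem good_of_perp {S g : Set X} {v σ : X} (hg : IsSeg g v σ)
    (h : ∀ p ∈ S, dist v σ ≤ dist p σ) : Good S g v := by
  intro p hp q hq
  have e1 := hg.dist_add hq
  have e2 := h p hp
  have t1 := dist_triangle p q σ
  have t2 := dist_triangle p q v
  have t3 := dist_comm q v
  have t4 := dist_nonneg (x := p) (y := q)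
  constructor <;> linarith

theorem IsSeg.exists_at {S : Set X} {p q : X} (h : IsSeg S p q) {r : ℝ} (h0 : 0 ≤ r)
    (h1 : r ≤ dist p q) : ∃ z ∈ S, dist p z = r := by
  obtain ⟨γ, hγ, e0, e1, hS⟩ := h.param
  refine ⟨γ r, hS ▸ ⟨r, ⟨h0, h1⟩, rfl⟩, ?_⟩
  rw [← e0, hγ 0 ⟨le_rfl, dist_nonneg⟩ r ⟨h0, h1⟩, zero_sub, abs_neg, abs_of_nonneg h0]

/-- nearest points between compact sets -/
theorem exists_nearest_pair {S S' : Set X} (h : IsCompact S) (h' : IsCompact S')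
    (hn : S.Nonempty) (hn' : S'.Nonempty) :
    ∃ u ∈ S, ∃ v ∈ S', ∀ x ∈ S, ∀ y ∈ S', dist u v ≤ dist x y := by
  obtain ⟨⟨u, v⟩, ⟨hu, hv⟩, hm⟩ := (h.prod h').exists_isMinOn (hn.prod hn')
    (f := fun z : X × X => dist z.1 z.2) continuous_dist.continuousOn
  exact ⟨u, hu, v, hv, fun x hx y hy => hm (a := (x, y)) ⟨hx, hy⟩⟩

theorem exists_nearest {S : Set X} (h : IsCompact S) (hn : S.Nonempty) (p : X) :
    ∃ u ∈ S, ∀ x ∈ S, dist p u ≤ dist p x := by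
  obtain ⟨u, hu, hm⟩ := h.exists_isMinOn hn (f := fun z : X => dist p z)
    (continuous_const.dist continuous_id).continuousOn
  exact ⟨u, hu, fun x hx => hm hx⟩

/-- set of times at which a path is `lam`-close to a compact set is compact -/
theorem isCompact_touch {γ : ℝ → X} {lo hi lam : ℝ} (h : IsoOn γ lo hi) {U : Set X}
    (hU : IsCompact U) : IsCompact {t | t ∈ Icc lo hi ∧ ∃ y ∈ U, dist (γ t) y ≤ lam} := by
  have hc : IsCompact ((Icc lo hi) ×ˢ U) := isCompact_Icc.prod hU
  have hcont : ContinuousOn (fun z : ℝ × X => dist (γ z.1) z.2) ((Icc lo hi) ×ˢ U) := by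
    have c1 : ContinuousOn (fun z : ℝ × X => γ z.1) ((Icc lo hi) ×ˢ U) :=
      h.continuousOn.comp continuousOn_fst (fun z hz => hz.1)
    exact continuous_dist.comp_continuousOn (c1.prodMk continuousOn_snd)
  have hc2 : IsCompact ((Icc lo hi ×ˢ U) ∩ (fun z : ℝ × X => dist (γ z.1) z.2) ⁻¹' Iic lam) := by
    apply hc.of_isClosed_subset _ inter_subset_left
    exact hcont.preimage_isClosed_of_isClosed hc.isClosed isClosed_Iic
  have := hc2.image continuous_fst
  convert this using 1
  ext t; constructor
  · rintro ⟨ht, y, hy, hd⟩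
    exact ⟨(t, y), ⟨⟨ht, hy⟩, hd⟩, rfl⟩
  · rintro ⟨⟨s, y⟩, ⟨⟨hs, hy⟩, hd⟩, rfl⟩
    exact ⟨hs, y, hy, hd⟩

theorem exists_last_touch {γ : ℝ → X} {lo hi lam : ℝ} (h : IsoOn γ lo hi) {U : Set X}
    (hU : IsCompact U) (hne : ∃ t ∈ Icc lo hi, ∃ y ∈ U, dist (γ t) y ≤ lam) :
    ∃ t ∈ Icc lo hi, (∃ y ∈ U, dist (γ t) y ≤ lam) ∧
      ∀ s ∈ Icc lo hi, t < s → ∀ y ∈ U, lam < dist (γ s) y := by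
  obtain ⟨t0, ht0, hy0⟩ := hne
  obtain ⟨t, ht, hm⟩ := (isCompact_touch (lam := lam) h hU).exists_isGreatest ⟨t0, ht0, hy0⟩
  refine ⟨t, ht.1, ht.2, fun s hs hts y hy => ?_⟩
  by_contra hcon
  have := hm ⟨hs, y, hy, not_lt.mp hcon⟩
  linarith

theorem exists_first_touch {γ : ℝ → X} {lo hi lam : ℝ} (h : IsoOn γ lo hi) {U : Set X}
    (hU : IsCompact U) (hne : ∃ t ∈ Icc lo hi, ∃ y ∈ U, dist (γ t) y ≤ lam) :
    ∃ t ∈ Icc lo hi, (∃ y ∈ U, dist (γ t) y ≤ lam) ∧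
      ∀ s ∈ Icc lo hi, s < t → ∀ y ∈ U, lam < dist (γ s) y := by
  obtain ⟨t0, ht0, hy0⟩ := hne
  obtain ⟨t, ht, hm⟩ := (isCompact_touch (lam := lam) h hU).exists_isLeast ⟨t0, ht0, hy0⟩
  refine ⟨t, ht.1, ht.2, fun s hs hts y hy => ?_⟩
  by_contra hcon
  have := hm ⟨hs, y, hy, not_lt.mp hcon⟩
  linarith

/-- a bound beyond a point persists at the point -/
theorem IsoOn.ge_of_right {γ : ℝ → X} {lo hi a b lam : ℝ} (h : IsoOn γ lo hi) {y : X}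
    (h1 : lo ≤ a) (hab : a < b) (h2 : b ≤ hi)
    (hb : ∀ s ∈ Icc lo hi, a < s → s ≤ b → lam ≤ dist (γ s) y) : lam ≤ dist (γ a) y := by
  apply le_of_forall_pos_le_add
  intro ε hε
  have hs : a < min b (a + ε) := lt_min hab (by linarith)
  have hs1 : min b (a + ε) ≤ b := min_le_left _ _
  have hs2 : min b (a + ε) ≤ a + ε := min_le_right _ _
  have m1 : min b (a + ε) ∈ Icc lo hi := ⟨by linarith, by linarith⟩
  have e1 := hb _ m1 hs hs1
  have e2 := h _ m1 a ⟨h1, by linarith⟩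
  rw [abs_of_nonneg (by linarith)] at e2
  have := dist_triangle (γ (min b (a + ε))) (γ a) y
  linarith

theorem IsoOn.ge_of_left {γ : ℝ → X} {lo hi a b lam : ℝ} (h : IsoOn γ lo hi) {y : X}
    (h1 : lo ≤ b) (hab : b < a) (h2 : a ≤ hi)
    (hb : ∀ s ∈ Icc lo hi, b ≤ s → s < a → lam ≤ dist (γ s) y) : lam ≤ dist (γ a) y := by
  apply le_of_forall_pos_le_add
  intro ε hε
  have hs : max b (a - ε) < a := max_lt hab (by linarith)
  have hs1 : b ≤ max b (a - ε) := le_max_left _ _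
  have hs2 : a - ε ≤ max b (a - ε) := le_max_right _ _
  have m1 : max b (a - ε) ∈ Icc lo hi := ⟨by linarith, by linarith⟩
  have e1 := hb _ m1 hs1 hs
  have e2 := h _ m1 a ⟨by linarith, h2⟩
  rw [abs_sub_comm, abs_of_nonneg (by linarith)] at e2
  have := dist_triangle (γ (max b (a - ε))) (γ a) y
  linarith

theorem tubN_of_dist {δ r : ℝ} {A : Set X} {x y : X} (hx : x ∈ tubN δ A) (h : dist x y ≤ r) :
    y ∈ tubN (δ + r) A := by
  have h1 : infDist x A < δ := hx
  have h2 : infDist y A ≤ infDist x A + dist y x := infDist_le_infDist_add_dist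
  rw [dist_comm] at h2
  show infDist y A < δ + r
  linarith

theorem tubN_mono {δ r : ℝ} {A : Set X} {x : X} (hx : x ∈ tubN δ A) (h : δ ≤ r) :
    x ∈ tubN r A := lt_of_lt_of_le (show infDist x A < δ from hx) h

/-- The polygon property for `M`-gons with parameters. -/
def TProp (𝓐 : Set (Set X)) (M : ℤ) (H χ : ℝ) : Prop :=
  ∀ (S : ℤ → Set X) (v : ℤ → X),
    (∀ i, 0 ≤ i → i < M → IsSeg (S i) (v i) (v (i + 1))) →
    v M = v 0 →
    (∀ i, 0 ≤ i → i < M → H ≤ dist (v i) (v (i + 1))) →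
    (∀ i, 0 ≤ i → i + 1 < M → Good (S i) (S (i + 1)) (v (i + 1))) →
    Good (S (M - 1)) (S 0) (v 0) →
    (∀ i j, 0 ≤ i → i + 2 ≤ j → j < M → ¬ (i = 0 ∧ j = M - 1) → FarSep H (S i) (S j)) →
    ∃ A ∈ 𝓐, ∀ i, 0 ≤ i → i < M → S i ⊆ tubN χ A

theorem TProp.mono {𝓐 : Set (Set X)} {M : ℤ} {H χ H' χ' : ℝ} (h : TProp 𝓐 M H χ)
    (hH : H ≤ H') (hχ : χ ≤ χ') : TProp 𝓐 M H' χ' := by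
  intro S v h1 h2 h3 h4 h5 h6
  obtain ⟨A, hA, h⟩ := h S v h1 h2 (fun i a b => hH.trans (h3 i a b)) h4 h5
    (fun i j a b c d => (h6 i j a b c d).mono subset_rfl subset_rfl hH)
  exact ⟨A, hA, fun i a b x hx => tubN_mono (h i a b hx) hχ⟩

/-! ### Hexagons, and passing to fewer edges -/

theorem tprop_six {𝓐 : Set (Set X)} {θ ν χ : ℝ} (hθ : 0 < θ) (hν : 8 ≤ ν)
    (h : Beta3With 𝓐 θ ν χ) : TProp 𝓐 6 (2 * (ν * θ)) χ := by
  intro S v hseg hcl hlen hgood hgood0 hsep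
  have hνθ : 8 * θ ≤ ν * θ := mul_le_mul_of_nonneg_right hν hθ.le
  -- distances between different edges
  have F1core : ∀ a b : ℤ, 0 ≤ a → a < 6 → 0 ≤ b → b < 6 → a ≠ b → ∀ p ∈ S a, ∀ q ∈ S b,
      2 * θ ≤ dist p (v a) → 2 * θ ≤ dist p (v (a + 1)) → θ ≤ dist p q := by
    intro a b ha ha' hb hb' hab p hp q hq hd1 hd2
    by_cases c1 : b = a + 1
    · subst c1
      have := (hgood a ha hb' p hp q hq).1
      linarith
    by_cases c2 : a = b + 1
    · subst c2
      have := (hgood b hb ha' q hq p hp).2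
      rw [dist_comm q p] at this
      linarith
    by_cases c3 : a = 0 ∧ b = 5
    · obtain ⟨rfl, rfl⟩ := c3
      have := (hgood0 q hq p hp).2
      rw [dist_comm q p] at this
      linarith
    by_cases c4 : b = 0 ∧ a = 5
    · obtain ⟨rfl, rfl⟩ := c4
      have := (hgood0 p hp q hq).1
      norm_num at hd2
      rw [hcl] at hd2
      linarith
    rcases lt_or_gt_of_ne hab with hlt | hlt
    · have := hsep a b ha (by omega) hb' (by omega) p hp q hq
      linarith
    · have := hsep b a hb (by omega) ha' (by omega) q hq p hp
      rw [dist_comm q p] at this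
      linarith
  have F2core : ∀ a b : ℤ, 0 ≤ a → a < 6 → 0 ≤ b → b < 6 → a ≠ b → ¬ (b + 1 = a) →
      ¬ (b = 5 ∧ a = 0) → ∀ q ∈ S b, ν * θ ≤ dist (v a) q := by
    intro a b ha ha' hb hb' hab h1 h2 q hq
    have hva : v a ∈ S a := (hseg a ha ha').left_mem
    by_cases c1 : b = a + 1
    · subst c1
      have := (hgood a ha hb' _ hva q hq).1
      have := hlen a ha ha'
      linarith
    by_cases c4 : b = 0 ∧ a = 5
    · obtain ⟨rfl, rfl⟩ := c4
      have e1 := (hgood0 _ hva q hq).1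
      have e2 := hlen 5 ha ha'
      norm_num at e2
      rw [hcl] at e2
      linarith
    rcases lt_or_gt_of_ne hab with hlt | hlt
    · have := hsep a b ha (by omega) hb' (by omega) _ hva q hq
      linarith
    · have := hsep b a hb (by omega) ha' (by omega) q hq _ hva
      rw [dist_comm q] at this
      linarith
  have hpar : ∀ i : Fin 6, ∃ γ : ℝ → X, IsoOn γ 0 (dist (v (i.val : ℤ)) (v ((i.val : ℤ) + 1))) ∧
      γ 0 = v (i.val : ℤ) ∧ γ (dist (v (i.val : ℤ)) (v ((i.val : ℤ) + 1))) = v ((i.val : ℤ) + 1) ∧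
      S (i.val : ℤ) = γ '' Icc 0 (dist (v (i.val : ℤ)) (v ((i.val : ℤ) + 1))) := fun i =>
    (hseg i.val (by omega) (by have := i.isLt; omega)).param
  choose γ hγ hγ0 hγ1 hγS using hpar
  let P : PrePolygon X 6 := ⟨γ, fun i => dist (v (i.val : ℤ)) (v ((i.val : ℤ) + 1))⟩
  have hes : ∀ i : Fin 6, P.edgeSet i = S (i.val : ℤ) := fun i => (hγS i).symm
  have hsucc : ∀ i : Fin 6, v ((finCycSucc i).val : ℤ) = v ((i.val : ℤ) + 1) := by
    intro i
    fin_cases i <;> simp [finCycSucc] <;> exact hcl.symm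
  have hgeo : P.IsGeodesicPolygon := by
    refine ⟨⟨fun i => dist_nonneg, fun i => ?_⟩, fun i => ⟨dist_nonneg, hγ i⟩⟩
    show γ i (dist (v (i.val : ℤ)) (v ((i.val : ℤ) + 1))) = γ (finCycSucc i) 0
    rw [hγ1, hγ0, hsucc]
  have hfat : P.IsFat2 θ ν := by
    constructor
    · intro i p hp hd1 hd2
      have hp' := hp
      rw [hes] at hp'
      have hd1' : 2 * θ ≤ dist p (γ i 0) := hd1
      have hd2' : 2 * θ ≤ dist p (γ i (dist (v (i.val : ℤ)) (v ((i.val : ℤ) + 1)))) := hd2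
      rw [hγ0] at hd1'
      rw [hγ1] at hd2'
      have hcore : ∀ j : Fin 6, j ≠ i → ∀ q ∈ S (j.val : ℤ), θ ≤ dist p q := by
        intro j hj q hq
        have := i.isLt
        have := j.isLt
        exact F1core i.val j.val (by omega) (by omega) (by omega) (by omega)
          (fun hh => hj (Fin.ext (by omega))) p hp' q hq hd1' hd2'
      rw [le_infDist]
      · rintro q ⟨hq, hqi⟩
        obtain ⟨j, hj⟩ := mem_iUnion.mp hq
        have hji : j ≠ i := by rintro rfl; exact hqi hj
        rw [hes] at hj
        exact hcore j hji q hj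
      · -- opposite edge
        let j : Fin 6 := i + 3
        have hj : ((i.val : ℤ) + 3 = j.val) ∨ ((j.val : ℤ) + 3 = i.val) := by
          fin_cases i <;> simp [j]
        have i1 := i.isLt
        have j1 := j.isLt
        have hsepij : ∀ x ∈ S (i.val : ℤ), ∀ y ∈ S (j.val : ℤ), 0 < dist x y := by
          intro x hx y hy
          rcases hj with hj | hj
          · have := hsep i.val j.val (by omega) (by omega) (by omega) (by omega) x hx y hy
            linarith
          · have := hsep j.val i.val (by omega) (by omega) (by omega) (by omega) y hy x hx
            rw [dist_comm] at this
            linarith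
        have hvj : v (j.val : ℤ) ∈ S (j.val : ℤ) := (hseg j.val (by omega) (by omega)).left_mem
        refine ⟨v (j.val : ℤ), mem_iUnion.mpr ⟨j, by rw [hes]; exact hvj⟩, ?_⟩
        rw [hes]
        intro hc
        have := hsepij _ hc _ hvj
        simp at this
    · intro i
      have i1 := i.isLt
      have hv : P.vertex i = v (i.val : ℤ) := hγ0 i
      rw [le_infDist]
      · intro q hq
        simp only [PrePolygon.opp, mem_iUnion, mem_ofPred_eq] at hq
        obtain ⟨j, ⟨hj1, hj2⟩, hq⟩ := hq
        rw [hes] at hq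
        have j1 := j.isLt
        rw [hv]
        have hj1' : (j.val : ℤ) ≠ i.val := fun hh => hj1 (Fin.ext (by omega))
        have hj2' : (j.val + 1) % 6 ≠ i.val := fun hh => hj2 (Fin.ext hh)
        exact F2core i.val j.val (by omega) (by omega) (by omega) (by omega) hj1'.symm
          (by omega) (by omega) q hq
      · have hne : ∃ j : Fin 6, j ≠ i ∧ finCycSucc j ≠ i := by
          refine ⟨i + 3, ?_⟩
          fin_cases i <;> simp [finCycSucc]
        obtain ⟨j, hj⟩ := hne
        have j1 := j.isLt
        refine ⟨v (j.val : ℤ), ?_⟩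
        simp only [PrePolygon.opp, mem_iUnion, mem_ofPred_eq]
        exact ⟨j, hj, by rw [hes]; exact (hseg j.val (by omega) (by omega)).left_mem⟩
  obtain ⟨A, hA, hsub⟩ := h P hgeo hfat
  refine ⟨A, hA, fun i hi hi' => ?_⟩
  have : S i = P.edgeSet (⟨i.toNat, by omega⟩ : Fin 6) := by
    rw [hes]
    congr 1
    simp [hi]
  rw [this]
  exact (subset_iUnion P.edgeSet _).trans hsub

/-- An `M`-gon can be seen as an `(M+1)`-gon by cutting its first edge. -/
theorem TProp.pred {𝓐 : Set (Set X)} {M : ℤ} {H χ : ℝ} (hM : 3 ≤ M) (hH : 0 < H)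
    (h : TProp 𝓐 (M + 1) H χ) : TProp 𝓐 M (4 * H) χ := by
  intro S v hseg hcl hlen hgood hgood0 hsep
  have s0 : IsSeg (S 0) (v 0) (v 1) := hseg 0 le_rfl (by omega)
  have l0 := hlen 0 le_rfl (by omega)
  norm_num at l0
  obtain ⟨z, hz, hz1⟩ := s0.exists_at (r := dist (v 0) (v 1) / 2) (by positivity)
    (by linarith [dist_nonneg (x := v 0) (y := v 1)])
  have hz2 := s0.dist_add hz
  obtain ⟨S1, S2, hS1, hS2, hS⟩ := s0.split hz
  have sub1 : S1 ⊆ S 0 := hS ▸ subset_union_left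
  have sub2 : S2 ⊆ S 0 := hS ▸ subset_union_right
  have g01 := hgood 0 le_rfl (by omega)
  norm_num at g01
  let S' : ℤ → Set X := fun i => if i = 0 then S1 else if i = 1 then S2 else S (i - 1)
  let v' : ℤ → X := fun i => if i = 0 then v 0 else if i = 1 then z else v (i - 1)
  have S'2 : ∀ i, 2 ≤ i → S' i = S (i - 1) := fun i hi => by
    simp only [S']; rw [if_neg (by omega), if_neg (by omega)]
  have v'2 : ∀ i, 2 ≤ i → v' i = v (i - 1) := fun i hi => by
    simp only [v']; rw [if_neg (by omega), if_neg (by omega)]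
  have S'0 : S' 0 = S1 := rfl
  have S'1 : S' 1 = S2 := rfl
  have v'0 : v' 0 = v 0 := rfl
  have v'1 : v' 1 = z := rfl
  have v'22 : v' 2 = v 1 := rfl
  have S'22 : S' 2 = S 1 := rfl
  have key : ∃ A ∈ 𝓐, ∀ i, 0 ≤ i → i < M + 1 → S' i ⊆ tubN χ A := by
    refine h S' v' ?_ ?_ ?_ ?_ ?_ ?_
    · intro i hi hi'
      by_cases c0 : i = 0
      · subst c0; exact hS1
      by_cases c1 : i = 1
      · subst c1; exact hS2
      rw [S'2 i (by omega), v'2 i (by omega), v'2 (i + 1) (by omega)]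
      have := hseg (i - 1) (by omega) (by omega)
      rwa [show i - 1 + 1 = i + 1 - 1 by ring] at this
    · rw [v'2 _ (by omega), v'0]; simpa using hcl
    · intro i hi hi'
      by_cases c0 : i = 0
      · subst c0; show H ≤ dist (v 0) z; linarith
      by_cases c1 : i = 1
      · subst c1; show H ≤ dist z (v 1); linarith
      rw [v'2 i (by omega), v'2 (i + 1) (by omega)]
      have := hlen (i - 1) (by omega) (by omega)
      rw [show i - 1 + 1 = i + 1 - 1 by ring] at this
      linarith
    · intro i hi hi'
      by_cases c0 : i = 0
      · subst c0; exact s0.split_good hz hS1 hS2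
      by_cases c1 : i = 1
      · subst c1; exact g01.mono sub2 subset_rfl
      rw [S'2 i (by omega), v'2 (i + 1) (by omega), S'2 (i + 1) (by omega)]
      have := hgood (i - 1) (by omega) (by omega)
      rwa [show i - 1 + 1 = i + 1 - 1 by ring] at this
    · rw [S'2 _ (by omega)]
      have := hgood0.mono subset_rfl sub1
      rw [show M + 1 - 1 - 1 = M - 1 by ring]
      exact this
    · intro i j hi hij hj hne
      by_cases c0 : i = 0
      · subst c0
        rw [S'2 j (by omega)]
        by_cases c2 : j = 2
        · subst c2
          intro x hx y hy
          have e1 := (g01 x (sub1 hx) y hy).1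
          have e2 := hS1.dist_add hx
          have e3 := dist_triangle z x (v 1)
          rw [dist_comm z x] at e3
          have e4 := dist_nonneg (x := v 0) (y := x)
          have e5 := s0.dist_add (sub1 hx)
          linarith
        · exact (hsep 0 (j - 1) le_rfl (by omega) (by omega) (by omega)).mono sub1 subset_rfl
            (by linarith)
      by_cases c1 : i = 1
      · subst c1
        rw [S'2 j (by omega)]
        by_cases c2 : j = M
        · subst c2
          intro x hx y hy
          have e1 := (hgood0 y hy x (sub2 hx)).2
          have e2 := hS2.dist_add hx
          have e5 := s0.dist_add (sub2 hx)
          rw [dist_comm y x, dist_comm x (v 0)] at e1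
          have e4 := dist_nonneg (x := x) (y := v 1)
          have e6 := dist_nonneg (x := z) (y := x)
          linarith
        · exact (hsep 0 (j - 1) le_rfl (by omega) (by omega) (by omega)).mono sub2 subset_rfl
            (by linarith)
      rw [S'2 i (by omega), S'2 j (by omega)]
      exact (hsep (i - 1) (j - 1) (by omega) (by omega) (by omega) (by omega)).mono subset_rfl
        subset_rfl (by linarith)
  obtain ⟨A, hA, hsub⟩ := key
  refine ⟨A, hA, fun i hi hi' => ?_⟩
  rcases eq_or_lt_of_le hi with rfl | hi0
  · rw [hS]
    exact union_subset (hsub 0 le_rfl (by omega)) (hsub 1 (by omega) (by omega))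
  · have := hsub (i + 1) (by omega) (by omega)
    rw [S'2 _ (by omega)] at this
    simpa using this

/-! ### Chains of segments running along a geodesic -/

/-- A chain of `n` inner segments with two extremal ones. -/
structure ChainP (n : ℤ) (E : ℤ → Set X) (W : ℤ → X) (H : ℝ) : Prop where
  seg : ∀ k, 0 ≤ k → k ≤ n + 1 → IsSeg (E k) (W k) (W (k + 1))
  good : ∀ k, 0 ≤ k → k ≤ n → Good (E k) (E (k + 1)) (W (k + 1))
  sep : ∀ i j, 0 ≤ i → i + 2 ≤ j → j ≤ n + 1 → FarSep H (E i) (E j)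
  len : ∀ k, 1 ≤ k → k ≤ n → H ≤ dist (W k) (W (k + 1))

theorem ChainP.refl {n : ℤ} {E : ℤ → Set X} {W : ℤ → X} {H : ℝ} (h : ChainP n E W H) :
    ChainP n (fun k => E (n + 1 - k)) (fun k => W (n + 2 - k)) H where
  seg k h0 h1 := by
    have := (h.seg (n + 1 - k) (by omega) (by omega)).symm
    show IsSeg (E (n + 1 - k)) (W (n + 2 - k)) (W (n + 2 - (k + 1)))
    rw [show n + 2 - k = n + 1 - k + 1 by ring, show n + 2 - (k + 1) = n + 1 - k by ring]
    exact this
  good k h0 h1 := by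
    have := (h.good (n - k) (by omega) (by omega)).symm
    show Good (E (n + 1 - k)) (E (n + 1 - (k + 1))) (W (n + 2 - (k + 1)))
    rw [show n + 1 - (k + 1) = n - k by ring, show n + 2 - (k + 1) = n - k + 1 by ring,
      show n + 1 - k = n - k + 1 by ring]
    exact this
  sep i j h0 h1 h2 := (h.sep (n + 1 - j) (n + 1 - i) (by omega) (by omega) (by omega)).symm
  len k h0 h1 := by
    have := h.len (n + 1 - k) (by omega) (by omega)
    show H ≤ dist (W (n + 2 - k)) (W (n + 2 - (k + 1)))
    rw [dist_comm, show n + 2 - k = n + 1 - k + 1 by ring, show n + 2 - (k + 1) = n + 1 - k by ring]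
    exact this

/-- the geodesic starts perpendicularly at the start of the chain -/
def StartC (γ : ℝ → X) (lo hi : ℝ) (E : ℤ → Set X) (W : ℤ → X) : Prop :=
  γ lo = W 0 ∧ ∀ t ∈ Icc lo hi, ∀ y ∈ E 0, t - lo ≤ dist (γ t) y

/-- the geodesic ends perpendicularly at the end of the chain -/
def EndC (γ : ℝ → X) (lo hi : ℝ) (n : ℤ) (E : ℤ → Set X) (W : ℤ → X) : Prop :=
  γ hi = W (n + 2) ∧ ∀ t ∈ Icc lo hi, ∀ y ∈ E (n + 1), hi - t ≤ dist (γ t) y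

/-- A free interval at level `lam`, with the data of its two ends. -/
structure LevelP (γ : ℝ → X) (lo hi d : ℝ) (n : ℤ) (E : ℤ → Set X) (W : ℤ → X)
    (lam α β : ℝ) (ma mb : ℤ) : Prop where
  hlo : lo ≤ α
  hhi : β ≤ hi
  hd : α + d ≤ β
  free : ∀ t ∈ Icc α β, ∀ k, 1 ≤ k → k ≤ n → ∀ y ∈ E k, lam ≤ dist (γ t) y
  aend : (ma = 0 ∧ α = lo ∧ StartC γ lo hi E W) ∨
    (1 ≤ ma ∧ ma ≤ n ∧ ∃ σ ∈ E ma, dist (γ α) σ ≤ lam)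
  bend : (mb = n + 1 ∧ β = hi ∧ EndC γ lo hi n E W) ∨
    (1 ≤ mb ∧ mb ≤ n ∧ ∃ σ ∈ E mb, dist (γ β) σ ≤ lam)

theorem IsoOn.neg {γ : ℝ → X} {lo hi : ℝ} (h : IsoOn γ lo hi) :
    IsoOn (fun t => γ (-t)) (-hi) (-lo) := by
  intro s hs t ht
  show dist (γ (-s)) (γ (-t)) = _
  rw [h (-s) ⟨by linarith [hs.2], by linarith [hs.1]⟩ (-t) ⟨by linarith [ht.2], by linarith [ht.1]⟩,
    abs_sub_comm]
  congr 1; ring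

theorem LevelP.mirror {γ : ℝ → X} {lo hi d : ℝ} {n : ℤ} {E : ℤ → Set X} {W : ℤ → X}
    {lam α β : ℝ} {ma mb : ℤ} (h : LevelP γ lo hi d n E W lam α β ma mb) :
    LevelP (fun t => γ (-t)) (-hi) (-lo) d n (fun k => E (n + 1 - k)) (fun k => W (n + 2 - k))
      lam (-β) (-α) (n + 1 - mb) (n + 1 - ma) where
  hlo := by linarith [h.hhi]
  hhi := by linarith [h.hlo]
  hd := by linarith [h.hd]
  free t ht k h0 h1 y hy := h.free (-t) ⟨by linarith [ht.2], by linarith [ht.1]⟩ (n + 1 - k)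
    (by omega) (by omega) y hy
  aend := by
    rcases h.bend with ⟨h1, h2, h3⟩ | ⟨h1, h2, h3⟩
    · refine Or.inl ⟨by omega, by rw [h2], ?_, ?_⟩
      · show γ (- -hi) = W (n + 2 - 0)
        rw [neg_neg, sub_zero]; exact h3.1
      · intro t ht y hy
        have := h3.2 (-t) ⟨by linarith [ht.2], by linarith [ht.1]⟩ y (by simpa using hy)
        show t - -hi ≤ dist (γ (-t)) y
        linarith
    · refine Or.inr ⟨by omega, by omega, ?_⟩
      show ∃ σ ∈ E (n + 1 - (n + 1 - mb)), dist (γ (- -β)) σ ≤ lam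
      rwa [neg_neg, show n + 1 - (n + 1 - mb) = mb by ring]
  bend := by
    rcases h.aend with ⟨h1, h2, h3⟩ | ⟨h1, h2, h3⟩
    · refine Or.inl ⟨by omega, by rw [h2], ?_, ?_⟩
      · show γ (- -lo) = W (n + 2 - (n + 2))
        rw [neg_neg, sub_self]; exact h3.1
      · intro t ht y hy
        have := h3.2 (-t) ⟨by linarith [ht.2], by linarith [ht.1]⟩ y (by simpa using hy)
        show -lo - t ≤ dist (γ (-t)) y
        linarith
    · refine Or.inr ⟨by omega, by omega, ?_⟩
      show ∃ σ ∈ E (n + 1 - (n + 1 - ma)), dist (γ (- -α)) σ ≤ lam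
      rwa [neg_neg, show n + 1 - (n + 1 - ma) = ma by ring]

/-- The left end of the polygon cut out by a geodesic and a chain. -/
structure EndOut (γ : ℝ → X) (α β x Λ : ℝ) (n : ℤ) (E : ℤ → Set X) (W : ℤ → X)
    (ma mb m : ℤ) (a : ℝ) (g : Set X) (σ : X) : Prop where
  hm1 : 1 ≤ m
  hm2 : m ≤ n
  mem : σ ∈ E m
  seg : IsSeg g (γ a) σ
  glen : x ≤ dist (γ a) σ
  ha1 : α ≤ a
  ha2 : a ≤ α + 2 * Λ
  goodbase : Good (γ '' Icc a β) g (γ a)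
  far : ∀ y ∈ g, ∀ t ∈ Icc a β, t - a - Λ ≤ dist (γ t) y
  sep : ∀ k, m < k → k ≤ mb → k ≤ n → FarSep x g (E k)
  gooc : Good (E m) g σ
  clen : m < mb → m < n → x ≤ dist σ (W (m + 1))
  gap : dist (γ a) σ ≤ Λ ∨ (g = E 0 ∧ m = 1 ∧ σ = W 1)
  ver : ∀ k, ma < k → k ≤ m → dist (γ a) (W k) ≤ 4 * Λ ∨ W k = σ
  alt : m = ma ∨ (m = ma + 1 ∧ ma = 0) ∨ (m = ma + 1 ∧ ma < mb ∧ dist (γ α) (W (ma + 1)) ≤ 2 * Λ)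

/-- The right end of the polygon cut out by a geodesic and a chain. -/
structure EndOutB (γ : ℝ → X) (α β x Λ : ℝ) (n : ℤ) (E : ℤ → Set X) (W : ℤ → X)
    (ma mb m : ℤ) (b : ℝ) (g : Set X) (σ : X) : Prop where
  hm1 : 1 ≤ m
  hm2 : m ≤ n
  mem : σ ∈ E m
  seg : IsSeg g (γ b) σ
  glen : x ≤ dist (γ b) σ
  hb1 : b ≤ β
  hb2 : β - 2 * Λ ≤ b
  goodbase : Good (γ '' Icc α b) g (γ b)
  far : ∀ y ∈ g, ∀ t ∈ Icc α b, b - t - Λ ≤ dist (γ t) y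
  sep : ∀ k, k < m → ma ≤ k → 1 ≤ k → FarSep x g (E k)
  gooc : Good (E m) g σ
  clen : ma < m → 1 < m → x ≤ dist σ (W m)
  gap : dist (γ b) σ ≤ Λ ∨ (g = E (n + 1) ∧ m = n ∧ σ = W (n + 1))
  ver : ∀ k, m < k → k ≤ mb → dist (γ b) (W k) ≤ 4 * Λ ∨ W k = σ
  alt : m = mb ∨ (m = mb - 1 ∧ mb = n + 1) ∨ (m = mb - 1 ∧ ma < mb ∧ dist (γ β) (W mb) ≤ 2 * Λ)

theorem EndOut.mirror {γ : ℝ → X} {α β x Λ : ℝ} {n : ℤ} {E : ℤ → Set X} {W : ℤ → X}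
    {ma mb m : ℤ} {a : ℝ} {g : Set X} {σ : X}
    (h : EndOut (fun t => γ (-t)) (-β) (-α) x Λ n (fun k => E (n + 1 - k))
      (fun k => W (n + 2 - k)) (n + 1 - mb) (n + 1 - ma) m a g σ) :
    EndOutB γ α β x Λ n E W ma mb (n + 1 - m) (-a) g σ where
  hm1 := by have := h.hm2; omega
  hm2 := by have := h.hm1; omega
  mem := h.mem
  seg := h.seg
  glen := h.glen
  hb1 := by have := h.ha1; linarith
  hb2 := by have := h.ha2; linarith
  goodbase := by
    refine h.goodbase.mono ?_ subset_rfl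
    rintro _ ⟨t, ht, rfl⟩
    exact ⟨-t, ⟨by linarith [ht.2], by linarith [ht.1]⟩, by simp⟩
  far y hy t ht := by
    have := h.far y hy (-t) ⟨by linarith [ht.2], by linarith [ht.1]⟩
    simp only [neg_neg] at this
    linarith
  sep k h1 h2 h3 := by
    have := h.sep (n + 1 - k) (by omega) (by omega) (by omega)
    simpa using this
  gooc := h.gooc
  clen h1 h2 := by
    have := h.clen (by omega) (by omega)
    rwa [show n + 2 - (m + 1) = n + 1 - m by ring] at this
  gap := by
    rcases h.gap with h1 | ⟨h1, h2, h3⟩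
    · exact Or.inl h1
    · refine Or.inr ⟨by simpa using h1, by omega, ?_⟩
      rw [h3]
      show W (n + 2 - 1) = W (n + 1)
      congr 1; ring
  ver k h1 h2 := by
    have := h.ver (n + 2 - k) (by omega) (by omega)
    simpa using this
  alt := by
    rcases h.alt with h1 | ⟨h1, h2⟩ | ⟨h1, h2, h3⟩
    · left; omega
    · right; left; constructor <;> omega
    · right; right
      refine ⟨by omega, by omega, ?_⟩
      simp only [neg_neg] at h3
      rwa [show n + 2 - (n + 1 - mb + 1) = mb by ring] at h3

theorem IsoOn.dist_le {γ : ℝ → X} {lo hi a b : ℝ} (h : IsoOn γ lo hi) (h1 : lo ≤ a) (hab : a ≤ b)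
    (h2 : b ≤ hi) : dist (γ a) (γ b) = b - a := by
  rw [h a ⟨h1, hab.trans h2⟩ b ⟨h1.trans hab, h2⟩, abs_sub_comm, abs_of_nonneg (by linarith)]

/-- Construction of the left end of the polygon. -/
theorem exists_endOut {γ : ℝ → X} {lo hi d x Λ H lam lam' α β α' β' : ℝ} {n : ℤ} {E : ℤ → Set X}
    {W : ℤ → X} {ma mb : ℤ} (hX : GeodesicSpace X) (hγ : IsoOn γ lo hi) (hC : ChainP n E W H)
    (hn : 1 ≤ n)
    (hx : 0 < x) (hlam : x ≤ lam) (hlam' : lam + 5 * x ≤ lam') (hΛ : lam' + 4 * x ≤ Λ)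
    (hd : 100 * Λ ≤ d) (hH : 100 * Λ ≤ H) (hL : LevelP γ lo hi d n E W lam α β ma mb)
    (hL' : LevelP γ lo hi d n E W lam' α' β' ma mb)
    (hnear : (∃ σ ∈ E ma, dist (γ α) σ ≤ lam ∧ dist σ (W (ma + 1)) < 4 * x) →
      (∃ σ ∈ E ma, dist (γ α') σ ≤ lam' ∧ dist σ (W (ma + 1)) < 4 * x)) :
    ∃ m a g σ, EndOut γ α β x Λ n E W ma mb m a g σ := by
  have hab := hL.hd
  have hlo := hL.hlo
  have hhi := hL.hhi
  have hab' := hL'.hd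
  have hlo' := hL'.hlo
  have hhi' := hL'.hhi
  rcases hL.aend with ⟨rfl, rfl, hst⟩ | ⟨hm1, hm2, hto⟩
  · -- start
    have s0 := hC.seg 0 le_rfl (by omega)
    have s1 := hC.seg 1 (by omega) (by omega)
    have g0 := hC.good 0 le_rfl (by omega)
    rw [zero_add] at s0 g0
    refine ⟨1, α, E 0, W 1, le_rfl, hn, s1.left_mem, hst.1 ▸ s0, ?_, le_rfl, by linarith, ?_, ?_,
      ?_, g0.symm, ?_, Or.inr ⟨rfl, rfl, rfl⟩, ?_, Or.inr (Or.inl ⟨rfl, rfl⟩)⟩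
    · have := hL.free α ⟨le_rfl, by linarith⟩ 1 le_rfl hn _ s1.left_mem
      linarith
    · rintro _ ⟨t, ht, rfl⟩ q hq
      have e1 := hst.2 t ⟨ht.1, ht.2.trans hhi⟩ q hq
      have e2 := hγ.dist_le le_rfl ht.1 (ht.2.trans hhi)
      have e3 := dist_triangle q (γ t) (γ α)
      rw [dist_comm] at e2
      rw [dist_comm q (γ t)] at e3
      have := ht.1
      constructor <;> linarith
    · intro y hy t ht
      have e1 := hst.2 t ⟨ht.1, ht.2.trans hhi⟩ y hy
      linarith
    · intro k h1 h2 h3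
      exact (hC.sep 0 k le_rfl (by omega) (by omega)).mono subset_rfl subset_rfl (by linarith)
    · intro h1 h2
      have := hC.len 1 le_rfl hn
      linarith
    · intro k h1 h2
      have : k = 1 := by omega
      subst this
      exact Or.inr rfl
  · by_cases hbad : ma < mb ∧ ∃ σ ∈ E ma, dist (γ α) σ ≤ lam ∧ dist σ (W (ma + 1)) < 4 * x
    · -- bad touch
      obtain ⟨hmab, hn1⟩ := hbad
      obtain ⟨σ2, hσ2, hσa2, hσb2⟩ := hnear hn1
      obtain ⟨σ1, hσ1, hσa1, hσb1⟩ := hn1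
      have w1 : dist (γ α) (W (ma + 1)) < lam + 4 * x := by
        linarith [dist_triangle (γ α) σ1 (W (ma + 1))]
      have w2 : dist (γ α') (W (ma + 1)) < lam' + 4 * x := by
        linarith [dist_triangle (γ α') σ2 (W (ma + 1))]
      have hman : ma + 1 ≤ n := by
        rcases hL.bend with ⟨h1, h2, h3⟩ | ⟨h1, h2, h3⟩
        · by_contra hcon
          have : ma = n := by omega
          subst this
          have := h3.2 α ⟨hlo, by linarith⟩ (W (ma + 1))
            (hC.seg (ma + 1) (by omega) le_rfl).left_mem
          linarith
        · omega
      have hWm : W (ma + 1) ∈ E (ma + 1) := (hC.seg (ma + 1) (by omega) (by omega)).left_mem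
      have hαα : dist (γ α) (γ α') ≤ 2 * Λ := by
        have := dist_triangle_right (γ α) (γ α') (W (ma + 1))
        linarith
      rw [hγ α ⟨hlo, by linarith⟩ α' ⟨hlo', by linarith⟩] at hαα
      have hαα' := abs_le.mp hαα
      have hle : α ≤ α' := by
        by_contra hcon
        have := hL'.free α ⟨by linarith, by linarith⟩ (ma + 1) (by omega) hman _ hWm
        linarith
      obtain ⟨a, ha, ⟨y0, hy0, hy0d⟩, hlast⟩ := exists_last_touch (lam := lam + 4 * x)
        (hγ.mono hlo (show α' ≤ hi by linarith))
        (hC.seg (ma + 1) (by omega) (by omega)).isCompact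
        ⟨α, ⟨le_rfl, hle⟩, _, hWm, w1.le⟩
      have haα' : a < α' := by
        rcases lt_or_eq_of_le ha.2 with h | h
        · exact h
        · exfalso
          subst h
          have := hL'.free a ⟨le_rfl, by linarith⟩ (ma + 1) (by omega) hman _ hy0
          linarith
      have ha1 := ha.1
      have hfr : ∀ t, a ≤ t → t ≤ β → ∀ y ∈ E (ma + 1), t ≤ β' → lam + 4 * x ≤ dist (γ t) y := by
        intro t ht1 ht2 y hy ht3
        rcases lt_or_ge α' t with h | h
        · have := hL'.free t ⟨h.le, ht3⟩ (ma + 1) (by omega) hman _ hy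
          linarith
        · rcases eq_or_lt_of_le ht1 with h' | h'
          · subst h'
            exact (hγ.mono hlo (show α' ≤ hi by linarith)).ge_of_right ha1 haα' le_rfl
              (fun s hs h1 h2 => (hlast s hs h1 y hy).le)
          · exact (hlast t ⟨by linarith, h⟩ h' y hy).le
      obtain ⟨σ, hσ, hσn⟩ := exists_nearest (hC.seg (ma + 1) (by omega) (by omega)).isCompact
        ⟨y0, hy0⟩ (γ a)
      have hσd : dist (γ a) σ ≤ lam + 4 * x := (hσn y0 hy0).trans hy0d
      have hσd' := hfr a le_rfl (by linarith) σ hσ (by linarith)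
      obtain ⟨g, hg⟩ := hX.exists_seg (γ a) σ
      have gle : ∀ y ∈ g, dist (γ a) y ≤ Λ := fun y hy => by
        have := hg.dist_add hy
        linarith [dist_nonneg (x := y) (y := σ)]
      have hσW : dist σ (W (ma + 1)) ≤ 4 * Λ := by
        have e1 := hγ.dist_le hlo ha1 (by linarith)
        have e2 := dist_triangle4 σ (γ a) (γ α) (W (ma + 1))
        rw [dist_comm σ (γ a), dist_comm (γ a) (γ α)] at e2
        linarith
      have hgeo : ∀ t ∈ Icc a β, ∀ y ∈ g, t - a - Λ ≤ dist (γ t) y := by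
        intro t ht y hy
        have e1 := hγ.dist_le (show lo ≤ a by linarith) ht.1 (ht.2.trans hhi)
        have e2 := dist_triangle_right (γ a) (γ t) y
        have e3 := gle y hy
        linarith
      have hnext : ma + 1 ≤ n → H - 4 * Λ ≤ dist σ (W (ma + 1 + 1)) := fun h => by
        have e1 := hC.len (ma + 1) (by omega) h
        have e2 := dist_triangle_left (W (ma + 1)) (W (ma + 1 + 1)) σ
        linarith
      refine ⟨ma + 1, a, g, σ, by omega, hman, hσ, hg, by linarith, ha1, by linarith, ?_,
        fun y hy t ht => hgeo t ht y hy, ?_, ?_, ?_, Or.inl (by linarith), ?_,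
        Or.inr (Or.inr ⟨rfl, hmab, by linarith⟩)⟩
      · apply good_of_perp hg
        rintro _ ⟨t, ht, rfl⟩
        rcases le_or_gt t β' with h | h
        · exact hσd.trans (hfr t ht.1 ht.2 σ hσ h)
        · have := hgeo t ht σ hg.right_mem
          linarith
      · intro k h1 h2 h3 y hy z hz
        have e1 : (H - 4 * Λ) / 2 ≤ dist σ z := by
          by_cases hk : k = ma + 1 + 1
          · subst hk
            have e1 := (hC.good (ma + 1) (by omega) hman σ hσ z hz).1
            have e2 := hnext hman
            linarith
          · have := hC.sep (ma + 1) k (by omega) (by omega) (by omega) σ hσ z hz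
            linarith
        have e2 := hg.dist_add hy
        have e3 := dist_triangle_left σ z y
        have := dist_nonneg (x := γ a) (y := y)
        linarith
      · exact good_of_perp hg.symm (fun p hp => by
          rw [dist_comm σ, dist_comm p]; exact hσn p hp)
      · intro h1 h2
        have := hnext hman
        linarith
      · intro k h1 h2
        have : k = ma + 1 := by omega
        subst this
        left
        have e2 := dist_triangle (γ a) σ (W (ma + 1))
        have e1 := hγ.dist_le hlo ha1 (by linarith)
        have e3 := dist_triangle_left (γ a) (W (ma + 1)) (γ α)
        linarith
    · -- ordinary touch
      obtain ⟨y0, hy0, hy0d⟩ := hto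
      obtain ⟨σ, hσ, hσn⟩ := exists_nearest (hC.seg ma (by omega) (by omega)).isCompact
        ⟨y0, hy0⟩ (γ α)
      have hσd : dist (γ α) σ ≤ lam := (hσn y0 hy0).trans hy0d
      have hfr := fun t ht y hy => hL.free t ht ma hm1 hm2 y hy
      have hσd' := hfr α ⟨le_rfl, by linarith⟩ σ hσ
      obtain ⟨g, hg⟩ := hX.exists_seg (γ α) σ
      have hnb : ma < mb → 4 * x ≤ dist σ (W (ma + 1)) := fun h => by
        by_contra hcon
        exact hbad ⟨h, σ, hσ, hσd, not_le.mp hcon⟩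
      refine ⟨ma, α, g, σ, hm1, hm2, hσ, hg, by linarith, le_rfl, by linarith, ?_, ?_, ?_, ?_, ?_,
        Or.inl (by linarith), ?_, Or.inl rfl⟩
      · apply good_of_perp hg
        rintro _ ⟨t, ht, rfl⟩
        exact hσd.trans (hfr t ht σ hσ)
      · intro y hy t ht
        have e1 := hγ.dist_le hlo ht.1 (ht.2.trans hhi)
        have e2 := dist_triangle_right (γ α) (γ t) y
        have e3 := hg.dist_add hy
        linarith [dist_nonneg (x := y) (y := σ)]
      · intro k h1 h2 h3 y hy z hz
        have e2 := hg.dist_add hy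
        have e3 := dist_triangle_left σ z y
        by_cases hk : k = ma + 1
        · subst hk
          have e1 := (hC.good ma (by omega) hm2 σ hσ z hz).1
          have e4 := hnb (by omega)
          have e5 := hL.free α ⟨le_rfl, by linarith⟩ (ma + 1) (by omega) h3 z hz
          have e6 := dist_triangle (γ α) y z
          linarith
        · have := hC.sep ma k (by omega) (by omega) (by omega) σ hσ z hz
          have := dist_nonneg (x := γ α) (y := y)
          linarith
      · exact good_of_perp hg.symm (fun p hp => by
          rw [dist_comm σ, dist_comm p]; exact hσn p hp)
      · intro h1 h2
        linarith [hnb h1]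
      · intro k h1 h2
        omega

/-- The polygon bounded by a piece of the geodesic and a piece of the chain. -/
theorem polygon_of_ends {𝓐 : Set (Set X)} {γ : ℝ → X} {lo hi d x Λ H lam χ α β : ℝ} {n : ℤ}
    {E : ℤ → Set X} {W : ℤ → X} {ma mb m m' : ℤ} {a b : ℝ} {g g' : Set X} {σ σ' : X}
    (hγ : IsoOn γ lo hi) (hC : ChainP n E W H) (hx : 0 < x) (hlam : x ≤ lam) (hlamΛ : lam ≤ Λ)
    (hd : 100 * Λ ≤ d) (hH : 100 * Λ ≤ H) (hL : LevelP γ lo hi d n E W lam α β ma mb)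
    (hA : EndOut γ α β x Λ n E W ma mb m a g σ) (hB : EndOutB γ α β x Λ n E W ma mb m' b g' σ')
    (hm : m ≤ m') (hma : ma ≤ m) (hmb : m' ≤ mb)
    (hT : ∀ M, 4 ≤ M → M ≤ n + 3 → TProp 𝓐 M x χ) :
    ∃ A ∈ 𝓐, γ '' Icc a b ⊆ tubN χ A ∧ σ ∈ tubN χ A ∧ σ' ∈ tubN χ A ∧
      ∀ k, m < k → k ≤ m' → W k ∈ tubN χ A := by
  have hab := hL.hd
  have hlo := hL.hlo
  have hhi := hL.hhi
  have a1 := hA.ha1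
  have a2 := hA.ha2
  have b1 := hB.hb1
  have b2 := hB.hb2
  have m1 := hA.hm1
  have m2 := hB.hm2
  have hbase : b - a ≥ 90 * Λ := by linarith
  have sub1 : γ '' Icc a b ⊆ γ '' Icc a β := image_mono (Icc_subset_Icc le_rfl b1)
  have sub2 : γ '' Icc a b ⊆ γ '' Icc α b := image_mono (Icc_subset_Icc a1 le_rfl)
  obtain ⟨r, hr⟩ : ∃ r, r = m' - m := ⟨_, rfl⟩
  have hr0 : 0 ≤ r := by omega
  let Y : ℤ → X := fun j => if j = 0 then σ else if j = r + 1 then σ' else W (m + j)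
  have Y0 : Y 0 = σ := rfl
  have Y1 : Y (r + 1) = σ' := by
    simp only [Y]; rw [if_neg (by omega), if_pos trivial]
  have Y2 : ∀ j, 1 ≤ j → j ≤ r → Y j = W (m + j) := fun j h1 h2 => by
    simp only [Y]; rw [if_neg (by omega), if_neg (by omega)]
  have YL : ∀ j, 0 ≤ j → j ≤ r → Y j ∈ E (m + j) := by
    intro j h1 h2
    rcases eq_or_lt_of_le h1 with h | h
    · subst h; rw [Y0, add_zero]; exact hA.mem
    · rw [Y2 j (by omega) h2]
      exact (hC.seg (m + j) (by omega) (by omega)).left_mem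
  have YR : ∀ j, 0 ≤ j → j ≤ r → Y (j + 1) ∈ E (m + j) := by
    intro j h1 h2
    rcases eq_or_lt_of_le h2 with h | h
    · subst h; rw [Y1, show m + j = m' by omega]; exact hB.mem
    · rw [Y2 (j + 1) (by omega) (by omega), ← add_assoc]
      exact (hC.seg (m + j) (by omega) (by omega)).right_mem
  have hCex : ∀ j, ∃ C : Set X, 0 ≤ j → j ≤ r → C ⊆ E (m + j) ∧ IsSeg C (Y j) (Y (j + 1)) := by
    intro j
    by_cases h : 0 ≤ j ∧ j ≤ r
    · obtain ⟨C, h1, h2⟩ := (hC.seg (m + j) (by omega) (by omega)).sub (YL j h.1 h.2) (YR j h.1 h.2)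
      exact ⟨C, fun _ _ => ⟨h1, h2⟩⟩
    · exact ⟨∅, fun h1 h2 => absurd ⟨h1, h2⟩ h⟩
  choose C hCC using hCex
  have Csub : ∀ j, 0 ≤ j → j ≤ r → C j ⊆ E (m + j) := fun j h1 h2 => (hCC j h1 h2).1
  have Cseg : ∀ j, 0 ≤ j → j ≤ r → IsSeg (C j) (Y j) (Y (j + 1)) := fun j h1 h2 => (hCC j h1 h2).2
  -- distances between the two gaps
  have hgg : FarSep x g g' := by
    intro y hy z hz
    rcases hB.gap with hgb | ⟨hgb1, hgb2, hgb3⟩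
    · have e1 := hA.far y hy b ⟨by linarith, b1⟩
      have e2 := hB.seg.dist_add hz
      have e3 := dist_triangle_right (γ b) y z
      linarith [dist_nonneg (x := z) (y := σ')]
    · rcases hA.gap with hga | ⟨hga1, hga2, hga3⟩
      · have e1 := hB.far z hz a ⟨a1, by linarith⟩
        have e2 := hA.seg.dist_add hy
        have e3 := dist_triangle (γ a) y z
        linarith [dist_nonneg (x := y) (y := σ)]
      · have := hC.sep 0 (n + 1) le_rfl (by omega) le_rfl y (hga1 ▸ hy) z (hgb1 ▸ hz)
        linarith
  have hσσ : r = 0 → x ≤ dist σ σ' := by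
    intro hr00
    rcases hB.gap with hgb | ⟨hgb1, hgb2, hgb3⟩
    · have e1 := hA.far σ hA.seg.right_mem b ⟨by linarith, b1⟩
      have e3 := dist_triangle_right (γ b) σ σ'
      linarith
    · rcases hA.gap with hga | ⟨hga1, hga2, hga3⟩
      · have e1 := hB.far σ' hB.seg.right_mem a ⟨a1, by linarith⟩
        have e3 := dist_triangle (γ a) σ σ'
        linarith
      · have e := hC.len 1 le_rfl (by omega)
        rw [hga3, hgb3, show n + 1 = 1 + 1 by omega]
        linarith
  have Ylen : ∀ j, 0 ≤ j → j ≤ r → x ≤ dist (Y j) (Y (j + 1)) := by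
    intro j h1 h2
    by_cases c0 : j = 0
    · subst c0
      by_cases c1 : r = 0
      · have := hσσ c1
        rw [Y0, ← c1, Y1]; exact this
      · rw [Y0, Y2 (0 + 1) (by omega) (by omega), zero_add]
        exact hA.clen (by omega) (by omega)
    · by_cases c1 : j = r
      · subst c1
        rw [Y1, Y2 j (by omega) le_rfl, dist_comm, show m + j = m' by omega]
        exact hB.clen (by omega) (by omega)
      · rw [Y2 j (by omega) (by omega), Y2 (j + 1) (by omega) (by omega), ← add_assoc]
        have := hC.len (m + j) (by omega) (by omega)
        linarith
  let S : ℤ → Set X := fun i => if i = 0 then γ '' Icc a b else if i = 1 then g else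
    if i = r + 3 then g' else C (i - 2)
  let v : ℤ → X := fun i => if i = 0 then γ b else if i = 1 then γ a else
    if i = r + 4 then γ b else Y (i - 2)
  have S0 : S 0 = γ '' Icc a b := rfl
  have S1 : S 1 = g := rfl
  have Sr : S (r + 3) = g' := by
    simp only [S]; rw [if_neg (by omega), if_neg (by omega), if_pos trivial]
  have S2 : ∀ i, 2 ≤ i → i ≤ r + 2 → S i = C (i - 2) := fun i h1 h2 => by
    simp only [S]; rw [if_neg (by omega), if_neg (by omega), if_neg (by omega)]
  have v0 : v 0 = γ b := rfl
  have v1 : v 1 = γ a := rfl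
  have vr : v (r + 4) = γ b := by
    simp only [v]; rw [if_neg (by omega), if_neg (by omega), if_pos trivial]
  have v2 : ∀ i, 2 ≤ i → i ≤ r + 3 → v i = Y (i - 2) := fun i h1 h2 => by
    simp only [v]; rw [if_neg (by omega), if_neg (by omega), if_neg (by omega)]
  have cases4 : ∀ i, 0 ≤ i → i < r + 4 → i = 0 ∨ i = 1 ∨ (2 ≤ i ∧ i ≤ r + 2) ∨ i = r + 3 := by
    intro i h1 h2; omega
  have key : ∃ A ∈ 𝓐, ∀ i, 0 ≤ i → i < r + 4 → S i ⊆ tubN χ A := by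
    refine hT (r + 4) (by omega) (by omega) S v ?_ ?_ ?_ ?_ ?_ ?_
    · intro i h1 h2
      rcases cases4 i h1 h2 with h | h | h | h
      · subst h
        exact (hγ.isSeg (by linarith) (by linarith) (by linarith)).symm
      · subst h
        rw [S1, v1, v2 (1 + 1) (by omega) (by omega)]
        exact hA.seg
      · rw [S2 i h.1 h.2, v2 i h.1 (by omega), v2 (i + 1) (by omega) (by omega),
          show i + 1 - 2 = i - 2 + 1 by ring]
        exact Cseg (i - 2) (by omega) (by omega)
      · subst h
        rw [Sr, v2 (r + 3) (by omega) (by omega), show r + 3 + 1 = r + 4 by ring, vr,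
          show r + 3 - 2 = r + 1 by ring, Y1]
        exact hB.seg.symm
    · rw [vr, v0]
    · intro i h1 h2
      rcases cases4 i h1 h2 with h | h | h | h
      · subst h
        rw [v0, zero_add, v1, dist_comm, hγ.dist_le (by linarith) (by linarith) (by linarith)]
        linarith
      · subst h
        rw [v1, v2 (1 + 1) (by omega) (by omega)]
        exact hA.glen
      · rw [v2 i h.1 (by omega), v2 (i + 1) (by omega) (by omega),
          show i + 1 - 2 = i - 2 + 1 by ring]
        exact Ylen (i - 2) (by omega) (by omega)
      · subst h
        rw [v2 (r + 3) (by omega) (by omega), show r + 3 + 1 = r + 4 by ring, vr,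
          show r + 3 - 2 = r + 1 by ring, Y1, dist_comm]
        exact hB.glen
    · intro i h1 h2
      rcases cases4 i h1 (by omega) with h | h | h | h
      · subst h
        rw [S0, zero_add, S1, v1]
        exact hA.goodbase.mono sub1 subset_rfl
      · subst h
        rw [S1, S2 (1 + 1) (by omega) (by omega), v2 (1 + 1) (by omega) (by omega)]
        have := Csub 0 le_rfl hr0
        rw [add_zero] at this
        exact (hA.gooc.mono this subset_rfl).symm
      · by_cases c : i = r + 2
        · subst c
          rw [S2 _ h.1 h.2, show r + 2 + 1 = r + 3 by ring, Sr, v2 _ (by omega) (by omega),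
            show r + 3 - 2 = r + 1 by ring, Y1, show r + 2 - 2 = r by ring]
          have := Csub r hr0 le_rfl
          rw [show m + r = m' by omega] at this
          exact hB.gooc.mono this subset_rfl
        · rw [S2 i h.1 h.2, S2 (i + 1) (by omega) (by omega), v2 (i + 1) (by omega) (by omega),
            show i + 1 - 2 = i - 2 + 1 by ring, Y2 (i - 2 + 1) (by omega) (by omega), ← add_assoc]
          have h1 := Csub (i - 2) (by omega) (by omega)
          have h2 := Csub (i - 2 + 1) (by omega) (by omega)
          rw [← add_assoc] at h2
          exact (hC.good (m + (i - 2)) (by omega) (by omega)).mono h1 h2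
      · omega
    · rw [show r + 4 - 1 = r + 3 by ring, Sr, S0, v0]
      exact (hB.goodbase.mono sub2 subset_rfl).symm
    · intro i j h1 h2 h3 h4
      rcases cases4 i h1 (by omega) with h | h | h | h
      · subst h
        rw [S0, S2 j (by omega) (by omega)]
        rintro _ ⟨t, ht, rfl⟩ y hy
        have := hL.free t ⟨by linarith [ht.1], by linarith [ht.2]⟩ (m + (j - 2)) (by omega)
          (by omega) y (Csub _ (by omega) (by omega) hy)
        linarith
      · subst h
        rw [S1]
        by_cases c : j = r + 3
        · subst c; rw [Sr]; exact hgg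
        · rw [S2 j (by omega) (by omega)]
          exact (hA.sep (m + (j - 2)) (by omega) (by omega) (by omega)).mono subset_rfl
            (Csub _ (by omega) (by omega)) le_rfl
      · rw [S2 i h.1 h.2]
        by_cases c : j = r + 3
        · subst c; rw [Sr]
          exact (hB.sep (m + (i - 2)) (by omega) (by omega) (by omega)).symm.mono
            (Csub _ (by omega) (by omega)) subset_rfl le_rfl
        · rw [S2 j (by omega) (by omega)]
          exact (hC.sep (m + (i - 2)) (m + (j - 2)) (by omega) (by omega) (by omega)).mono
            (Csub _ (by omega) (by omega)) (Csub _ (by omega) (by omega)) (by linarith)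
      · omega
  obtain ⟨A, hAA, hsub⟩ := key
  refine ⟨A, hAA, hsub 0 le_rfl (by omega), ?_, ?_, ?_⟩
  · exact hsub 1 (by omega) (by omega) hA.seg.right_mem
  · have := hsub (r + 3) (by omega) (by omega)
    rw [Sr] at this
    exact this hB.seg.right_mem
  · intro k h1 h2
    have := hsub (k - m + 2) (by omega) (by omega)
    rw [S2 _ (by omega) (by omega)] at this
    have h3 := (Cseg (k - m + 2 - 2) (by omega) (by omega)).left_mem
    have h4 := this h3
    rw [Y2 _ (by omega) (by omega)] at h4
    rwa [show m + (k - m + 2 - 2) = k by ring] at h4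

theorem pairUp {𝓐 : Set (Set X)} {γ : ℝ → X} {lo hi d x Λ H lam lam' χ α β α' β' : ℝ} {n : ℤ}
    {E : ℤ → Set X} {W : ℤ → X} {ma mb : ℤ} (hX : GeodesicSpace X) (hγ : IsoOn γ lo hi)
    (hC : ChainP n E W H) (hn : 1 ≤ n)
    (hx : 0 < x) (hlam : x ≤ lam) (hlam' : lam + 5 * x ≤ lam') (hΛ : lam' + 4 * x ≤ Λ)
    (hd : 100 * Λ ≤ d) (hH : 100 * Λ ≤ H) (hL : LevelP γ lo hi d n E W lam α β ma mb)
    (hL' : LevelP γ lo hi d n E W lam' α' β' ma mb) (hmab : ma ≤ mb)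
    (hnearA : (∃ σ ∈ E ma, dist (γ α) σ ≤ lam ∧ dist σ (W (ma + 1)) < 4 * x) →
      (∃ σ ∈ E ma, dist (γ α') σ ≤ lam' ∧ dist σ (W (ma + 1)) < 4 * x))
    (hnearB : (∃ σ ∈ E mb, dist (γ β) σ ≤ lam ∧ dist σ (W mb) < 4 * x) →
      (∃ σ ∈ E mb, dist (γ β') σ ≤ lam' ∧ dist σ (W mb) < 4 * x))
    (hT : ∀ M, 4 ≤ M → M ≤ n + 3 → TProp 𝓐 M x χ) :
    ∃ A ∈ 𝓐, (∀ t, α + 2 * Λ ≤ t → t ≤ β - 2 * Λ → γ t ∈ tubN χ A) ∧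
      ∀ k, ma < k → k ≤ mb → W k ∈ tubN (χ + 4 * Λ) A := by
  obtain ⟨m, a, g, σ, hA⟩ := exists_endOut hX hγ hC hn hx hlam hlam' hΛ hd hH hL hL' hnearA
  obtain ⟨m'', b', g', σ', hB'⟩ := exists_endOut hX hγ.neg hC.refl hn hx hlam hlam' hΛ hd hH
    hL.mirror hL'.mirror (by
      simp only [neg_neg, show n + 1 - (n + 1 - mb) = mb by ring,
        show n + 2 - (n + 1 - mb + 1) = mb by ring]
      exact hnearB)
  have hB := hB'.mirror
  generalize n + 1 - m'' = m' at hB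
  generalize -b' = b at hB
  have hab := hL.hd
  have hlo := hL.hlo
  have hhi := hL.hhi
  have a1 := hA.ha1
  have a2 := hA.ha2
  have b1 := hB.hb1
  have b2 := hB.hb2
  have p1 := hA.hm1
  have p2 := hA.hm2
  have p3 := hB.hm1
  have p4 := hB.hm2
  have hmm : m ≤ m' := by
    rcases hA.alt with h | ⟨h, h'⟩ | ⟨h, h', h''⟩ <;>
    rcases hB.alt with k | ⟨k, k'⟩ | ⟨k, k', k''⟩ <;> try omega
    by_contra hcon
    have : mb = ma + 1 := by omega
    subst this
    have e1 := hγ.dist_le hlo (by linarith) hhi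
    have e2 := dist_triangle_right (γ α) (γ β) (W (ma + 1))
    linarith
  have hma : ma ≤ m := by
    rcases hA.alt with h | ⟨h, h'⟩ | ⟨h, h', h''⟩ <;> omega
  have hmb : m' ≤ mb := by
    rcases hB.alt with h | ⟨h, h'⟩ | ⟨h, h', h''⟩ <;> omega
  obtain ⟨A, hAA, q1, q2, q3, q4⟩ := polygon_of_ends hγ hC hx hlam (by linarith) hd hH hL hA hB
    hmm hma hmb hT
  have hΛ0 : 0 ≤ Λ := by linarith
  refine ⟨A, hAA, fun t ht1 ht2 => q1 ⟨t, ⟨by linarith, by linarith⟩, rfl⟩, fun k h1 h2 => ?_⟩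
  rcases le_or_gt k m with h | h
  · rcases hA.ver k h1 h with e | e
    · exact tubN_of_dist (q1 ⟨a, ⟨le_rfl, by linarith⟩, rfl⟩) e
    · rw [e]; exact tubN_mono q2 (by linarith)
  · rcases le_or_gt k m' with h' | h'
    · exact tubN_mono (q4 k h h') (by linarith)
    · rcases hB.ver k h' h2 with e | e
      · exact tubN_of_dist (q1 ⟨b, ⟨by linarith, le_rfl⟩, rfl⟩) e
      · rw [e]; exact tubN_mono q3 (by linarith)

/-! ### Choosing a good level -/

theorem pigeon_levels {n : ℤ} {N : ℕ} (hN : n + 2 ≤ N) (ma mb : ℕ → ℤ)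
    (P Q : ℕ → Prop) (h : ∀ i, i < 4 * N ^ 2 + 1 → 0 ≤ ma i ∧ ma i ≤ n + 1 ∧ 0 ≤ mb i ∧
      mb i ≤ n + 1) :
    ∃ i j, i < j ∧ j < 4 * N ^ 2 + 1 ∧ ma i = ma j ∧ mb i = mb j ∧ (P i ↔ P j) ∧ (Q i ↔ Q j) := by
  classical
  let f : Fin (4 * N ^ 2 + 1) → (Fin N × Fin N) × (Prop × Prop) := fun i =>
    ((⟨(ma i).toNat, by have := h i i.isLt; omega⟩, ⟨(mb i).toNat, by have := h i i.isLt; omega⟩),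
      (P i, Q i))
  have hcard : Fintype.card ((Fin N × Fin N) × (Prop × Prop)) < Fintype.card (Fin (4 * N ^ 2 + 1)) := by
    simp only [Fintype.card_prod, Fintype.card_fin, Fintype.card_prop]
    ring_nf
    omega
  obtain ⟨i, j, hij, hf⟩ := Fintype.exists_ne_map_eq_of_card_lt f hcard
  have main : ∀ i j : Fin (4 * N ^ 2 + 1), f i = f j →
      ma i = ma j ∧ mb i = mb j ∧ (P i ↔ P j) ∧ (Q i ↔ Q j) := by
    intro i j hf
    simp only [f, Prod.mk.injEq, Fin.mk.injEq] at hf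
    obtain ⟨⟨h1, h2⟩, h3, h4⟩ := hf
    have hi := h i i.isLt
    have hj := h j j.isLt
    exact ⟨by omega, by omega, iff_of_eq h3, iff_of_eq h4⟩
  rcases lt_or_gt_of_ne hij with hlt | hlt
  · exact ⟨i, j, hlt, j.isLt, main i j hf⟩
  · exact ⟨j, i, hlt, i.isLt, main j i hf.symm⟩

theorem exists_piece {𝓐 : Set (Set X)} {γ : ℝ → X} {lo hi d x Λ H χ : ℝ} {n : ℤ} {N : ℕ}
    {E : ℤ → Set X} {W : ℤ → X} (hX : GeodesicSpace X) (hγ : IsoOn γ lo hi)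
    (hC : ChainP n E W H) (hn : 1 ≤ n) (hN : n + 2 ≤ N)
    (hx : 0 < x) (hΛ : (5 * (4 * (N : ℝ) ^ 2 + 1) + 5) * x ≤ Λ)
    (hd : 100 * Λ ≤ d) (hH : 100 * Λ ≤ H)
    (hT : ∀ M, 4 ≤ M → M ≤ n + 3 → TProp 𝓐 M x χ) (R : ℝ → ℝ → ℤ → ℤ → Prop)
    (h : ∀ lam, x ≤ lam → lam ≤ Λ → ∃ α β ma mb, LevelP γ lo hi d n E W lam α β ma mb ∧
      R α β ma mb) :
    ∃ α β ma mb, R α β ma mb ∧ ∃ A ∈ 𝓐, (∀ t, α + 2 * Λ ≤ t → t ≤ β - 2 * Λ → γ t ∈ tubN χ A) ∧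
      ∀ k, ma < k → k ≤ mb → W k ∈ tubN (χ + 4 * Λ) A := by
  have hlev : ∀ i : ℕ, i < 4 * N ^ 2 + 1 → ((5 * (i : ℝ) + 1) * x ≥ x ∧
      (5 * (i : ℝ) + 1) * x + 4 * x ≤ Λ) := by
    intro i hi
    have h0 : (0 : ℝ) ≤ i := Nat.cast_nonneg i
    have h1 : (i : ℝ) ≤ 4 * (N : ℝ) ^ 2 + 1 := by exact_mod_cast hi.le
    constructor
    · nlinarith
    · nlinarith
  have hex : ∀ i : ℕ, ∃ α β ma mb, i < 4 * N ^ 2 + 1 →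
      LevelP γ lo hi d n E W ((5 * (i : ℝ) + 1) * x) α β ma mb ∧ R α β ma mb := by
    intro i
    by_cases hi : i < 4 * N ^ 2 + 1
    · obtain ⟨h1, h2⟩ := hlev i hi
      obtain ⟨α, β, ma, mb, hh⟩ := h ((5 * (i : ℝ) + 1) * x) h1 (by linarith)
      exact ⟨α, β, ma, mb, fun _ => hh⟩
    · exact ⟨0, 0, 0, 0, fun h => absurd h hi⟩
  choose α β ma mb hh using hex
  obtain ⟨i, j, hij, hj, e1, e2, e3, e4⟩ := pigeon_levels (n := n) hN ma mb
    (fun i => (ma i ≤ mb i → ∃ σ ∈ E (ma i), dist (γ (α i)) σ ≤ (5 * (i : ℝ) + 1) * x ∧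
        dist σ (W (ma i + 1)) < 4 * x) ∧
      (mb i < ma i → ∃ σ ∈ E (ma i), dist (γ (α i)) σ ≤ (5 * (i : ℝ) + 1) * x ∧
        dist σ (W (ma i)) < 4 * x))
    (fun i => (ma i ≤ mb i → ∃ σ ∈ E (mb i), dist (γ (β i)) σ ≤ (5 * (i : ℝ) + 1) * x ∧
        dist σ (W (mb i)) < 4 * x) ∧
      (mb i < ma i → ∃ σ ∈ E (mb i), dist (γ (β i)) σ ≤ (5 * (i : ℝ) + 1) * x ∧
        dist σ (W (mb i + 1)) < 4 * x))
    (fun i hi => by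
      have hL := (hh i hi).1
      refine ⟨?_, ?_, ?_, ?_⟩
      · rcases hL.aend with ⟨a, -⟩ | ⟨a, b, -⟩ <;> omega
      · rcases hL.aend with ⟨a, -⟩ | ⟨a, b, -⟩ <;> omega
      · rcases hL.bend with ⟨a, -⟩ | ⟨a, b, -⟩ <;> omega
      · rcases hL.bend with ⟨a, -⟩ | ⟨a, b, -⟩ <;> omega)
  obtain ⟨hLi, hRi⟩ := hh i (by omega)
  obtain ⟨hLj, hRj⟩ := hh j hj
  rw [← e1, ← e2] at hLj
  simp only [← e1, ← e2] at e3 e4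
  have l1 := (hlev i (by omega)).1
  have l2 := (hlev j hj).2
  have l3 : (5 * (i : ℝ) + 1) * x + 5 * x ≤ (5 * (j : ℝ) + 1) * x := by
    have : (i : ℝ) + 1 ≤ j := by exact_mod_cast hij
    nlinarith
  refine ⟨α i, β i, ma i, mb i, hRi, ?_⟩
  rcases le_or_gt (ma i) (mb i) with hm | hm
  · have hm' := not_lt.mpr hm
    simp only [hm, hm', true_imp_iff, false_imp_iff, and_true] at e3 e4
    exact pairUp hX hγ hC hn hx l1 l3 l2 hd hH hLi hLj hm e3.mp e4.mp hT
  · have hm' := not_le.mpr hm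
    simp only [hm, hm', true_imp_iff, false_imp_iff, true_and] at e3 e4
    have conv : ∀ lam α β, LevelP γ lo hi d n E W lam α β (ma i) (mb i) →
        LevelP γ lo hi d n (fun k => E (n + 1 - k)) (fun k => W (n + 2 - k)) lam α β
          (n + 1 - ma i) (n + 1 - mb i) := by
      intro lam α β hL
      refine ⟨hL.hlo, hL.hhi, hL.hd, fun t ht k h1 h2 y hy => hL.free t ht (n + 1 - k) (by omega)
        (by omega) y hy, Or.inr ?_, Or.inr ?_⟩
      · rcases hL.aend with ⟨a, -⟩ | ⟨a, b, c⟩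
        · rcases hL.bend with ⟨a, -⟩ | ⟨a, b, -⟩ <;> omega
        · exact ⟨by omega, by omega, by simpa using c⟩
      · rcases hL.bend with ⟨a, -⟩ | ⟨a, b, c⟩
        · rcases hL.aend with ⟨a, -⟩ | ⟨a, b, -⟩ <;> omega
        · exact ⟨by omega, by omega, by simpa using c⟩
    obtain ⟨A, hA, hA1, -⟩ := pairUp hX hγ hC.refl hn hx l1 l3 l2 hd hH (conv _ _ _ hLi)
      (conv _ _ _ hLj) (by omega)
      (by
        simp only [show n + 1 - (n + 1 - ma i) = ma i by ring,
          show n + 2 - (n + 1 - ma i + 1) = ma i by ring]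
        exact e3.mp)
      (by
        simp only [show n + 1 - (n + 1 - mb i) = mb i by ring,
          show n + 2 - (n + 1 - mb i) = mb i + 1 by ring]
        exact e4.mp) hT
    exact ⟨A, hA, hA1, fun k h1 h2 => by omega⟩

theorem isCompact_inner {n : ℤ} {E : ℤ → Set X} {W : ℤ → X} {H : ℝ} (hC : ChainP n E W H)
    {k1 k2 : ℤ} (h1 : 0 ≤ k1) (h2 : k2 ≤ n + 1) : IsCompact (⋃ k ∈ Icc k1 k2, E k) := by
  apply (Set.finite_Icc k1 k2).isCompact_biUnion
  intro k hk
  exact (hC.seg k (h1.trans hk.1) (hk.2.trans h2)).isCompact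

theorem exists_last_end {γ : ℝ → X} {lo hi lam p H : ℝ} {n : ℤ} {E : ℤ → Set X} {W : ℤ → X}
    (hγ : IsoOn γ lo hi) (hC : ChainP n E W H) {k1 k2 : ℤ} (h1 : 0 ≤ k1) (h2 : k2 ≤ n + 1)
    (hp : p ∈ Icc lo hi) :
    ∃ α, lo ≤ α ∧ α ≤ p ∧
      (α < p → ∀ t ∈ Icc α p, ∀ k, k1 ≤ k → k ≤ k2 → ∀ y ∈ E k, lam ≤ dist (γ t) y) ∧
      (α = lo ∨ ∃ k, k1 ≤ k ∧ k ≤ k2 ∧ ∃ σ ∈ E k, dist (γ α) σ ≤ lam) := by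
  have hU := isCompact_inner hC h1 h2
  have hγ' := hγ.mono le_rfl hp.2
  by_cases hne : ∃ t ∈ Icc lo p, ∃ y ∈ ⋃ k ∈ Icc k1 k2, E k, dist (γ t) y ≤ lam
  · obtain ⟨α, hα, ⟨y, hy, hyd⟩, hl⟩ := exists_last_touch hγ' hU hne
    simp only [mem_iUnion] at hy
    obtain ⟨k, hk, hy⟩ := hy
    refine ⟨α, hα.1, hα.2, ?_, Or.inr ⟨k, hk.1, hk.2, y, hy, hyd⟩⟩
    intro hαp t ht k hk1 hk2 y hy
    have hyU : y ∈ ⋃ k ∈ Icc k1 k2, E k := mem_biUnion (show k ∈ Icc k1 k2 from ⟨hk1, hk2⟩) hy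
    rcases eq_or_lt_of_le ht.1 with h | h
    · subst h
      exact hγ'.ge_of_right hα.1 hαp le_rfl (fun s hs h1 h2 => (hl s hs h1 y hyU).le)
    · exact (hl t ⟨hα.1.trans ht.1, ht.2⟩ h y hyU).le
  · push Not at hne
    refine ⟨lo, le_rfl, hp.1, ?_, Or.inl rfl⟩
    intro _ t ht k hk1 hk2 y hy
    exact (hne t ht y (mem_biUnion (show k ∈ Icc k1 k2 from ⟨hk1, hk2⟩) hy)).le

theorem exists_first_end {γ : ℝ → X} {lo hi lam p H : ℝ} {n : ℤ} {E : ℤ → Set X} {W : ℤ → X}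
    (hγ : IsoOn γ lo hi) (hC : ChainP n E W H) {k1 k2 : ℤ} (h1 : 0 ≤ k1) (h2 : k2 ≤ n + 1)
    (hp : p ∈ Icc lo hi) :
    ∃ β, p ≤ β ∧ β ≤ hi ∧
      (p < β → ∀ t ∈ Icc p β, ∀ k, k1 ≤ k → k ≤ k2 → ∀ y ∈ E k, lam ≤ dist (γ t) y) ∧
      (β = hi ∨ ∃ k, k1 ≤ k ∧ k ≤ k2 ∧ ∃ σ ∈ E k, dist (γ β) σ ≤ lam) := by
  have hU := isCompact_inner hC h1 h2
  have hγ' := hγ.mono hp.1 le_rfl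
  by_cases hne : ∃ t ∈ Icc p hi, ∃ y ∈ ⋃ k ∈ Icc k1 k2, E k, dist (γ t) y ≤ lam
  · obtain ⟨β, hβ, ⟨y, hy, hyd⟩, hl⟩ := exists_first_touch hγ' hU hne
    simp only [mem_iUnion] at hy
    obtain ⟨k, hk, hy⟩ := hy
    refine ⟨β, hβ.1, hβ.2, ?_, Or.inr ⟨k, hk.1, hk.2, y, hy, hyd⟩⟩
    intro hαp t ht k hk1 hk2 y hy
    have hyU : y ∈ ⋃ k ∈ Icc k1 k2, E k := mem_biUnion (show k ∈ Icc k1 k2 from ⟨hk1, hk2⟩) hy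
    rcases eq_or_lt_of_le ht.2 with h | h
    · subst h
      exact hγ'.ge_of_left le_rfl hαp hβ.2 (fun s hs h1 h2 => (hl s hs h2 y hyU).le)
    · exact (hl t ⟨ht.1, ht.2.trans hβ.2⟩ h y hyU).le
  · push Not at hne
    refine ⟨hi, hp.2, le_rfl, ?_, Or.inl rfl⟩
    intro _ t ht k hk1 hk2 y hy
    exact (hne t ht y (mem_biUnion (show k ∈ Icc k1 k2 from ⟨hk1, hk2⟩) hy)).le

/-- around a time which is far from the chain, the geodesic is close to a piece -/
theorem piece_at_free {𝓐 : Set (Set X)} {γ : ℝ → X} {lo hi d x Λ H χ : ℝ} {n : ℤ} {N : ℕ}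
    {E : ℤ → Set X} {W : ℤ → X} (hX : GeodesicSpace X) (hγ : IsoOn γ lo hi)
    (hC : ChainP n E W H) (hS : StartC γ lo hi E W) (hE : EndC γ lo hi n E W)
    (hn : 1 ≤ n) (hN : n + 2 ≤ N)
    (hx : 0 < x) (hΛ : (5 * (4 * (N : ℝ) ^ 2 + 1) + 5) * x ≤ Λ)
    (hd : 100 * Λ ≤ d) (hH : 100 * Λ ≤ H)
    (hT : ∀ M, 4 ≤ M → M ≤ n + 3 → TProp 𝓐 M x χ) {t : ℝ} (ht1 : lo + d ≤ t) (ht2 : t ≤ hi - d)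
    (hfree : ∀ s, t - d ≤ s → s ≤ t + d → ∀ k, 1 ≤ k → k ≤ n → ∀ y ∈ E k, Λ < dist (γ s) y) :
    ∃ A ∈ 𝓐, ∀ s, t - d / 2 ≤ s → s ≤ t + d / 2 → γ s ∈ tubN χ A := by
  have hΛ0 : 0 ≤ Λ := le_trans (by positivity) hΛ
  obtain ⟨α, β, ma, mb, ⟨r1, r2⟩, A, hA, hA1, -⟩ := exists_piece hX hγ hC hn hN hx hΛ hd hH hT
    (fun α β _ _ => α ≤ t - d ∧ t + d ≤ β) (by
      intro lam hl1 hl2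
      have htm : t ∈ Icc lo hi := ⟨by linarith, by linarith⟩
      obtain ⟨α, a1, a2, a3, a4⟩ := exists_last_end (lam := lam) (k1 := 1) (k2 := n) hγ hC
        (by omega) (by omega) htm
      obtain ⟨β, b1, b2, b3, b4⟩ := exists_first_end (lam := lam) (k1 := 1) (k2 := n) hγ hC
        (by omega) (by omega) htm
      have hαd : α ≤ t - d := by
        rcases a4 with h | ⟨k, k1, k2, σ, hσ, hσd⟩
        · linarith
        · by_contra hcon
          have := hfree α (by linarith) (by linarith) k k1 k2 σ hσ
          linarith
      have hβd : t + d ≤ β := by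
        rcases b4 with h | ⟨k, k1, k2, σ, hσ, hσd⟩
        · linarith
        · by_contra hcon
          have := hfree β (by linarith) (by linarith) k k1 k2 σ hσ
          linarith
      have hfr : ∀ s ∈ Icc α β, ∀ k, 1 ≤ k → k ≤ n → ∀ y ∈ E k, lam ≤ dist (γ s) y := by
        intro s hs k h1 h2 y hy
        rcases le_total s t with h | h
        · exact a3 (by linarith) s ⟨hs.1, h⟩ k h1 h2 y hy
        · exact b3 (by linarith) s ⟨h, hs.2⟩ k h1 h2 y hy
      have ea : ∃ ma, (ma = 0 ∧ α = lo ∧ StartC γ lo hi E W) ∨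
          (1 ≤ ma ∧ ma ≤ n ∧ ∃ σ ∈ E ma, dist (γ α) σ ≤ lam) := by
        rcases a4 with h | ⟨k, h⟩
        · exact ⟨0, Or.inl ⟨rfl, h, hS⟩⟩
        · exact ⟨k, Or.inr h⟩
      have eb : ∃ mb, (mb = n + 1 ∧ β = hi ∧ EndC γ lo hi n E W) ∨
          (1 ≤ mb ∧ mb ≤ n ∧ ∃ σ ∈ E mb, dist (γ β) σ ≤ lam) := by
        rcases b4 with h | ⟨k, h⟩
        · exact ⟨n + 1, Or.inl ⟨rfl, h, hE⟩⟩
        · exact ⟨k, Or.inr h⟩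
      obtain ⟨ma, ea⟩ := ea
      obtain ⟨mb, eb⟩ := eb
      exact ⟨α, β, ma, mb, ⟨a1, b2, by linarith, hfr, ea, eb⟩, hαd, hβd⟩)
  exact ⟨A, hA, fun s h1 h2 => hA1 s (by linarith) (by linarith)⟩

/-- every vertex of the chain is close to the geodesic or to a piece close to it -/
theorem vertex_alt {𝓐 : Set (Set X)} {γ : ℝ → X} {lo hi d x Λ H χ : ℝ} {n : ℤ} {N : ℕ}
    {E : ℤ → Set X} {W : ℤ → X} (hX : GeodesicSpace X) (hγ : IsoOn γ lo hi) (hlohi : lo ≤ hi)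
    (hC : ChainP n E W H) (hS : StartC γ lo hi E W) (hE : EndC γ lo hi n E W)
    (hn : 1 ≤ n) (hN : n + 2 ≤ N)
    (hx : 0 < x) (hΛ : (5 * (4 * (N : ℝ) ^ 2 + 1) + 5) * x ≤ Λ)
    (hd : 100 * Λ ≤ d) (hH : 100 * d ≤ H)
    (hT : ∀ M, 4 ≤ M → M ≤ n + 3 → TProp 𝓐 M x χ) {k : ℤ} (hk1 : 1 ≤ k) (hk2 : k ≤ n + 1) :
    (∃ t ∈ Icc lo hi, dist (γ t) (W k) ≤ 7 * d) ∨
    ∃ α β, lo ≤ α ∧ β ≤ hi ∧ α + 3 * d ≤ β ∧ ∃ A ∈ 𝓐,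
      (∀ t, α + 2 * Λ ≤ t → t ≤ β - 2 * Λ → γ t ∈ tubN χ A) ∧ W k ∈ tubN (χ + 4 * Λ) A := by
  by_cases hnear : ∃ t ∈ Icc lo hi, dist (γ t) (W k) ≤ 7 * d
  · exact Or.inl hnear
  right
  have hΛ0 : 0 < Λ := lt_of_lt_of_le (by positivity) hΛ
  obtain ⟨α, β, ma, mb, ⟨r1, r2, r3, r4, r5⟩, A, hA, hA1, hA2⟩ := exists_piece hX hγ hC hn hN hx hΛ
    hd (by linarith) hT
    (fun α β ma mb => lo ≤ α ∧ β ≤ hi ∧ α + 3 * d ≤ β ∧ ma < k ∧ k ≤ mb) (by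
      intro lam hl1 hl2
      obtain ⟨β, b1, b2, b3, b4⟩ := exists_first_end (lam := lam) (k1 := k) (k2 := n) hγ hC
        (by omega) (by omega) (show lo ∈ Icc lo hi from ⟨le_rfl, hlohi⟩)
      obtain ⟨α, a1, a2, a3, a4⟩ := exists_last_end (lam := lam) (k1 := 1) (k2 := k - 1) hγ hC
        (by omega) (by omega) (show β ∈ Icc lo hi from ⟨b1, b2⟩)
      have hlong : α + 3 * d ≤ β := by
        by_contra hcon
        have ya : ∃ j, 0 ≤ j ∧ j < k ∧ ∃ y ∈ E j, dist (γ α) y ≤ Λ := by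
          rcases a4 with h | ⟨j, h1, h2, σ, h3, h4⟩
          · refine ⟨0, le_rfl, by omega, γ α, ?_, by simpa using hΛ0.le⟩
            rw [h, hS.1]
            exact (hC.seg 0 le_rfl (by omega)).left_mem
          · exact ⟨j, by omega, by omega, σ, h3, by linarith⟩
        have yb : ∃ j, k ≤ j ∧ j ≤ n + 1 ∧ ∃ y ∈ E j, dist (γ β) y ≤ Λ := by
          rcases b4 with h | ⟨j, h1, h2, σ, h3, h4⟩
          · refine ⟨n + 1, by omega, le_rfl, γ β, ?_, by simpa using hΛ0.le⟩
            rw [h, hE.1, show n + 2 = n + 1 + 1 by ring]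
            exact (hC.seg (n + 1) (by omega) le_rfl).right_mem
          · exact ⟨j, by omega, by omega, σ, h3, by linarith⟩
        obtain ⟨j, j1, j2, y, hy, hyd⟩ := ya
        obtain ⟨j', j1', j2', y', hy', hyd'⟩ := yb
        have e1 := hγ.dist_le a1 a2 b2
        have e2 := dist_triangle4 y (γ α) (γ β) y'
        rw [dist_comm y (γ α)] at e2
        have hjj : j' < j + 2 := by
          by_contra hc
          have := hC.sep j j' j1 (by omega) j2' y hy y' hy'
          linarith
        have hj : j = k - 1 := by omega
        have hj' : j' = k - 1 + 1 := by omega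
        subst hj
        subst hj'
        have e3 := (hC.good (k - 1) (by omega) (by omega) y hy y' hy').1
        rw [show k - 1 + 1 = k by ring] at e3
        have e4 := dist_triangle (γ α) y (W k)
        exact hnear ⟨α, ⟨a1, a2.trans b2⟩, by linarith⟩
      have hαβ : α < β := by linarith
      have hfr : ∀ s ∈ Icc α β, ∀ j, 1 ≤ j → j ≤ n → ∀ y ∈ E j, lam ≤ dist (γ s) y := by
        intro s hs j h1 h2 y hy
        rcases lt_or_ge j k with h | h
        · exact a3 hαβ s hs j h1 (by omega) y hy
        · exact b3 (by linarith) s ⟨a1.trans hs.1, hs.2⟩ j h h2 y hy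
      have ea : ∃ ma, ma < k ∧ ((ma = 0 ∧ α = lo ∧ StartC γ lo hi E W) ∨
          (1 ≤ ma ∧ ma ≤ n ∧ ∃ σ ∈ E ma, dist (γ α) σ ≤ lam)) := by
        rcases a4 with h | ⟨j, h1, h2, h3⟩
        · exact ⟨0, by omega, Or.inl ⟨rfl, h, hS⟩⟩
        · exact ⟨j, by omega, Or.inr ⟨h1, by omega, h3⟩⟩
      have eb : ∃ mb, k ≤ mb ∧ ((mb = n + 1 ∧ β = hi ∧ EndC γ lo hi n E W) ∨
          (1 ≤ mb ∧ mb ≤ n ∧ ∃ σ ∈ E mb, dist (γ β) σ ≤ lam)) := by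
        rcases b4 with h | ⟨j, h1, h2, h3⟩
        · exact ⟨n + 1, by omega, Or.inl ⟨rfl, h, hE⟩⟩
        · exact ⟨j, by omega, Or.inr ⟨by omega, h2, h3⟩⟩
      obtain ⟨ma, ema, ea⟩ := ea
      obtain ⟨mb, emb, eb⟩ := eb
      exact ⟨α, β, ma, mb, ⟨a1, b2, by linarith, hfr, ea, eb⟩, a1, b2, hlong, ema, emb⟩)
  exact ⟨α, β, r1, r2, r3, A, hA, hA1, hA2 k r4 r5⟩

/-! ### The induction step -/

theorem tprop_step {𝓐 : Set (Set X)} (hX : GeodesicSpace X) (hα : Alpha1 𝓐) (hQ : PropQ 𝓐)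
    {M : ℤ} (hM : 7 ≤ M) {x χ : ℝ} (hx : 0 < x) (hχ : 0 < χ)
    (hT : ∀ M', 4 ≤ M' → M' ≤ M - 1 → TProp 𝓐 M' x χ) :
    ∃ H χ', 0 < H ∧ 0 < χ' ∧ TProp 𝓐 M H χ' := by
  obtain ⟨D1, hD1⟩ := hα χ hχ
  obtain ⟨q, hq, K0, hK0, hQQ⟩ := hQ
  obtain ⟨N, hN⟩ : ∃ N : ℕ, (N : ℤ) = M := ⟨M.toNat, by omega⟩
  obtain ⟨Λ, hΛ⟩ : ∃ Λ, Λ = (5 * (4 * (N : ℝ) ^ 2 + 1) + 5) * x := ⟨_, rfl⟩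
  have hΛ0 : 0 < Λ := by rw [hΛ]; positivity
  obtain ⟨d, hd⟩ : ∃ d, d = 100 * Λ + 2 * |D1| + 2 := ⟨_, rfl⟩
  have habs := le_abs_self D1
  have habs' := abs_nonneg D1
  have hd1 : 100 * Λ ≤ d := by linarith
  have hd2 : D1 < d / 2 := by linarith
  have hd0 : 0 < d := by linarith
  refine ⟨100 * d, q * max (χ + 8 * d) K0, by linarith,
    mul_pos hq (lt_of_lt_of_le (by linarith) (le_max_left _ _)), ?_⟩
  intro S v hseg hcl hlen hgood hgood0 hsep
  obtain ⟨H, hH⟩ : ∃ H, H = 100 * d := ⟨_, rfl⟩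
  rw [← hH] at hlen hsep
  -- nearest points of two edges
  have s0 : IsSeg (S 0) (v 0) (v 1) := hseg 0 le_rfl (by omega)
  have s3 : IsSeg (S 3) (v 3) (v 4) := hseg 3 (by omega) (by omega)
  obtain ⟨u, hu, w, hw, huw⟩ := exists_nearest_pair s0.isCompact s3.isCompact ⟨_, s0.left_mem⟩
    ⟨_, s3.left_mem⟩
  obtain ⟨G, hG⟩ := hX.exists_seg u w
  obtain ⟨γ, hγ, hγ0, hγ1, -⟩ := hG.param
  have hDH : H ≤ dist u w := hsep 0 3 le_rfl (by omega) (by omega) (by omega) u hu w hw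
  generalize hDD : dist u w = D at *
  have perp0 : ∀ t ∈ Icc 0 D, ∀ y ∈ S 0, t - 0 ≤ dist (γ t) y := by
    intro t ht y hy
    have e1 := huw y hy w hw
    have e2 := dist_triangle y (γ t) w
    have e3 := hγ.dist_le ht.1 ht.2 le_rfl
    rw [hγ1] at e3
    rw [dist_comm y (γ t)] at e2
    linarith
  have perp1 : ∀ t ∈ Icc 0 D, ∀ y ∈ S 3, D - t ≤ dist (γ t) y := by
    intro t ht y hy
    have e1 := huw u hu y hy
    have e2 := dist_triangle u (γ t) y
    have e3 := hγ.dist_le le_rfl ht.1 ht.2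
    rw [hγ0] at e3
    linarith
  obtain ⟨S01, S02, h01, h02, hS0⟩ := s0.split hu
  obtain ⟨S31, S32, h31, h32, hS3⟩ := s3.split hw
  have sub01 : S01 ⊆ S 0 := hS0 ▸ subset_union_left
  have sub02 : S02 ⊆ S 0 := hS0 ▸ subset_union_right
  have sub31 : S31 ⊆ S 3 := hS3 ▸ subset_union_left
  have sub32 : S32 ⊆ S 3 := hS3 ▸ subset_union_right
  -- first side
  let EA : ℤ → Set X := fun k => if k = 0 then S02 else if k = 3 then S31 else S k
  let WA : ℤ → X := fun k => if k = 0 then u else if k = 4 then w else v k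
  have EAsub : ∀ k, 0 ≤ k → k ≤ 3 → EA k ⊆ S k := by
    intro k h1 h2
    simp only [EA]
    split_ifs with c1 c2
    · subst c1; exact sub02
    · subst c2; exact sub31
    · exact subset_rfl
  have hCA : ChainP 2 EA WA H := by
    refine ⟨?_, ?_, ?_, ?_⟩
    · intro k h1 h2
      by_cases c1 : k = 0
      · subst c1; exact h02
      by_cases c2 : k = 3
      · subst c2; exact h31
      have e1 : EA k = S k := by simp only [EA]; rw [if_neg c1, if_neg c2]
      have e2 : WA k = v k := by simp only [WA]; rw [if_neg c1, if_neg (by omega)]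
      have e3 : WA (k + 1) = v (k + 1) := by
        simp only [WA]; rw [if_neg (by omega), if_neg (by omega)]
      rw [e1, e2, e3]
      exact hseg k h1 (by omega)
    · intro k h1 h2
      have e3 : WA (k + 1) = v (k + 1) := by
        simp only [WA]; rw [if_neg (by omega), if_neg (by omega)]
      rw [e3]
      exact (hgood k h1 (by omega)).mono (EAsub k h1 (by omega)) (EAsub _ (by omega) (by omega))
    · intro i j h1 h2 h3
      exact (hsep i j h1 h2 (by omega) (by omega)).mono (EAsub i h1 (by omega))
        (EAsub j (by omega) (by omega)) le_rfl
    · intro k h1 h2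
      have e2 : WA k = v k := by simp only [WA]; rw [if_neg (by omega), if_neg (by omega)]
      have e3 : WA (k + 1) = v (k + 1) := by
        simp only [WA]; rw [if_neg (by omega), if_neg (by omega)]
      rw [e2, e3]
      exact hlen k (by omega) (by omega)
  have hSA : StartC γ 0 D EA WA := ⟨hγ0, fun t ht y hy => perp0 t ht y (sub02 hy)⟩
  have hEA : EndC γ 0 D 2 EA WA := ⟨hγ1, fun t ht y hy => perp1 t ht y (sub31 hy)⟩
  -- second side
  let EB : ℤ → Set X := fun k => if k = 0 then S01 else if k = M - 3 then S32 else S (M - k)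
  let WB : ℤ → X := fun k => if k = 0 then u else if k = M - 2 then w else v (M + 1 - k)
  have EB0 : EB 0 = S01 := rfl
  have EB1 : EB (M - 3) = S32 := by
    simp only [EB]; rw [if_neg (by omega), if_pos trivial]
  have EB2 : ∀ k, 1 ≤ k → k ≤ M - 4 → EB k = S (M - k) := fun k h1 h2 => by
    simp only [EB]; rw [if_neg (by omega), if_neg (by omega)]
  have WB1 : WB (M - 2) = w := by
    simp only [WB]; rw [if_neg (by omega), if_pos trivial]
  have WB2 : ∀ k, 1 ≤ k → k ≤ M - 3 → WB k = v (M + 1 - k) := fun k h1 h2 => by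
    simp only [WB]; rw [if_neg (by omega), if_neg (by omega)]
  have EBsub : ∀ k, 1 ≤ k → k ≤ M - 3 → EB k ⊆ S (M - k) := by
    intro k h1 h2
    by_cases c : k = M - 3
    · subst c
      rw [EB1, show M - (M - 3) = 3 by ring]; exact sub32
    · rw [EB2 k h1 (by omega)]
  have hCB : ChainP (M - 4) EB WB H := by
    refine ⟨?_, ?_, ?_, ?_⟩
    · intro k h1 h2
      by_cases c1 : k = 0
      · subst c1
        rw [EB0, WB2 (0 + 1) (by omega) (by omega), show M + 1 - (0 + 1) = M by ring, hcl]
        exact h01.symm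
      by_cases c2 : k = M - 3
      · subst c2
        rw [EB1, WB2 (M - 3) (by omega) (by omega), show M + 1 - (M - 3) = 4 by ring,
          show M - 3 + 1 = M - 2 by ring, WB1]
        exact h32.symm
      rw [EB2 k (by omega) (by omega), WB2 k (by omega) (by omega), WB2 (k + 1) (by omega) (by omega),
        show M + 1 - (k + 1) = M - k by ring, show M + 1 - k = M - k + 1 by ring]
      exact (hseg (M - k) (by omega) (by omega)).symm
    · intro k h1 h2
      rw [WB2 (k + 1) (by omega) (by omega), show M + 1 - (k + 1) = M - k by ring]
      by_cases c1 : k = 0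
      · subst c1
        rw [EB0, sub_zero, hcl]
        have := EBsub (0 + 1) (by omega) (by omega)
        rw [show M - (0 + 1) = M - 1 by ring] at this
        exact (hgood0.mono this sub01).symm
      · have e1 := hgood (M - k - 1) (by omega) (by omega)
        rw [show M - k - 1 + 1 = M - k by ring] at e1
        have := EBsub (k + 1) (by omega) (by omega)
        rw [show M - (k + 1) = M - k - 1 by ring] at this
        exact (e1.mono this (EBsub k (by omega) (by omega))).symm
    · intro i j h1 h2 h3
      by_cases c1 : i = 0
      · subst c1
        exact (hsep 0 (M - j) le_rfl (by omega) (by omega) (by omega)).mono sub01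
          (EBsub j (by omega) (by omega)) le_rfl
      · exact ((hsep (M - j) (M - i) (by omega) (by omega) (by omega) (by omega)).mono
          (EBsub j (by omega) (by omega)) (EBsub i (by omega) (by omega)) le_rfl).symm
    · intro k h1 h2
      rw [WB2 k (by omega) (by omega), WB2 (k + 1) (by omega) (by omega),
        show M + 1 - (k + 1) = M - k by ring, show M + 1 - k = M - k + 1 by ring, dist_comm]
      exact hlen (M - k) (by omega) (by omega)
  have hSB : StartC γ 0 D EB WB := ⟨hγ0, fun t ht y hy => perp0 t ht y (sub01 hy)⟩
  have hEB : EndC γ 0 D (M - 4) EB WB := by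
    refine ⟨?_, fun t ht y hy => perp1 t ht y (sub32 ?_)⟩
    · rw [show M - 4 + 2 = M - 2 by ring, WB1]; exact hγ1
    · rwa [show M - 4 + 1 = M - 3 by ring, EB1] at hy
  -- pieces along the geodesic
  have hpiece : ∀ t, d ≤ t → t ≤ D - d → ∃ A ∈ 𝓐, ∀ s, t - d / 2 ≤ s → s ≤ t + d / 2 →
      γ s ∈ tubN χ A := by
    intro t ht1 ht2
    by_cases hf : ∀ s, t - d ≤ s → s ≤ t + d → ∀ k, 1 ≤ k → k ≤ 2 → ∀ y ∈ EA k, Λ < dist (γ s) y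
    · exact piece_at_free hX hγ hCA hSA hEA (by omega) (N := N) (by omega) hx hΛ.ge hd1
        (by linarith) (fun M' h1 h2 => hT M' h1 (by omega)) (by linarith) ht2 hf
    · refine piece_at_free hX hγ hCB hSB hEB (by omega) (N := N) (by omega) hx hΛ.ge hd1
        (by linarith) (fun M' h1 h2 => hT M' h1 (by omega)) (by linarith) ht2 ?_
      push Not at hf
      obtain ⟨s, hs1, hs2, k, hk1, hk2, y, hy, hyd⟩ := hf
      intro s' hs1' hs2' k' hk1' hk2' y' hy'
      by_contra hcon
      have e1 := hsep k (M - k') (by omega) (by omega) (by omega) (by omega) y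
        (EAsub k (by omega) (by omega) hy) y' (EBsub k' (by omega) (by omega) hy')
      have e2 := dist_triangle4 y (γ s) (γ s') y'
      have e3 := hγ s ⟨by linarith, by linarith⟩ s' ⟨by linarith, by linarith⟩
      have e4 : |s - s'| ≤ 2 * d := abs_le.mpr ⟨by linarith, by linarith⟩
      rw [dist_comm y (γ s)] at e2
      linarith
  have huniq : ∀ A ∈ 𝓐, ∀ A' ∈ 𝓐, ∀ s s', 0 ≤ s → s' ≤ D → s + d / 2 ≤ s' → γ s ∈ tubN χ A →
      γ s ∈ tubN χ A' → γ s' ∈ tubN χ A → γ s' ∈ tubN χ A' → A = A' := by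
    intro A hA A' hA' s s' h1 h2 h3 a1 a2 a3 a4
    by_contra hne
    have := hD1 A hA A' hA' hne (γ s) ⟨a1, a2⟩ (γ s') ⟨a3, a4⟩
    rw [hγ.dist_le h1 (by linarith) h2] at this
    linarith
  obtain ⟨A0, hA0, hA0d⟩ := hpiece d le_rfl (by linarith)
  have hconst : ∀ m : ℕ, ∀ t, d ≤ t → t ≤ D - d → t ≤ d + m * (d / 2) → ∀ A ∈ 𝓐,
      (∀ s, t - d / 2 ≤ s → s ≤ t + d / 2 → γ s ∈ tubN χ A) → A = A0 := by
    intro m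
    induction m with
    | zero =>
      intro t ht1 ht2 ht3 A hA hAs
      have : t = d := by
        simp only [Nat.cast_zero, zero_mul, add_zero] at ht3
        linarith
      subst this
      exact huniq A hA A0 hA0 (t / 2) t (by linarith) (by linarith) (by linarith)
        (hAs _ (by linarith) (by linarith)) (hA0d _ (by linarith) (by linarith))
        (hAs _ (by linarith) (by linarith)) (hA0d _ (by linarith) (by linarith))
    | succ m ih =>
      intro t ht1 ht2 ht3 A hA hAs
      push_cast at ht3
      have hmd : 0 ≤ (m : ℝ) * (d / 2) := by positivity
      obtain ⟨t', ht'⟩ : ∃ t', t' = max d (t - d / 2) := ⟨_, rfl⟩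
      have g1 : d ≤ t' := ht' ▸ le_max_left _ _
      have g2 : t - d / 2 ≤ t' := ht' ▸ le_max_right _ _
      have g3 : t' ≤ t := by rw [ht']; exact max_le ht1 (by linarith)
      have g4 : t' ≤ d + m * (d / 2) := by rw [ht']; exact max_le (by linarith) (by linarith)
      obtain ⟨A', hA', hAs'⟩ := hpiece t' g1 (by linarith)
      have := ih t' g1 (by linarith) g4 A' hA' hAs'
      subst this
      exact huniq A hA A' hA' (t - d / 2) t (by linarith) (by linarith) (by linarith)
        (hAs _ (by linarith) (by linarith)) (hAs' _ (by linarith) (by linarith))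
        (hAs _ (by linarith) (by linarith)) (hAs' _ (by linarith) (by linarith))
  have hall : ∀ s, d / 2 ≤ s → s ≤ D - d / 2 → γ s ∈ tubN χ A0 := by
    intro s hs1 hs2
    obtain ⟨t, ht⟩ : ∃ t, t = max d (min s (D - d)) := ⟨_, rfl⟩
    have g1 : d ≤ t := ht ▸ le_max_left _ _
    have g2 : t ≤ D - d := by rw [ht]; exact max_le (by linarith) (min_le_right _ _)
    have g3 : t ≤ s + d / 2 := by
      rw [ht]; exact max_le (by linarith) ((min_le_left _ _).trans (by linarith))
    have g4 : s - d / 2 ≤ t := by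
      rw [ht]; exact le_trans (le_min (by linarith) (by linarith)) (le_max_right _ _)
    obtain ⟨A, hA, hAs⟩ := hpiece t g1 g2
    obtain ⟨m, hm⟩ := exists_nat_ge ((t - d) / (d / 2))
    rw [div_le_iff₀ (by linarith)] at hm
    have := hconst m t g1 g2 (by linarith) A hA hAs
    subst this
    exact hAs s (by linarith) (by linarith)
  have hall' : ∀ s ∈ Icc 0 D, γ s ∈ tubN (χ + d) A0 := by
    intro s hs
    obtain ⟨t, ht⟩ : ∃ t, t = max (d / 2) (min s (D - d / 2)) := ⟨_, rfl⟩
    have g1 : d / 2 ≤ t := ht ▸ le_max_left _ _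
    have g2 : t ≤ D - d / 2 := by rw [ht]; exact max_le (by linarith) (min_le_right _ _)
    have g3 : t ≤ s + d / 2 := by
      rw [ht]; exact max_le (by linarith [hs.1]) ((min_le_left _ _).trans (by linarith))
    have g4 : s - d / 2 ≤ t := by
      rw [ht]
      exact le_trans (le_min (by linarith) (by linarith [hs.2])) (le_max_right _ _)
    refine tubN_of_dist (hall t g1 g2) ?_
    rw [hγ t ⟨by linarith, by linarith⟩ s hs]
    exact abs_le.mpr ⟨by linarith, by linarith⟩
  -- the vertices
  have hvert : ∀ y : X, ((∃ t ∈ Icc 0 D, dist (γ t) y ≤ 7 * d) ∨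
      ∃ α β, 0 ≤ α ∧ β ≤ D ∧ α + 3 * d ≤ β ∧ ∃ A ∈ 𝓐,
      (∀ t, α + 2 * Λ ≤ t → t ≤ β - 2 * Λ → γ t ∈ tubN χ A) ∧ y ∈ tubN (χ + 4 * Λ) A) →
      y ∈ tubN (χ + 8 * d) A0 := by
    rintro y (⟨t, ht, hty⟩ | ⟨α, β, h1, h2, h3, A, hA, hA1, hA2⟩)
    · exact tubN_mono (tubN_of_dist (hall' t ht) hty) (by linarith)
    · have : A = A0 := huniq A hA A0 hA0 (α + d) (α + 2 * d) (by linarith) (by linarith)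
        (by linarith) (hA1 _ (by linarith) (by linarith)) (hall _ (by linarith) (by linarith))
        (hA1 _ (by linarith) (by linarith)) (hall _ (by linarith) (by linarith))
      subst this
      exact tubN_mono hA2 (by linarith)
  have hvA : ∀ k, 1 ≤ k → k ≤ 3 → v k ∈ tubN (χ + 8 * d) A0 := by
    intro k h1 h2
    have := hvert _ (vertex_alt hX hγ (by linarith) hCA hSA hEA (by omega) (N := N) (by omega) hx
      hΛ.ge hd1 hH.ge (fun M' h1 h2 => hT M' h1 (by omega)) h1 h2)
    have e2 : WA k = v k := by simp only [WA]; rw [if_neg (by omega), if_neg (by omega)]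
    rwa [e2] at this
  have hvB : ∀ k, 4 ≤ k → k ≤ M → v k ∈ tubN (χ + 8 * d) A0 := by
    intro k h1 h2
    have := hvert _ (vertex_alt hX hγ (by linarith) hCB hSB hEB (by omega) (N := N) (by omega) hx
      hΛ.ge hd1 hH.ge (fun M' h1 h2 => hT M' h1 (by omega)) (k := M + 1 - k) (by omega) (by omega))
    rw [WB2 _ (by omega) (by omega)] at this
    rwa [show M + 1 - (M + 1 - k) = k by ring] at this
  have hv : ∀ k, 0 ≤ k → k ≤ M → v k ∈ tubN (max (χ + 8 * d) K0) A0 := by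
    intro k h1 h2
    refine tubN_mono ?_ (le_max_left _ _)
    by_cases c0 : k = 0
    · subst c0; rw [← hcl]; exact hvB M (by omega) le_rfl
    by_cases c1 : k ≤ 3
    · exact hvA k (by omega) c1
    · exact hvB k (by omega) h2
  refine ⟨A0, hA0, fun i hi hi' => ?_⟩
  obtain ⟨δ, ℓ, hδ, hδ0, hδ1, hδS⟩ := hseg i hi hi'
  rw [hδS]
  rintro _ ⟨s, hs, rfl⟩
  exact hQQ A0 hA0 _ (le_max_right _ _) δ ℓ hδ (by rw [hδ0]; exact hv i hi hi'.le)
    (by rw [hδ1]; exact hv (i + 1) (by omega) (by omega)) s hs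

theorem tprop_all {𝓐 : Set (Set X)} (hX : GeodesicSpace X) (hα : Alpha1 𝓐) (hQ : PropQ 𝓐)
    (hβ : Beta3 𝓐) (m : ℕ) :
    ∃ H χ, 0 < H ∧ 0 < χ ∧ ∀ M : ℤ, 4 ≤ M → M ≤ m + 6 → TProp 𝓐 M H χ := by
  induction m with
  | zero =>
    obtain ⟨θ, hθ, ν, hν, χ, hχ, h⟩ := hβ
    have h0 : 0 < ν * θ := by positivity
    have h6 := tprop_six hθ hν h
    have h5 : TProp 𝓐 5 _ χ := TProp.pred (M := 5) (by omega) (by linarith) h6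
    have h4 : TProp 𝓐 4 _ χ := TProp.pred (M := 4) (by omega) (by linarith) h5
    refine ⟨4 * (4 * (2 * (ν * θ))), χ, by linarith, hχ, fun M h1 h2 => ?_⟩
    have : M = 4 ∨ M = 5 ∨ M = 6 := by push_cast at h2; omega
    rcases this with rfl | rfl | rfl
    · exact h4
    · exact h5.mono (by linarith) le_rfl
    · exact h6.mono (by linarith) le_rfl
  | succ m ih =>
    obtain ⟨H, χ, hH, hχ, h⟩ := ih
    obtain ⟨H', χ', hH', hχ', h'⟩ := tprop_step hX hα hQ (M := (m : ℤ) + 7) (by omega) hH hχ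
      (fun M' h1 h2 => h M' h1 (by omega))
    refine ⟨max H H', max χ χ', lt_max_of_lt_left hH, lt_max_of_lt_left hχ, fun M h1 h2 => ?_⟩
    push_cast at h2
    by_cases c : M = m + 7
    · subst c
      exact h'.mono (le_max_right _ _) (le_max_right _ _)
    · exact (h M h1 (by omega)).mono (le_max_left _ _) (le_max_left _ _)

/-! ### Cutting the corners of a fat polygon -/

/-- Leaving a set through a point close to one of its endpoints. -/
theorem exit_near {γ : ℝ → X} {ℓ θ t0 : ℝ} {E : Set X} {a b : X} (hγ : IsoOn γ 0 ℓ)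
    (hE : IsCompact E) (hθ : 0 < θ)
    (hF : ∀ p ∈ E, ∀ s ∈ Icc 0 ℓ, γ s ∉ E → 2 * θ ≤ dist p a → 2 * θ ≤ dist p b →
      θ ≤ dist p (γ s))
    (h0 : t0 ∈ Icc 0 ℓ) (hin : γ t0 ∈ E) (hout : γ ℓ ∉ E) :
    ∃ t ∈ Icc 0 ℓ, t0 ≤ t ∧ γ t ∈ E ∧ (dist (γ t) a < 2 * θ ∨ dist (γ t) b < 2 * θ) := by
  obtain ⟨t, ht, ⟨y, hy, hyt⟩, hlast⟩ := exists_last_touch (lam := 0) hγ hE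
    ⟨t0, h0, γ t0, hin, by simp⟩
  have hty : γ t = y := dist_le_zero.mp hyt
  have htE : γ t ∈ E := hty ▸ hy
  have ht0 : t0 ≤ t := by
    by_contra hc
    have := hlast t0 h0 (not_le.mp hc) (γ t0) hin
    simp at this
  refine ⟨t, ht, ht0, htE, ?_⟩
  by_contra hcon
  push Not at hcon
  have htl : t < ℓ := lt_of_le_of_ne ht.2 (fun h => hout (h ▸ htE))
  have m1 : t < min ℓ (t + θ / 2) := lt_min htl (by linarith)
  have m2 : min ℓ (t + θ / 2) ≤ ℓ := min_le_left _ _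
  have m3 : min ℓ (t + θ / 2) ≤ t + θ / 2 := min_le_right _ _
  have hs : min ℓ (t + θ / 2) ∈ Icc 0 ℓ := ⟨by linarith [ht.1], m2⟩
  have hn : γ (min ℓ (t + θ / 2)) ∉ E := by
    intro h
    have := hlast _ hs m1 _ h
    simp at this
  have e1 := hF _ htE _ hs hn hcon.1 hcon.2
  have e2 := hγ.dist_le ht.1 m1.le m2
  linarith

/-- A fat polygon indexed by the integers, periodically. -/
structure FatData (k : ℤ) (θ : ℝ) (γ : ℤ → ℝ → X) (ℓ : ℤ → ℝ) : Prop where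
  three : 3 ≤ k
  pos : 0 < θ
  per : ∀ i j, i % k = j % k → γ i = γ j ∧ ℓ i = ℓ j
  nonneg : ∀ i, 0 ≤ ℓ i
  iso : ∀ i, IsoOn (γ i) 0 (ℓ i)
  closed : ∀ i, γ i (ℓ i) = γ (i + 1) 0
  fat1 : ∀ i j, ∀ p ∈ γ i '' Icc 0 (ℓ i), ∀ q ∈ γ j '' Icc 0 (ℓ j), q ∉ γ i '' Icc 0 (ℓ i) →
    2 * θ ≤ dist p (γ i 0) → 2 * θ ≤ dist p (γ (i + 1) 0) → θ ≤ dist p q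
  fat2 : ∀ i j, i < j → j < i + k - 1 → ∀ q ∈ γ j '' Icc 0 (ℓ j), 40 * θ ≤ dist (γ i 0) q

namespace FatData

variable {k : ℤ} {θ : ℝ} {γ : ℤ → ℝ → X} {ℓ : ℤ → ℝ}

theorem shift (h : FatData k θ γ ℓ) (i : ℤ) : γ (i + k) = γ i ∧ ℓ (i + k) = ℓ i :=
  h.per _ _ (by simp)

theorem compact (h : FatData k θ γ ℓ) (i : ℤ) : IsCompact (γ i '' Icc 0 (ℓ i)) :=
  isCompact_Icc.image_of_continuousOn (h.iso i).continuousOn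

theorem start_mem (h : FatData k θ γ ℓ) (i : ℤ) : γ i 0 ∈ γ i '' Icc 0 (ℓ i) :=
  ⟨0, ⟨le_rfl, h.nonneg i⟩, rfl⟩

theorem end_mem (h : FatData k θ γ ℓ) (i : ℤ) : γ (i + 1) 0 ∈ γ i '' Icc 0 (ℓ i) :=
  ⟨ℓ i, ⟨h.nonneg i, le_rfl⟩, h.closed i⟩

theorem vert (h : FatData k θ γ ℓ) (i j : ℤ) (h1 : i < j) (h2 : j < i + k) :
    40 * θ ≤ dist (γ i 0) (γ j 0) := by
  have := h.three
  rcases lt_or_ge j (i + k - 1) with h3 | h3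
  · exact h.fat2 i j h1 h3 _ (h.start_mem j)
  · have e := h.fat2 i (j - 1) (by omega) (by omega) _ (h.end_mem (j - 1))
    simpa using e

theorem notMem_of_far (h : FatData k θ γ ℓ) {p : X} {E : Set X}
    (hf : ∀ q ∈ E, 40 * θ ≤ dist p q) : p ∉ E := by
  intro hp
  have := hf p hp
  have := h.pos
  rw [dist_self] at *
  linarith

theorem nonadj (h : FatData k θ γ ℓ) (i j : ℤ) (h1 : i + 2 ≤ j) (h2 : j ≤ i + k - 2) :
    FarSep θ (γ i '' Icc 0 (ℓ i)) (γ j '' Icc 0 (ℓ j)) := by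
  have hθ := h.pos
  have hk := h.three
  have fa := h.fat2 i j (by omega) (by omega)
  have fb := h.fat2 (i + 1) j (by omega) (by omega)
  have hdisj : ∀ q ∈ γ j '' Icc 0 (ℓ j), q ∉ γ i '' Icc 0 (ℓ i) := by
    rintro _ ⟨t0, ht0, rfl⟩ hq
    have hout : γ j (ℓ j) ∉ γ i '' Icc 0 (ℓ i) := by
      rw [h.closed]
      have := h.fat2 (j + 1) (i + k) (by omega) (by omega)
      rw [(h.shift i).1, (h.shift i).2] at this
      exact h.notMem_of_far this
    obtain ⟨t, ht, -, -, hc⟩ := exit_near (h.iso j) (h.compact i) hθ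
      (fun p hp s hs hn => h.fat1 i j p hp _ ⟨s, hs, rfl⟩ hn) ht0 hq hout
    have e1 := fa _ ⟨t, ht, rfl⟩
    have e2 := fb _ ⟨t, ht, rfl⟩
    rw [dist_comm] at e1 e2
    rcases hc with hc | hc <;> linarith
  intro p hp q hq
  have e1 := fa q hq
  have e2 := fb q hq
  have t1 := dist_triangle_left (γ i 0) q p
  have t2 := dist_triangle_left (γ (i + 1) 0) q p
  by_contra hcon
  push Not at hcon
  rcases lt_or_ge (dist p (γ i 0)) (2 * θ) with c1 | c1
  · linarith
  rcases lt_or_ge (dist p (γ (i + 1) 0)) (2 * θ) with c2 | c2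
  · linarith
  have := h.fat1 i j p hp q hq (hdisj q hq) c1 c2
  linarith

theorem adj (h : FatData k θ γ ℓ) (i : ℤ) : ∀ p ∈ γ i '' Icc 0 (ℓ i),
    ∀ q ∈ γ (i + 1) '' Icc 0 (ℓ (i + 1)), dist p q < θ → dist p (γ (i + 1) 0) < 3 * θ := by
  intro p hp q hq hpq
  have hθ := h.pos
  have hk := h.three
  have fa := h.fat2 i (i + 1) (by omega) (by omega)
  by_cases hqE : q ∈ γ i '' Icc 0 (ℓ i)
  · obtain ⟨t0, ht0, rfl⟩ := hq
    have hout : γ (i + 1) (ℓ (i + 1)) ∉ γ i '' Icc 0 (ℓ i) := by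
      rw [h.closed]
      have := h.fat2 (i + 1 + 1) (i + k) (by omega) (by omega)
      rw [(h.shift i).1, (h.shift i).2] at this
      exact h.notMem_of_far this
    obtain ⟨t, ht, htt, -, hc⟩ := exit_near (h.iso (i + 1)) (h.compact i) hθ
      (fun p hp s hs hn => h.fat1 i (i + 1) p hp _ ⟨s, hs, rfl⟩ hn) ht0 hqE hout
    have e1 := fa _ ⟨t, ht, rfl⟩
    rw [dist_comm] at e1
    rcases hc with hc | hc
    · linarith
    have d1 := (h.iso (i + 1)).dist_le le_rfl ht.1 ht.2
    have d0 := (h.iso (i + 1)).dist_le le_rfl ht0.1 ht0.2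
    rw [dist_comm] at d1 d0
    have := dist_triangle p (γ (i + 1) t0) (γ (i + 1) 0)
    linarith
  · by_contra hcon
    push Not at hcon
    have e1 := fa q hq
    have t1 := dist_triangle_left (γ i 0) q p
    rcases lt_or_ge (dist p (γ i 0)) (2 * θ) with c1 | c1
    · linarith
    have := h.fat1 i (i + 1) p hp q hq hqE c1 (by linarith)
    linarith

theorem len (h : FatData k θ γ ℓ) (i : ℤ) : 40 * θ ≤ ℓ i := by
  have hk := h.three
  have e := h.vert i (i + 1) (by omega) (by omega)
  rw [← h.closed, (h.iso i).dist_le le_rfl (h.nonneg i) le_rfl] at e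
  linarith

theorem corner (h : FatData k θ γ ℓ) (hX : GeodesicSpace X) {H : ℝ} (hH : 0 < H) (hHθ : H < θ)
    (i : ℤ) : ∃ (t r : ℝ) (G : Set X), t ∈ Icc 0 (ℓ i) ∧ r ∈ Icc 0 (ℓ (i + 1)) ∧ r < 4 * θ ∧
      ℓ i - 3 * θ < t ∧ dist (γ i t) (γ (i + 1) r) = H ∧ IsSeg G (γ i t) (γ (i + 1) r) ∧
      ∀ s ∈ Icc 0 (ℓ i), s ≤ t → ∀ y ∈ γ (i + 1) '' Icc 0 (ℓ (i + 1)), H ≤ dist (γ i s) y := by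
  have hθ := h.pos
  obtain ⟨t, ht, ⟨y, hy, hyt⟩, hfirst⟩ := exists_first_touch (lam := H) (h.iso i) (h.compact (i + 1))
    ⟨ℓ i, ⟨h.nonneg i, le_rfl⟩, γ (i + 1) 0, h.start_mem _, by rw [h.closed]; simpa using hH.le⟩
  obtain ⟨r, hr, rfl⟩ := hy
  obtain ⟨G, hG⟩ := hX.exists_seg (γ i t) (γ (i + 1) r)
  have a1 := h.adj i _ ⟨t, ht, rfl⟩ _ ⟨r, hr, rfl⟩ (by linarith)
  have d1 := (h.iso i).dist_le ht.1 ht.2 le_rfl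
  rw [h.closed] at d1
  have d2 := (h.iso (i + 1)).dist_le le_rfl hr.1 hr.2
  have tr := dist_triangle_left (γ (i + 1) 0) (γ (i + 1) r) (γ i t)
  have hl := h.len i
  have hall : ∀ s ∈ Icc 0 (ℓ i), s ≤ t → ∀ y ∈ γ (i + 1) '' Icc 0 (ℓ (i + 1)),
      H ≤ dist (γ i s) y := by
    intro s hs hst y hy
    rcases hst.lt_or_eq with hlt | rfl
    · exact (hfirst s hs hlt y hy).le
    · exact (h.iso i).ge_of_left (b := 0) le_rfl (by linarith) hs.2
        (fun s' hs' _ hlt => (hfirst s' hs' hlt y hy).le)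
  exact ⟨t, r, G, ht, hr, by linarith, by linarith,
    le_antisymm hyt (hall t ht le_rfl _ ⟨r, hr, rfl⟩), hG, hall⟩

theorem cut (h : FatData k θ γ ℓ) (hX : GeodesicSpace X) {𝓐 : Set (Set X)} {H χ : ℝ} (hH : 0 < H)
    (hHθ : H < θ) (hT : TProp 𝓐 (2 * k) H χ) :
    ∃ A ∈ 𝓐, ∀ i, 0 ≤ i → i < k → γ i '' Icc 0 (ℓ i) ⊆ tubN (χ + 4 * θ) A := by
  have hθ := h.pos
  have hk := h.three
  -- periodic choice of the corner data
  have hper : ∃ (t r : ℤ → ℝ) (G : ℤ → Set X),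
      (∀ i, t (i + k) = t i ∧ r (i + k) = r i ∧ G (i + k) = G i) ∧
      ∀ i, t i ∈ Icc 0 (ℓ i) ∧ r i ∈ Icc 0 (ℓ (i + 1)) ∧ r i < 4 * θ ∧
      ℓ i - 3 * θ < t i ∧ dist (γ i (t i)) (γ (i + 1) (r i)) = H ∧
      IsSeg (G i) (γ i (t i)) (γ (i + 1) (r i)) ∧
      ∀ s ∈ Icc 0 (ℓ i), s ≤ t i → ∀ y ∈ γ (i + 1) '' Icc 0 (ℓ (i + 1)),
        H ≤ dist (γ i s) y := by
    choose t r G hc using fun i => h.corner hX hH hHθ i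
    refine ⟨fun i => t (i % k), fun i => r (i % k), fun i => G (i % k), fun i => by simp,
      fun i => ?_⟩
    have e1 := h.per (i % k) i (by simp)
    have e2 := h.per (i % k + 1) (i + 1) (by simp)
    have := hc (i % k)
    rw [e1.1, e1.2, e2.1, e2.2] at this
    exact this
  obtain ⟨t, r, G, hp, hc⟩ := hper
  choose ht hr hr4 ht3 hd hG hfar using hc
  -- the kept pieces
  obtain ⟨K, hK⟩ : ∃ K : ℤ → Set X, ∀ i, K i = γ i '' Icc (r (i - 1)) (t i) := ⟨_, fun _ => rfl⟩
  have hKper : ∀ i, K (i + k) = K i := by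
    intro i
    rw [hK, hK, (h.shift i).1, (hp i).1, show i + k - 1 = (i - 1) + k by ring, (hp _).2.1]
  have hr0 : ∀ i, 0 ≤ r (i - 1) := fun i => (hr (i - 1)).1
  have hrt : ∀ i, r (i - 1) + H ≤ t i := by
    intro i
    have := h.len i
    have := hr4 (i - 1)
    have := ht3 i
    linarith
  have hKE : ∀ i, K i ⊆ γ i '' Icc 0 (ℓ i) := by
    intro i
    rw [hK]
    exact image_mono (Icc_subset_Icc (hr0 i) (ht i).2)
  have hKseg : ∀ i, IsSeg (K i) (γ i (r (i - 1))) (γ i (t i)) := by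
    intro i
    rw [hK]
    exact (h.iso i).isSeg (hr0 i) (by linarith [hrt i]) (ht i).2
  have hKK : ∀ i, FarSep H (K i) (γ (i + 1) '' Icc 0 (ℓ (i + 1))) := by
    intro i x hx y hy
    rw [hK] at hx
    obtain ⟨s, hs, rfl⟩ := hx
    exact hfar i s ⟨(hr0 i).trans hs.1, hs.2.trans (ht i).2⟩ hs.2 y hy
  have hgood1 : ∀ i, Good (K i) (G i) (γ i (t i)) := by
    intro i
    refine good_of_perp (hG i) (fun p hp => ?_)
    rw [hd]
    exact hKK i p hp _ ⟨r i, hr i, rfl⟩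
  have hgood2 : ∀ i, Good (G i) (K (i + 1)) (γ (i + 1) (r i)) := by
    intro i
    refine (good_of_perp (hG i).symm (fun p hp => ?_)).symm
    rw [dist_comm, hd, dist_comm]
    exact hfar i _ (ht i) le_rfl p (hKE _ hp)
  have hGnear : ∀ i, ∀ x ∈ G i, dist x (γ (i + 1) 0) < 4 * θ := by
    intro i x hx
    have e1 := (hG i).dist_add hx
    rw [hd] at e1
    have e2 := (h.iso i).dist_le (ht i).1 (ht i).2 le_rfl
    rw [h.closed] at e2
    have e3 := dist_triangle_left x (γ (i + 1) 0) (γ i (t i))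
    have e4 := ht3 i
    have e5 := dist_nonneg (x := x) (y := γ (i + 1) (r i))
    linarith
  have hGG : ∀ i j, i < j → j < i + k → FarSep H (G i) (G j) := by
    intro i j h1 h2 x hx y hy
    have e1 := hGnear i x hx
    have e2 := hGnear j y hy
    have e3 := h.vert (i + 1) (j + 1) (by omega) (by omega)
    have e4 := dist_triangle4_left (γ (i + 1) 0) x y (γ (j + 1) 0)
    have e5 := dist_triangle4 (γ (i + 1) 0) x y (γ (j + 1) 0)
    rw [dist_comm _ x] at e5
    linarith
  have hGK : ∀ i j, i + 1 < j → j < i + k → FarSep H (G i) (K j) := by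
    intro i j h1 h2 x hx y hy
    have e1 := hGnear i x hx
    have e3 := h.fat2 (i + 1) j (by omega) (by omega) y (hKE _ hy)
    have e5 := dist_triangle_left (γ (i + 1) 0) y x
    linarith
  -- the polygon with doubled number of sides
  obtain ⟨A, hA, hsub⟩ := hT (fun n => if n % 2 = 0 then K (n / 2) else G (n / 2))
    (fun n => if n % 2 = 0 then γ (n / 2) (r (n / 2 - 1)) else γ (n / 2) (t (n / 2)))
    (by
      intro n _ _
      rcases Int.even_or_odd' n with ⟨a, rfl | rfl⟩
      · have a1 : 2 * a % 2 = 0 := by omega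
        have a2 : 2 * a / 2 = a := by omega
        have a3 : (2 * a + 1) % 2 = 1 := by omega
        have a4 : (2 * a + 1) / 2 = a := by omega
        simpa only [a1, a2, a3, a4, if_true, one_ne_zero, if_false] using hKseg a
      · have a1 : (2 * a + 1 + 1) % 2 = 0 := by omega
        have a2 : (2 * a + 1 + 1) / 2 = a + 1 := by omega
        have a3 : (2 * a + 1) % 2 = 1 := by omega
        have a4 : (2 * a + 1) / 2 = a := by omega
        simpa only [a1, a2, a3, a4, if_true, one_ne_zero, if_false, add_sub_cancel_right] using hG a)
    (by
      have a1 : 2 * k % 2 = 0 := by omega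
      have a2 : 2 * k / 2 = k := by omega
      have e1 := h.shift 0
      have e2 := hp (0 - 1)
      rw [zero_add] at e1
      rw [show 0 - 1 + k = k - 1 by ring] at e2
      simp only [a1, a2, if_true, Int.zero_emod, Int.zero_ediv]
      rw [e1.1, e2.2.1])
    (by
      intro n _ _
      rcases Int.even_or_odd' n with ⟨a, rfl | rfl⟩
      · have a1 : 2 * a % 2 = 0 := by omega
        have a2 : 2 * a / 2 = a := by omega
        have a3 : (2 * a + 1) % 2 = 1 := by omega
        have a4 : (2 * a + 1) / 2 = a := by omega
        simp only [a1, a2, a3, a4, if_true, one_ne_zero, if_false]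
        rw [(h.iso a).dist_le (hr0 a) (by linarith [hrt a]) (ht a).2]
        linarith [hrt a]
      · have a1 : (2 * a + 1 + 1) % 2 = 0 := by omega
        have a2 : (2 * a + 1 + 1) / 2 = a + 1 := by omega
        have a3 : (2 * a + 1) % 2 = 1 := by omega
        have a4 : (2 * a + 1) / 2 = a := by omega
        simp only [a1, a2, a3, a4, if_true, one_ne_zero, if_false, add_sub_cancel_right]
        exact (hd a).ge)
    (by
      intro n _ _
      rcases Int.even_or_odd' n with ⟨a, rfl | rfl⟩
      · have a1 : 2 * a % 2 = 0 := by omega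
        have a2 : 2 * a / 2 = a := by omega
        have a3 : (2 * a + 1) % 2 = 1 := by omega
        have a4 : (2 * a + 1) / 2 = a := by omega
        simpa only [a1, a2, a3, a4, if_true, one_ne_zero, if_false] using hgood1 a
      · have a1 : (2 * a + 1 + 1) % 2 = 0 := by omega
        have a2 : (2 * a + 1 + 1) / 2 = a + 1 := by omega
        have a3 : (2 * a + 1) % 2 = 1 := by omega
        have a4 : (2 * a + 1) / 2 = a := by omega
        simpa only [a1, a2, a3, a4, if_true, one_ne_zero, if_false, add_sub_cancel_right]
          using hgood2 a)
    (by
      have a1 : (2 * k - 1) % 2 = 1 := by omega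
      have a2 : (2 * k - 1) / 2 = 0 - 1 + k := by omega
      have e := hgood2 (0 - 1)
      simp only [a1, a2, if_true, one_ne_zero, if_false, Int.zero_emod, Int.zero_ediv]
      rw [(hp (0 - 1)).2.2]
      simpa using e)
    (by
      intro i j h1 h2 h3 h4
      rcases Int.even_or_odd' i with ⟨a, rfl | rfl⟩ <;> rcases Int.even_or_odd' j with ⟨b, rfl | rfl⟩
      · have a1 : 2 * a % 2 = 0 := by omega
        have a2 : 2 * a / 2 = a := by omega
        have a3 : 2 * b % 2 = 0 := by omega
        have a4 : 2 * b / 2 = b := by omega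
        simp only [a1, a2, a3, a4, if_true]
        by_cases hb : b = a + 1
        · subst hb
          exact (hKK a).mono subset_rfl (hKE _) le_rfl
        by_cases hb' : b = a + k - 1
        · have e := (hKK b).symm
          rw [show b + 1 = a + k by omega, (h.shift a).1, (h.shift a).2] at e
          exact e.mono (hKE _) subset_rfl le_rfl
        · exact (h.nonadj a b (by omega) (by omega)).mono (hKE _) (hKE _) hHθ.le
      · have a1 : 2 * a % 2 = 0 := by omega
        have a2 : 2 * a / 2 = a := by omega
        have a3 : (2 * b + 1) % 2 = 1 := by omega
        have a4 : (2 * b + 1) / 2 = b := by omega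
        simp only [a1, a2, a3, a4, if_true, one_ne_zero, if_false]
        rw [← hKper]
        exact (hGK b (a + k) (by omega) (by omega)).symm
      · have a1 : 2 * b % 2 = 0 := by omega
        have a2 : 2 * b / 2 = b := by omega
        have a3 : (2 * a + 1) % 2 = 1 := by omega
        have a4 : (2 * a + 1) / 2 = a := by omega
        simp only [a1, a2, a3, a4, if_true, one_ne_zero, if_false]
        exact hGK a b (by omega) (by omega)
      · have a1 : (2 * b + 1) % 2 = 1 := by omega
        have a2 : (2 * b + 1) / 2 = b := by omega
        have a3 : (2 * a + 1) % 2 = 1 := by omega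
        have a4 : (2 * a + 1) / 2 = a := by omega
        simp only [a1, a2, a3, a4, one_ne_zero, if_false]
        exact hGG a b (by omega) (by omega))
  refine ⟨A, hA, fun i hi1 hi2 => ?_⟩
  have hKA : K i ⊆ tubN χ A := by
    have e := hsub (2 * i) (by omega) (by omega)
    have a1 : 2 * i % 2 = 0 := by omega
    have a2 : 2 * i / 2 = i := by omega
    simpa only [a1, a2, if_true] using e
  rintro _ ⟨s, hs, rfl⟩
  rcases lt_or_ge s (r (i - 1)) with c1 | c1
  · refine tubN_of_dist (hKA (hKseg i).left_mem) ?_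
    rw [dist_comm, (h.iso i).dist_le hs.1 c1.le (by linarith [hrt i, (ht i).2])]
    linarith [hr4 (i - 1), hs.1]
  rcases lt_or_ge (t i) s with c2 | c2
  · refine tubN_of_dist (hKA (hKseg i).right_mem) ?_
    rw [(h.iso i).dist_le (ht i).1 c2.le hs.2]
    linarith [ht3 i, hs.2]
  · refine tubN_mono (hKA ?_) (by linarith)
    rw [hK]
    exact ⟨s, ⟨c1, c2⟩, rfl⟩

end FatData

/-- The integer-indexed version of a fat polygon. -/
theorem fatData_of_polygon {k : ℕ} (hk : 3 ≤ k) {θ : ℝ} (hθ : 0 < θ) (P : PrePolygon X k)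
    (hP : P.IsGeodesicPolygon) (hF : P.IsFat2 θ 40) :
    ∃ φ : ℤ → Fin k, (∀ i : Fin k, φ (i.val : ℤ) = i) ∧
      FatData (k : ℤ) θ (fun i => P.edge (φ i)) (fun i => P.len (φ i)) := by
  have hk0 : (0 : ℤ) < k := by omega
  have hlt : ∀ i : ℤ, (i % k).toNat < k := by
    intro i
    have := Int.emod_lt_of_pos i hk0
    have := Int.emod_nonneg i hk0.ne'
    omega
  obtain ⟨φ, hφ⟩ : ∃ φ : ℤ → Fin k, ∀ i, φ i = ⟨(i % k).toNat, hlt i⟩ := ⟨_, fun _ => rfl⟩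
  have hval : ∀ i, ((φ i).val : ℤ) = i % k := by
    intro i
    rw [hφ]
    exact Int.toNat_of_nonneg (Int.emod_nonneg i hk0.ne')
  have hsucc : ∀ i, finCycSucc (φ i) = φ (i + 1) := by
    intro i
    apply Fin.ext
    have e := hval (i + 1)
    have : (((finCycSucc (φ i)).val : ℕ) : ℤ) = ((φ i).val + 1 : ℤ) % k := by
      simp [finCycSucc]
    rw [hval] at this
    have e2 : (i % k + 1) % k = (i + 1) % k := by simp
    omega
  have hinj : ∀ i j : ℤ, φ i = φ j → ∃ c, i - j = k * c := by
    intro i j hij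
    have : i % k = j % k := by rw [← hval, ← hval, hij]
    exact Int.ModEq.dvd (Int.ModEq.symm this)
  have hne : ∀ i j : ℤ, i < j → j < i + k → φ j ≠ φ i := by
    intro i j h1 h2 he
    obtain ⟨c, hc⟩ := hinj _ _ he
    have c1 : 0 < c := by
      by_contra hcon
      nlinarith
    nlinarith
  refine ⟨φ, ?_, ?_⟩
  · intro i
    apply Fin.ext
    have e := hval i.val
    have : ((i.val : ℤ)) % k = i.val := Int.emod_eq_of_lt (by omega) (by omega)
    omega
  refine ⟨by omega, hθ, ?_, fun i => hP.1.1 _, fun i => (hP.2 _).2, ?_, ?_, ?_⟩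
  · intro i j hij
    have : φ i = φ j := by
      apply Fin.ext
      have e1 := hval i
      have e2 := hval j
      omega
    simp [this]
  · intro i
    have := hP.1.2 (φ i)
    rwa [hsucc] at this
  · intro i j p hp q hq hn h1 h2
    have e := hF.1 (φ i) p hp h1 (by rw [hP.1.2, hsucc]; exact h2)
    exact e.trans (infDist_le_dist_of_mem ⟨mem_iUnion.mpr ⟨φ j, hq⟩, hn⟩)
  · intro i j h1 h2 q hq
    have e := hF.2 (φ i)
    refine e.trans (infDist_le_dist_of_mem ?_)
    refine mem_iUnion₂.mpr ⟨φ j, ⟨hne i j h1 (by omega), ?_⟩, hq⟩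
    rw [hsucc]
    exact hne i (j + 1) (by omega) (by omega)

theorem alpha3_of {𝓐 : Set (Set X)} (hX : GeodesicSpace X) (hα : Alpha1 𝓐) (hQ : PropQ 𝓐)
    (hβ : Beta3 𝓐) : Alpha3 𝓐 := by
  intro k hk
  rcases Nat.lt_or_ge k 3 with hk2 | hk3
  · have : k = 2 := by omega
    subst this
    refine ⟨1, one_pos, 8, le_rfl, 1, one_pos, fun P _ hF => ?_⟩
    exfalso
    have e := hF.2 0
    have : P.opp 0 = ∅ := by
      rw [PrePolygon.opp]
      simp only [iUnion_eq_empty]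
      rintro j ⟨h1, h2⟩
      exfalso
      revert h1 h2
      fin_cases j <;> decide
    rw [this, infDist_empty] at e
    norm_num at e
  · obtain ⟨H, χ, hH, hχ, hT⟩ := tprop_all hX hα hQ hβ (2 * k)
    have hT' := hT (2 * k) (by omega) (by push_cast; omega)
    refine ⟨2 * H, by linarith, 40, by norm_num, χ + 4 * (2 * H), by linarith, fun P hP hF => ?_⟩
    obtain ⟨φ, hφ, hD⟩ := fatData_of_polygon hk3 (by linarith) P hP hF
    obtain ⟨A, hA, h⟩ := hD.cut hX hH (by linarith) hT'
    refine ⟨A, hA, iUnion_subset fun i => ?_⟩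
    have := h i.val (by omega) (by omega)
    simp only [hφ] at this
    exact this

/-- **Lemma.** If a geodesic metric space `X` and a collection `𝓐` of subsets satisfy
(α₁), (α₂), (Q) and (β₃), then `X` is asymptotically tree-graded with respect to `𝓐`;
in particular (α₃) holds. -/
theorem atg_of_alpha1_alpha2_q_beta3 (hX : GeodesicSpace X) (𝓐 : Set (Set X))
    (h1 : Alpha1 𝓐) (h2 : Alpha2 𝓐) (hQ : PropQ 𝓐) (h3 : Beta3 𝓐) :
    ATG 𝓐 := by
  exact ⟨h1, h2, alpha3_of hX h1 hQ h3⟩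
end

section
/- Let X be a geodesic metric space that is (*)-asymptotically tree-graded with respect to a collection 𝓐 of subsets, and assume moreover that (X,𝓐) satisfies properties (α1), (α2) and (Q). Then there exist θ > 0, ν ≥ 8 and χ > 0 such that every geodesic quadrilateral in X which is (θ,ν)-fat is contained in N_χ(A) for some A ∈ 𝓐. -/
open Set Metric

/-! ### Basic metric notions: tubular neighborhoods, geodesics -/

variable {X : Type*} [MetricSpace X]

/-! ### Auxiliary lemmas -/

lemma aux_dist_ctub {σ : ℝ} {A : Set X} {x y : X} {c : ℝ} (hx : x ∈ ctubN σ A)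
    (h : dist y x ≤ c) : infDist y A ≤ σ + c := by
  have := infDist_le_infDist_add_dist (s := A) (x := y) (y := x)
  have h2 : infDist x A ≤ σ := hx
  linarith

lemma geo_dist {γ : ℝ → X} {ℓ : ℝ} (h : IsGeodesicParam γ ℓ) {s t : ℝ} (hs : 0 ≤ s) (hst : s ≤ t)
    (ht : t ≤ ℓ) : dist (γ s) (γ t) = t - s := by
  rw [h.2 s ⟨hs, by linarith⟩ t ⟨by linarith, ht⟩, abs_sub_comm, abs_of_nonneg (by linarith)]

lemma geo_sub {γ : ℝ → X} {ℓ : ℝ} (h : IsGeodesicParam γ ℓ) {a b : ℝ} (ha : 0 ≤ a) (hab : a ≤ b)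
    (hb : b ≤ ℓ) : IsGeodesicParam (fun s => γ (a + s)) (b - a) := by
  refine ⟨by linarith, fun s hs t ht => ?_⟩
  have := h.2 (a + s) ⟨by linarith [hs.1], by linarith [hs.2]⟩ (a + t)
    ⟨by linarith [ht.1], by linarith [ht.2]⟩
  simp only [this]
  congr 1; ring

lemma geo_rev {γ : ℝ → X} {ℓ : ℝ} (h : IsGeodesicParam γ ℓ) :
    IsGeodesicParam (fun s => γ (ℓ - s)) ℓ := by
  refine ⟨h.1, fun s hs t ht => ?_⟩
  have := h.2 (ℓ - s) ⟨by linarith [hs.2], by linarith [hs.1]⟩ (ℓ - t)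
    ⟨by linarith [ht.2], by linarith [ht.1]⟩
  simp only [this]
  rw [abs_sub_comm]; congr 1; ring

lemma geo_almost {γ : ℝ → X} {ℓ C : ℝ} (h : IsGeodesicParam γ ℓ) (hC : 0 ≤ C) :
    IsAlmostGeodesic C γ ℓ := by
  refine ⟨h.1, fun s hs t ht => ?_⟩
  rw [h.2 s hs t ht]
  exact ⟨by linarith, le_rfl⟩

/-- concatenation of a short geodesic and a geodesic -/
lemma concat_almost {α β : ℝ → X} {a b κ : ℝ} (hα : IsGeodesicParam α a) (hβ : IsGeodesicParam β b)
    (hj : α a = β 0) (ha : a ≤ κ) :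
    IsAlmostGeodesic (2 * κ) (fun s => if s ≤ a then α s else β (s - a)) (a + b) := by
  have ha0 := hα.1
  have hb0 := hβ.1
  have key : ∀ s t : ℝ, 0 ≤ s → s ≤ t → t ≤ a + b →
      t - s - 2 * κ ≤ dist (if s ≤ a then α s else β (s - a)) (if t ≤ a then α t else β (t - a)) ∧
      dist (if s ≤ a then α s else β (s - a)) (if t ≤ a then α t else β (t - a)) ≤ t - s := by
    intro s t hs hst ht
    by_cases h1 : t ≤ a
    · rw [if_pos h1, if_pos (by linarith), geo_dist hα hs hst h1]
      constructor <;> linarith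
    · rw [if_neg h1]
      push Not at h1
      by_cases h2 : s ≤ a
      · rw [if_pos h2]
        have e1 := geo_dist hα hs h2 le_rfl
        have e2 := geo_dist hβ le_rfl (show 0 ≤ t - a by linarith) (by linarith)
        rw [← hj] at e2
        have t1 := dist_triangle (α s) (α a) (β (t - a))
        have t2 := dist_triangle (α a) (α s) (β (t - a))
        rw [dist_comm (α a) (α s)] at t2
        constructor <;> linarith
      · rw [if_neg h2]
        push Not at h2
        rw [geo_dist hβ (by linarith) (by linarith) (by linarith)]
        constructor <;> linarith
  refine ⟨by linarith, fun s hs t ht => ?_⟩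
  rcases le_total s t with h | h
  · have := key s t hs.1 h ht.2
    rw [abs_sub_comm, abs_of_nonneg (by linarith)]
    exact this
  · have := key t s ht.1 h hs.2
    rw [abs_of_nonneg (by linarith), dist_comm]
    exact this

lemma hit_compact {C : ℝ} {p : ℝ → X} {ℓ : ℝ} (hp : IsAlmostGeodesic C p ℓ) (σ : ℝ) (A : Set X) :
    IsCompact {t | t ∈ Set.Icc (0:ℝ) ℓ ∧ p t ∈ ctubN σ A} := by
  have hc : ContinuousOn p (Icc 0 ℓ) := by
    have : LipschitzOnWith 1 p (Icc 0 ℓ) := by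
      refine LipschitzOnWith.of_dist_le_mul fun s hs t ht => ?_
      simpa [Real.dist_eq] using (hp.2 s hs t ht).2
    exact this.continuousOn
  have hcl : IsClosed (ctubN σ A) := isClosed_le (continuous_infDist_pt A) continuous_const
  have := hc.preimage_isClosed_of_isClosed isClosed_Icc hcl
  exact (isCompact_Icc (a := (0:ℝ)) (b := ℓ)).of_isClosed_subset this inter_subset_left

lemma hit_props {C : ℝ} {p : ℝ → X} {ℓ : ℝ} (hp : IsAlmostGeodesic C p ℓ) (σ : ℝ) (A : Set X)
    {t₀ : ℝ} (ht₀ : t₀ ∈ Icc (0:ℝ) ℓ) (hA : p t₀ ∈ ctubN σ A) :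
    ∃ a b : ℝ, 0 ≤ a ∧ a ≤ t₀ ∧ t₀ ≤ b ∧ b ≤ ℓ ∧ p a ∈ ctubN σ A ∧ p b ∈ ctubN σ A ∧
      entrancePoint p ℓ (ctubN σ A) = p a ∧ exitPoint p ℓ (ctubN σ A) = p b ∧
      (∀ t ∈ Icc (0:ℝ) ℓ, p t ∈ ctubN σ A → a ≤ t ∧ t ≤ b) := by
  have hK := hit_compact hp σ A
  have hne : {t | t ∈ Set.Icc (0:ℝ) ℓ ∧ p t ∈ ctubN σ A}.Nonempty := ⟨t₀, ht₀, hA⟩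
  have h1 := hK.sInf_mem hne
  have h2 := hK.sSup_mem hne
  have h3 : ∀ t ∈ Icc (0:ℝ) ℓ, p t ∈ ctubN σ A →
      sInf {t | t ∈ Set.Icc (0:ℝ) ℓ ∧ p t ∈ ctubN σ A} ≤ t ∧
      t ≤ sSup {t | t ∈ Set.Icc (0:ℝ) ℓ ∧ p t ∈ ctubN σ A} := fun t ht htA =>
    ⟨csInf_le hK.bddBelow ⟨ht, htA⟩, le_csSup hK.bddAbove ⟨ht, htA⟩⟩
  exact ⟨_, _, h1.1.1, (h3 t₀ ht₀ hA).1, (h3 t₀ ht₀ hA).2, h2.1.2, h1.2, h2.2, rfl, rfl, h3⟩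

/-- Unified form of the (*) alternative. -/
lemma tri {𝓐 : Set (Set X)} {C σ δ : ℝ} (h : StarATGWith 𝓐 C σ δ) {p q r : ℝ → X} {lp lq lr : ℝ}
    (hp : IsAlmostGeodesic C p lp) (hq : IsAlmostGeodesic C q lq) (hr : IsAlmostGeodesic C r lr)
    (hpq : p lp = q 0) (hqr : q lq = r 0) (hrp : r lr = p 0) :
    ∃ p1 p2 q1 q2 r1 r2 : ℝ, (0 ≤ p1 ∧ p1 ≤ p2 ∧ p2 ≤ lp) ∧ (0 ≤ q1 ∧ q1 ≤ q2 ∧ q2 ≤ lq) ∧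
      (0 ≤ r1 ∧ r1 ≤ r2 ∧ r2 ≤ lr) ∧
      dist (p p2) (q q1) ≤ 2 * |σ| + |δ| ∧ dist (q q2) (r r1) ≤ 2 * |σ| + |δ| ∧
      dist (r r2) (p p1) ≤ 2 * |σ| + |δ| ∧
      ((p1 = p2 ∧ q1 = q2 ∧ r1 = r2) ∨
        ∃ A ∈ 𝓐, p p1 ∈ ctubN σ A ∧ p p2 ∈ ctubN σ A ∧ q q1 ∈ ctubN σ A ∧ q q2 ∈ ctubN σ A ∧
          r r1 ∈ ctubN σ A ∧ r r2 ∈ ctubN σ A) := by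
  have aσ := le_abs_self σ
  have aδ := le_abs_self δ
  have aσ0 := abs_nonneg σ
  have aδ0 := abs_nonneg δ
  have s0 : finCycSucc (0 : Fin 3) = 1 := rfl
  have s1 : finCycSucc (1 : Fin 3) = 2 := rfl
  have s2 : finCycSucc (2 : Fin 3) = 0 := rfl
  have hT := h ⟨![p, q, r], ![lp, lq, lr]⟩
    ⟨by intro i; fin_cases i; exacts [hp.1, hq.1, hr.1],
     by intro i; fin_cases i; exacts [hpq, hqr, hrp]⟩
    (by intro i; fin_cases i; exacts [hp, hq, hr])
  rcases hT with ⟨a, ha⟩ | ⟨A, hA, hne, hd⟩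
  · obtain ⟨_, h0, ⟨p1, hp1, rfl⟩⟩ := ha 0
    obtain ⟨_, h1, ⟨q1, hq1, rfl⟩⟩ := ha 1
    obtain ⟨_, h2, ⟨r1, hr1, rfl⟩⟩ := ha 2
    change p p1 ∈ _ at h0
    change q q1 ∈ _ at h1
    change r r1 ∈ _ at h2
    rw [mem_closedBall] at h0 h1 h2
    have d1 := dist_triangle_right (p p1) (q q1) a
    have d2 := dist_triangle_right (q q1) (r r1) a
    have d3 := dist_triangle_right (r r1) (p p1) a
    exact ⟨p1, p1, q1, q1, r1, r1, ⟨hp1.1, le_rfl, hp1.2⟩, ⟨hq1.1, le_rfl, hq1.2⟩,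
      ⟨hr1.1, le_rfl, hr1.2⟩, by linarith, by linarith, by linarith, Or.inl ⟨rfl, rfl, rfl⟩⟩
  · obtain ⟨_, h0, ⟨p0, hp0, rfl⟩⟩ := hne 0
    obtain ⟨_, h1, ⟨q0, hq0, rfl⟩⟩ := hne 1
    obtain ⟨_, h2, ⟨r0, hr0, rfl⟩⟩ := hne 2
    obtain ⟨p1, p2, a1, a2, a3, a4, a5, a6, a7, a8, -⟩ := hit_props hp σ A hp0 h0
    obtain ⟨q1, q2, b1, b2, b3, b4, b5, b6, b7, b8, -⟩ := hit_props hq σ A hq0 h1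
    obtain ⟨r1, r2, c1, c2, c3, c4, c5, c6, c7, c8, -⟩ := hit_props hr σ A hr0 h2
    have d0 := hd 0
    have d1 := hd 1
    have d2 := hd 2
    rw [s0] at d0
    rw [s1] at d1
    rw [s2] at d2
    change dist (exitPoint p lp _) (entrancePoint q lq _) < δ at d0
    change dist (exitPoint q lq _) (entrancePoint r lr _) < δ at d1
    change dist (exitPoint r lr _) (entrancePoint p lp _) < δ at d2
    rw [a8, b7] at d0
    rw [b8, c7] at d1
    rw [c8, a7] at d2
    exact ⟨p1, p2, q1, q2, r1, r2, ⟨a1, by linarith, a4⟩, ⟨b1, by linarith, b4⟩,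
      ⟨c1, by linarith, c4⟩, by linarith, by linarith, by linarith,
      Or.inr ⟨A, hA, a5, a6, b5, b6, c5, c6⟩⟩

/-- Every point of `g` is in an interval with endpoints close to `U` which is short or in a piece. -/
def SideProp (𝓐 : Set (Set X)) (g : ℝ → X) (ℓ : ℝ) (U : Set X) (S κ : ℝ) : Prop :=
  ∀ m ∈ Icc (0:ℝ) ℓ, ∃ s1 s2 : ℝ, 0 ≤ s1 ∧ s1 ≤ m ∧ m ≤ s2 ∧ s2 ≤ ℓ ∧
    (∃ u ∈ U, dist (g s1) u ≤ κ) ∧ (∃ u ∈ U, dist (g s2) u ≤ κ) ∧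
    (s2 - s1 ≤ κ ∨ ∃ A ∈ 𝓐, g s1 ∈ ctubN S A ∧ g s2 ∈ ctubN S A)

lemma SideProp.rev {𝓐 : Set (Set X)} {g : ℝ → X} {ℓ : ℝ} {U : Set X} {S κ : ℝ}
    (h : SideProp 𝓐 g ℓ U S κ) : SideProp 𝓐 (fun s => g (ℓ - s)) ℓ U S κ := by
  intro m hm
  obtain ⟨s1, s2, h1, h2, h3, h4, h5, h6, h7⟩ := h (ℓ - m) ⟨by linarith [hm.2], by linarith [hm.1]⟩
  refine ⟨ℓ - s2, ℓ - s1, by linarith, by linarith, by linarith, by linarith, ?_, ?_, ?_⟩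
  · simpa using h6
  · simpa using h5
  · rcases h7 with h7 | ⟨A, hA, h8, h9⟩
    · left; linarith
    · right; exact ⟨A, hA, by simpa using h9, by simpa using h8⟩

lemma bigon (hX : GeodesicSpace X) {𝓐 : Set (Set X)} {κ₀ σ δ : ℝ} (hκ : 0 ≤ κ₀)
    (h : StarATGWith 𝓐 (2 * κ₀) σ δ)
    {g k : ℝ → X} {ℓ b : ℝ} (hg : IsGeodesicParam g ℓ) (hk : IsGeodesicParam k b)
    (h0 : g 0 = k 0) (hd : dist (g ℓ) (k b) ≤ κ₀) :
    SideProp 𝓐 g ℓ (k '' Icc 0 b) σ (κ₀ + (2 * |σ| + |δ|)) := by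
  intro m hm
  obtain ⟨α, a, hα, hα0, hα1⟩ := hX (g ℓ) (k b)
  have ha : a ≤ κ₀ := by
    have := geo_dist hα le_rfl hα.1 le_rfl
    rw [hα0, hα1] at this
    linarith
  have ha0 := hα.1
  have hb0 := hk.1
  have hr := concat_almost hα (geo_rev hk) (by simpa using hα1) ha
  have hp : IsGeodesicParam g m := by simpa using geo_sub hg le_rfl hm.1 hm.2
  have hq := geo_sub hg hm.1 hm.2 le_rfl
  -- points of the third side are close to `k`
  have hclose : ∀ s, 0 ≤ s → s ≤ a + b →
      ∃ u ∈ k '' Icc 0 b, dist ((fun s => if s ≤ a then α s else (fun s => k (b - s)) (s - a)) s) u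
        ≤ κ₀ := by
    intro s hs hs'
    by_cases hsa : s ≤ a
    · refine ⟨k b, ⟨b, ⟨hb0, le_rfl⟩, rfl⟩, ?_⟩
      simp only [if_pos hsa]
      rw [← hα1, geo_dist hα hs hsa le_rfl]
      linarith
    · push Not at hsa
      refine ⟨k (b - (s - a)), ⟨_, ⟨by linarith, by linarith⟩, rfl⟩, ?_⟩
      simp only [if_neg (not_le.2 hsa), dist_self]
      exact hκ
  have hend : (fun s => if s ≤ a then α s else (fun s => k (b - s)) (s - a)) (a + b) = g 0 := by
    by_cases hb : a + b ≤ a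
    · have : b = 0 := by linarith
      subst this
      simp [hα1, h0]
    · simp only [if_neg hb]
      rw [h0]; congr 1; ring
  obtain ⟨p1, p2, q1, q2, r1, r2, ⟨hp1, hp2, hp3⟩, ⟨hq1, hq2, hq3⟩, ⟨hr1, hr2, hr3⟩, d1, d2, d3, hor⟩ :=
    tri h (geo_almost hp (by linarith)) (geo_almost hq (by linarith)) hr
      (by simp) (by simp [ha0, hα0]) hend
  have e1 : dist (g p2) (g (m + q1)) = m + q1 - p2 :=
    geo_dist hg (by linarith) (by linarith) (by linarith)
  refine ⟨p1, m + q2, hp1, by linarith, by linarith, by linarith, ?_, ?_, ?_⟩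
  · obtain ⟨u, hu, hu'⟩ := hclose r2 (by linarith) hr3
    refine ⟨u, hu, ?_⟩
    have := dist_triangle_left (g p1) u
      ((fun s => if s ≤ a then α s else (fun s => k (b - s)) (s - a)) r2)
    linarith
  · obtain ⟨u, hu, hu'⟩ := hclose r1 hr1 (by linarith)
    refine ⟨u, hu, ?_⟩
    have := dist_triangle (g (m + q2))
      ((fun s => if s ≤ a then α s else (fun s => k (b - s)) (s - a)) r1) u
    linarith
  · rcases hor with ⟨e1, e2, e3⟩ | ⟨A, hA, c1, c2, c3, c4, c5, c6⟩
    · left; subst e1 e2; linarith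
    · right; exact ⟨A, hA, c1, c4⟩

lemma ctubN_mono {σ S : ℝ} (h : σ ≤ S) {A : Set X} {x : X} (hx : x ∈ ctubN σ A) : x ∈ ctubN S A :=
  le_trans (show infDist x A ≤ σ from hx) h

lemma side (hX : GeodesicSpace X) {𝓐 : Set (Set X)} {σ₀ δ₀ σ δ : ℝ}
    (h₀ : StarATGWith 𝓐 0 σ₀ δ₀)
    (h : StarATGWith 𝓐 (2 * (2 * |σ₀| + |δ₀|)) σ δ)
    {p q g : ℝ → X} {lp lq ℓ : ℝ} (hp : IsGeodesicParam p lp) (hq : IsGeodesicParam q lq)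
    (hg : IsGeodesicParam g ℓ) (hpq : p lp = q 0) (hqg : q lq = g 0) (hgp : g ℓ = p 0) :
    SideProp 𝓐 g ℓ (p '' Icc 0 lp ∪ q '' Icc 0 lq) (|σ₀| + |σ|)
      ((2 * |σ₀| + |δ₀|) + (2 * |σ| + |δ|)) := by
  have aσ := le_abs_self σ
  have aδ := le_abs_self δ
  have aσ0 := abs_nonneg σ
  have aδ0 := abs_nonneg δ
  have bσ := le_abs_self σ₀
  have bδ := le_abs_self δ₀
  have bσ0 := abs_nonneg σ₀
  have bδ0 := abs_nonneg δ₀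
  have hκ : 0 ≤ 2 * |σ₀| + |δ₀| := by linarith
  obtain ⟨p1, p2, q1, q2, r1, r2, ⟨hp1, hp2, hp3⟩, ⟨hq1, hq2, hq3⟩, ⟨hr1, hr2, hr3⟩, d1, d2, d3, hor⟩ :=
    tri h₀ (geo_almost hp le_rfl) (geo_almost hq le_rfl) (geo_almost hg le_rfl) hpq hqg hgp
  intro m hm
  rcases le_total m r1 with hm1 | hm1
  · have hg' : IsGeodesicParam g r1 := by simpa using geo_sub hg le_rfl hr1 (by linarith)
    have hk := geo_sub (geo_rev hq) le_rfl (show 0 ≤ lq - q2 by linarith) (by linarith)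
    have B := bigon hX hκ h hg' hk (by simpa using hqg.symm) (by
      rw [dist_comm]; simpa using d2)
    obtain ⟨s1, s2, k1, k2, k3, k4, ⟨u, hu, k5⟩, ⟨v, hv, k6⟩, k7⟩ := B m ⟨hm.1, hm1⟩
    have hsub : ∀ u ∈ (fun s => (fun s => q (lq - s)) (0 + s)) '' Icc 0 (lq - q2 - 0),
        u ∈ p '' Icc 0 lp ∪ q '' Icc 0 lq := by
      rintro _ ⟨s, hs, rfl⟩
      exact Or.inr ⟨_, ⟨by linarith [hs.2], by linarith [hs.1]⟩, rfl⟩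
    refine ⟨s1, s2, k1, k2, k3, by linarith, ⟨u, hsub u hu, k5⟩, ⟨v, hsub v hv, k6⟩, ?_⟩
    exact k7.imp id fun ⟨A, hA, x1, x2⟩ =>
      ⟨A, hA, ctubN_mono (by linarith) x1, ctubN_mono (by linarith) x2⟩
  rcases le_total m r2 with hm2 | hm2
  · refine ⟨r1, r2, hr1, hm1, hm2, hr3, ⟨q q2, Or.inr ⟨q2, ⟨by linarith, hq3⟩, rfl⟩, ?_⟩,
      ⟨p p1, Or.inl ⟨p1, ⟨hp1, by linarith⟩, rfl⟩, by linarith⟩, ?_⟩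
    · rw [dist_comm]; linarith
    · rcases hor with ⟨e1, e2, e3⟩ | ⟨A, hA, c1, c2, c3, c4, c5, c6⟩
      · left; linarith
      · right; exact ⟨A, hA, ctubN_mono (by linarith) c5, ctubN_mono (by linarith) c6⟩
  · have hg' := geo_sub (geo_rev hg) le_rfl (show 0 ≤ ℓ - r2 by linarith) (by linarith)
    have hk : IsGeodesicParam p p1 := by simpa using geo_sub hp le_rfl hp1 (by linarith)
    have B := bigon hX hκ h hg' hk (by simpa using hgp) (by simpa using d3)
    obtain ⟨s1, s2, k1, k2, k3, k4, ⟨u, hu, k5⟩, ⟨v, hv, k6⟩, k7⟩ := B (ℓ - m)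
      ⟨by linarith [hm.2], by linarith⟩
    have hsub : ∀ u ∈ p '' Icc 0 p1, u ∈ p '' Icc 0 lp ∪ q '' Icc 0 lq := by
      rintro _ ⟨s, hs, rfl⟩
      exact Or.inl ⟨_, ⟨hs.1, by linarith [hs.2]⟩, rfl⟩
    simp only [zero_add] at k5 k6 k7
    refine ⟨ℓ - s2, ℓ - s1, by linarith, by linarith, by linarith, by linarith,
      ⟨v, hsub v hv, k6⟩, ⟨u, hsub u hu, k5⟩, ?_⟩
    rcases k7 with k7 | ⟨A, hA, x1, x2⟩
    · left; linarith
    · right; exact ⟨A, hA, ctubN_mono (by linarith) x2, ctubN_mono (by linarith) x1⟩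

/-- Intervals in `S`-neighborhoods of distinct pieces overlap at most `D`. -/
def OverlapProp (𝓐 : Set (Set X)) (S D : ℝ) : Prop :=
  ∀ (g : ℝ → X) (ℓ : ℝ), IsGeodesicParam g ℓ → ∀ A ∈ 𝓐, ∀ A' ∈ 𝓐, A ≠ A' →
    ∀ e f s1 s2 : ℝ, 0 ≤ e → f ≤ ℓ → 0 ≤ s1 → s2 ≤ ℓ → g e ∈ ctubN S A → g f ∈ ctubN S A →
    g s1 ∈ ctubN S A' → g s2 ∈ ctubN S A' → ∀ t1 t2 : ℝ, t1 ≤ t2 → e ≤ t1 → s1 ≤ t1 →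
    t2 ≤ f → t2 ≤ s2 → t2 - t1 ≤ D

lemma Q_interval {𝓐 : Set (Set X)} {t K₀ K S : ℝ} (hQ : PropQWith 𝓐 t K₀) (hK : K₀ ≤ K)
    (hS : S < K) {g : ℝ → X} {ℓ : ℝ} (hg : IsGeodesicParam g ℓ) {A : Set X} (hA : A ∈ 𝓐)
    {e f : ℝ} (he : 0 ≤ e) (hf : f ≤ ℓ) (h1 : g e ∈ ctubN S A) (h2 : g f ∈ ctubN S A)
    {s : ℝ} (hes : e ≤ s) (hsf : s ≤ f) : infDist (g s) A < t * K := by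
  have h := hQ A hA K hK _ _ (geo_sub hg he (hes.trans hsf) hf)
    (by simpa [tubN] using lt_of_le_of_lt (show infDist (g e) A ≤ S from h1) hS)
    (by simpa [tubN] using lt_of_le_of_lt (show infDist (g f) A ≤ S from h2) hS)
    (s - e) ⟨by linarith, by linarith⟩
  simpa [tubN] using h

lemma overlap_of {𝓐 : Set (Set X)} {t K₀ K S D : ℝ} (hQ : PropQWith 𝓐 t K₀) (hK : K₀ ≤ K)
    (hS : S < K) (hD : ∀ A ∈ 𝓐, ∀ A' ∈ 𝓐, A ≠ A' →
      ∀ x ∈ tubN (t * K) A ∩ tubN (t * K) A', ∀ y ∈ tubN (t * K) A ∩ tubN (t * K) A',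
        dist x y ≤ D) : OverlapProp 𝓐 S D := by
  intro g ℓ hg A hA A' hA' hne e f s1 s2 he hf hs1 hs2 a1 a2 a3 a4 t1 t2 ht12 c1 c2 c3 c4
  have := hD A hA A' hA' hne (g t1)
    ⟨Q_interval hQ hK hS hg hA he hf a1 a2 c1 (by linarith),
      Q_interval hQ hK hS hg hA' hs1 hs2 a3 a4 c2 (by linarith)⟩ (g t2)
    ⟨Q_interval hQ hK hS hg hA he hf a1 a2 (by linarith) c3,
      Q_interval hQ hK hS hg hA' hs1 hs2 a3 a4 (by linarith) c4⟩
  rwa [geo_dist hg (by linarith) ht12 (by linarith)] at this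

/-- The entrance point of a long piece is close to `U`. -/
lemma entrance_close {𝓐 : Set (Set X)} {S D κ : ℝ} (hO : OverlapProp 𝓐 S D) (hD : 0 ≤ D)
    (hκ : 0 ≤ κ)
    {g : ℝ → X} {ℓ : ℝ} (hg : IsGeodesicParam g ℓ) {U : Set X} (hU : SideProp 𝓐 g ℓ U S κ)
    {A : Set X} (hA : A ∈ 𝓐) {e f : ℝ} (he : 0 ≤ e) (hf : f ≤ ℓ) (hef : e + D < f)
    (h1 : g e ∈ ctubN S A) (h2 : g f ∈ ctubN S A)
    (hmin : ∀ t ∈ Icc (0:ℝ) ℓ, g t ∈ ctubN S A → e ≤ t) :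
    ∃ u ∈ U, dist (g e) u ≤ 2 * κ + D := by
  obtain ⟨s1, s2, k1, k2, k3, k4, ⟨u, hu, k5⟩, ⟨v, hv, k6⟩, k7⟩ := hU e ⟨he, by linarith⟩
  have fin2 : s2 - e ≤ κ + D → ∃ u ∈ U, dist (g e) u ≤ 2 * κ + D := by
    intro hh
    refine ⟨v, hv, ?_⟩
    have := dist_triangle (g e) (g s2) v
    rw [geo_dist hg he k3 k4] at this
    linarith
  rcases k7 with k7 | ⟨A', hA', k7, k8⟩
  · exact fin2 (by linarith)
  · by_cases hAA : A = A'
    · subst hAA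
      have := hmin s1 ⟨k1, by linarith⟩ k7
      have : s1 = e := by linarith
      subst this
      exact ⟨u, hu, by linarith⟩
    · apply fin2
      have := hO g ℓ hg A hA A' hA' hAA e f s1 s2 he hf k1 k4 h1 h2 k7 k8 e (min s2 f)
        (le_min k3 (by linarith)) le_rfl k2 (min_le_right _ _) (min_le_left _ _)
      rcases le_total s2 f with h | h
      · rw [min_eq_left h] at this; linarith
      · rw [min_eq_right h] at this; linarith

/-- Either the point is close to `U` or it lies in a long piece. -/
lemma close_or_long {𝓐 : Set (Set X)} {S D κ : ℝ} (hD : 0 ≤ D) (hκ : 0 ≤ κ)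
    {g : ℝ → X} {ℓ : ℝ} (hg : IsGeodesicParam g ℓ) {U : Set X} (hU : SideProp 𝓐 g ℓ U S κ)
    {m : ℝ} (hm : m ∈ Icc (0:ℝ) ℓ) :
    (∃ u ∈ U, dist (g m) u ≤ 2 * κ + D) ∨
    ∃ A ∈ 𝓐, ∃ s1 s2 : ℝ, 0 ≤ s1 ∧ s1 ≤ m ∧ m ≤ s2 ∧ s2 ≤ ℓ ∧ s1 + D < s2 ∧
      g s1 ∈ ctubN S A ∧ g s2 ∈ ctubN S A := by
  obtain ⟨s1, s2, k1, k2, k3, k4, ⟨u, hu, k5⟩, ⟨v, hv, k6⟩, k7⟩ := hU m hm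
  have fin2 : s2 - s1 ≤ κ + D → ∃ u ∈ U, dist (g m) u ≤ 2 * κ + D := by
    intro hh
    refine ⟨v, hv, ?_⟩
    have := dist_triangle (g m) (g s2) v
    rw [geo_dist hg hm.1 k3 k4] at this
    linarith
  rcases k7 with k7 | ⟨A', hA', k7, k8⟩
  · exact Or.inl (fin2 (by linarith))
  · by_cases h : s2 - s1 ≤ κ + D
    · exact Or.inl (fin2 h)
    · exact Or.inr ⟨A', hA', s1, s2, k1, k2, k3, k4, by linarith, k7, k8⟩

/-- The apex of a fat triangle over a long piece is close to the piece. -/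
lemma apex_close {𝓐 : Set (Set X)} {σ₀ δ₀ S D θ c : ℝ} (h₀ : StarATGWith 𝓐 0 σ₀ δ₀)
    (hσS : σ₀ ≤ S) (hS : 0 ≤ S) (hO : OverlapProp 𝓐 S D) (hD : 0 ≤ D)
    (hθ : D + 2 * (2 * |σ₀| + |δ₀|) < θ) (hc : 0 ≤ c)
    {p q g : ℝ → X} {lp lq ℓ : ℝ} (hp : IsGeodesicParam p lp) (hq : IsGeodesicParam q lq)
    (hg : IsGeodesicParam g ℓ) (hpq : p lp = q 0) (hqg : q lq = g 0) (hgp : g ℓ = p 0)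
    {A : Set X} (hA : A ∈ 𝓐) {e f : ℝ} (he : 0 ≤ e) (hf : f ≤ ℓ) (hef : e + D < f)
    (h1 : g e ∈ ctubN S A) (h2 : g f ∈ ctubN S A) (he' : e ≤ 4 * θ) (hf' : ℓ - f ≤ 4 * θ)
    (hmid : ∀ s, e ≤ s → s ≤ f → infDist (g s) A ≤ c)
    (hadj : ∀ u ∈ p '' Icc 0 lp, ∀ v ∈ q '' Icc 0 lq, dist u v < θ →
      dist u (q 0) ≤ 3 * θ)
    (hfx : ∀ v ∈ q '' Icc 0 lq, 100 * θ ≤ dist (p 0) v)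
    (hfz : ∀ v ∈ p '' Icc 0 lp, 100 * θ ≤ dist (g 0) v) :
    infDist (q 0) A ≤ c + S + 8 * θ := by
  have bσ0 := abs_nonneg σ₀
  have bδ0 := abs_nonneg δ₀
  have hall : ∀ s, 0 ≤ s → s ≤ ℓ → infDist (g s) A ≤ c + S + 4 * θ := by
    intro s hs hs'
    rcases le_total s e with h | h
    · have := aux_dist_ctub h1 (geo_dist hg hs h (by linarith)).le
      linarith
    rcases le_total f s with h' | h'
    · have := geo_dist hg (by linarith) h' hs'
      rw [dist_comm] at this
      have := aux_dist_ctub h2 this.le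
      linarith
    · have := hmid s h h'
      linarith
  obtain ⟨p1, p2, q1, q2, r1, r2, ⟨hp1, hp2, hp3⟩, ⟨hq1, hq2, hq3⟩, ⟨hr1, hr2, hr3⟩, d1, d2, d3, hor⟩ :=
    tri h₀ (geo_almost hp le_rfl) (geo_almost hq le_rfl) (geo_almost hg le_rfl) hpq hqg hgp
  have mp1 : p p1 ∈ p '' Icc 0 lp := ⟨p1, ⟨hp1, by linarith⟩, rfl⟩
  have mp2 : p p2 ∈ p '' Icc 0 lp := ⟨p2, ⟨by linarith, by linarith⟩, rfl⟩
  have mq1 : q q1 ∈ q '' Icc 0 lq := ⟨q1, ⟨hq1, by linarith⟩, rfl⟩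
  have mq2 : q q2 ∈ q '' Icc 0 lq := ⟨q2, ⟨by linarith, by linarith⟩, rfl⟩
  have hy2 := hadj _ mp2 _ mq1 (by linarith)
  -- it is enough that `p p1` is close to the apex
  have fin1 : dist (p p1) (q 0) ≤ 3 * θ → infDist (q 0) A ≤ c + S + 8 * θ := by
    intro hh
    have t1 := dist_triangle (g r2) (p p1) (q 0)
    have t2 := hall r2 (by linarith) hr3
    have t3 := infDist_le_infDist_add_dist (s := A) (x := q 0) (y := g r2)
    rw [dist_comm] at t3
    linarith
  rcases hor with ⟨e1, e2, e3⟩ | ⟨A', hA', c1, c2, c3, c4, c5, c6⟩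
  · rw [← e1] at hy2
    exact fin1 hy2
  · by_cases hAA : A = A'
    · subst hAA
      rw [dist_comm] at hy2
      have := aux_dist_ctub c2 hy2
      linarith
    · have hov := hO g ℓ hg A hA A' hA' hAA e f r1 r2 he hf hr1 hr3 h1 h2 (ctubN_mono hσS c5)
        (ctubN_mono hσS c6)
      rcases le_total f r2 with hfr | hfr
      · exfalso
        rcases le_total r1 e with hre | hre
        · have := hov e f (by linarith) le_rfl hre le_rfl hfr
          linarith
        · have hr1f : f - D ≤ r1 := by
            rcases le_total r1 f with h | h
            · have := hov r1 f h hre le_rfl le_rfl hfr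
              linarith
            · linarith
          have g1 := geo_dist hg hr1 (show r1 ≤ ℓ by linarith) le_rfl
          rw [hgp] at g1
          have := hfx _ mq2
          have t := dist_triangle (p 0) (g r1) (q q2)
          rw [dist_comm (p 0) (g r1), dist_comm (g r1) (q q2)] at t
          linarith
      · rcases le_total r1 e with hre | hre
        · exfalso
          have hr2e : r2 ≤ e + D := by
            rcases le_total e r2 with h | h
            · have := hov e r2 h le_rfl hre hfr le_rfl
              linarith
            · linarith
          have g1 := geo_dist hg le_rfl (show 0 ≤ r2 by linarith) hr3
          have := hfz _ mp1
          have t := dist_triangle (g 0) (g r2) (p p1)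
          linarith
        · have := hov r1 r2 hr2 hre le_rfl hfr le_rfl
          apply fin1
          apply hadj _ mp1 _ mq2
          have g1 := geo_dist hg hr1 hr2 hr3
          have t1 := dist_triangle (p p1) (g r2) (q q2)
          have t2 := dist_triangle (g r2) (g r1) (q q2)
          rw [dist_comm (p p1) (g r2)] at t1
          rw [dist_comm (g r2) (g r1), dist_comm (g r1) (q q2)] at t2
          linarith

/-- Consequence of (F1) for two edges. -/
lemma fat_core {θ : ℝ} (hθ : 0 < θ) {γ η : ℝ → X} {la lb : ℝ} (hγ : IsGeodesicParam γ la)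
    (hη : IsGeodesicParam η lb) {S : Set X}
    (hF : ∀ p ∈ γ '' Icc 0 la, 2 * θ ≤ dist p (γ 0) → 2 * θ ≤ dist p (γ la) →
      ∀ q ∈ S \ γ '' Icc 0 la, θ ≤ dist p q)
    (hηS : η '' Icc 0 lb ⊆ S) (hend : η lb ∉ γ '' Icc 0 la)
    {u : X} (hu : u ∈ γ '' Icc 0 la) {s : ℝ} (hs : s ∈ Icc (0:ℝ) lb) (hd : dist u (η s) < θ) :
    (dist u (γ 0) < 2 * θ ∨ dist u (γ la) < 2 * θ) ∨
    ∃ s' ∈ Icc (0:ℝ) lb, s ≤ s' ∧ (dist (η s') (γ 0) < 2 * θ ∨ dist (η s') (γ la) < 2 * θ) := by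
  by_cases hv : η s ∈ γ '' Icc 0 la
  · right
    have hcont : ContinuousOn γ (Icc 0 la) := by
      have : LipschitzOnWith 1 γ (Icc 0 la) := by
        refine LipschitzOnWith.of_dist_le_mul fun s hs t ht => ?_
        simpa [Real.dist_eq] using (hγ.2 s hs t ht).le
      exact this.continuousOn
    have hcl : IsClosed (γ '' Icc 0 la) := (isCompact_Icc.image_of_continuousOn hcont).isClosed
    have hcη : ContinuousOn η (Icc 0 lb) := by
      have : LipschitzOnWith 1 η (Icc 0 lb) := by
        refine LipschitzOnWith.of_dist_le_mul fun s hs t ht => ?_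
        simpa [Real.dist_eq] using (hη.2 s hs t ht).le
      exact this.continuousOn
    have hK : IsCompact (Icc 0 lb ∩ η ⁻¹' (γ '' Icc 0 la)) :=
      isCompact_Icc.of_isClosed_subset (hcη.preimage_isClosed_of_isClosed isClosed_Icc hcl)
        inter_subset_left
    have hmem := hK.sSup_mem ⟨s, hs, hv⟩
    have hub : ∀ t ∈ Icc 0 lb ∩ η ⁻¹' (γ '' Icc 0 la), t ≤ sSup (Icc 0 lb ∩ η ⁻¹' (γ '' Icc 0 la)) :=
      fun t ht => le_csSup hK.bddAbove ht
    generalize sSup (Icc 0 lb ∩ η ⁻¹' (γ '' Icc 0 la)) = τ at hmem hub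
    refine ⟨τ, hmem.1, hub s ⟨hs, hv⟩, ?_⟩
    by_contra hcon
    push Not at hcon
    have hlt : τ < lb := by
      rcases lt_or_eq_of_le hmem.1.2 with h | h
      · exact h
      · exact absurd (h ▸ hmem.2) hend
    have hτ0 := hmem.1.1
    have hm1 : min (τ + θ / 2) lb ≤ lb := min_le_right _ _
    have hm2 : min (τ + θ / 2) lb ≤ τ + θ / 2 := min_le_left _ _
    have hm3 : τ < min (τ + θ / 2) lb := lt_min (by linarith) hlt
    have hin : η (min (τ + θ / 2) lb) ∈ S \ γ '' Icc 0 la := by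
      refine ⟨hηS ⟨_, ⟨by linarith, hm1⟩, rfl⟩, fun hh => ?_⟩
      have := hub (min (τ + θ / 2) lb) ⟨⟨by linarith, hm1⟩, hh⟩
      linarith
    have := hF (η τ) hmem.2 hcon.1 hcon.2 _ hin
    rw [geo_dist hη hτ0 hm3.le hm1] at this
    linarith
  · left
    by_contra hcon
    push Not at hcon
    have := hF u hu hcon.1 hcon.2 _ ⟨hηS ⟨s, hs, rfl⟩, hv⟩
    linarith

lemma fat_far {P : PrePolygon X 4} {θ ν : ℝ} (hF : P.IsFat2 θ ν) (i : Fin 4) :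
    (∀ v ∈ P.edgeSet (finCycSucc i), ν * θ ≤ dist (P.edge i 0) v) ∧
    (∀ v ∈ P.edgeSet (finCycSucc (finCycSucc i)), ν * θ ≤ dist (P.edge i 0) v) := by
  have h := hF.2 i
  have a1 : finCycSucc i ≠ i ∧ finCycSucc (finCycSucc i) ≠ i := by clear * - i; revert i; decide
  have a2 : finCycSucc (finCycSucc i) ≠ i ∧ finCycSucc (finCycSucc (finCycSucc i)) ≠ i := by
    clear * - i; revert i; decide
  constructor
  · intro v hv
    exact h.trans (infDist_le_dist_of_mem (mem_biUnion a1 hv))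
  · intro v hv
    exact h.trans (infDist_le_dist_of_mem (mem_biUnion a2 hv))

lemma fat_F1 {P : PrePolygon X 4} {θ ν : ℝ} (hF : P.IsFat2 θ ν) (i : Fin 4) :
    ∀ p ∈ P.edge i '' Icc 0 (P.len i), 2 * θ ≤ dist p (P.edge i 0) →
      2 * θ ≤ dist p (P.edge i (P.len i)) →
      ∀ q ∈ P.carrier \ P.edge i '' Icc 0 (P.len i), θ ≤ dist p q := by
  intro p hp h1 h2 q hq
  exact (hF.1 i p hp h1 h2).trans (infDist_le_dist_of_mem hq)

lemma fat_adj {P : PrePolygon X 4} {θ ν : ℝ} (hθ : 0 < θ) (hν : 8 ≤ ν) (hP : P.IsGeodesicPolygon)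
    (hF : P.IsFat2 θ ν) (i : Fin 4) {u v : X} (hu : u ∈ P.edgeSet i)
    (hv : v ∈ P.edgeSet (finCycSucc i)) (hd : dist u v < θ) :
    dist u (P.edge (finCycSucc i) 0) ≤ 3 * θ ∧ dist v (P.edge (finCycSucc i) 0) ≤ 3 * θ := by
  have hνθ : 8 * θ ≤ ν * θ := mul_le_mul_of_nonneg_right hν hθ.le
  have hgi := hP.2 i
  have hgj := hP.2 (finCycSucc i)
  have far := fat_far hF
  have hcyc : finCycSucc (finCycSucc (finCycSucc (finCycSucc i))) = i := by clear * - i; revert i; decide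
  have hend : P.edge (finCycSucc i) (P.len (finCycSucc i)) ∉ P.edge i '' Icc 0 (P.len i) := by
    rw [hP.1.2]
    intro hh
    have := (far (finCycSucc (finCycSucc i))).2 _ (by rw [hcyc]; exact hh)
    rw [dist_self] at this
    linarith
  obtain ⟨s, hs, rfl⟩ := hv
  have := fat_core hθ hgi hgj (fat_F1 hF i) (subset_iUnion P.edgeSet (finCycSucc i)) hend hu hs hd
  rw [hP.1.2 i] at this
  rcases this with (h | h) | ⟨s', hs', hss, h | h⟩
  · exfalso
    have f := (far i).1 _ ⟨s, hs, rfl⟩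
    have := dist_triangle_left (P.edge i 0) (P.edge (finCycSucc i) s) u
    linarith
  · have := dist_triangle_left (P.edge (finCycSucc i) s) (P.edge (finCycSucc i) 0) u
    constructor <;> linarith
  · exfalso
    have f := (far i).1 _ ⟨s', hs', rfl⟩
    rw [dist_comm] at f
    linarith
  · have e1 := geo_dist hgj le_rfl hs.1 hs.2
    have e2 := geo_dist hgj le_rfl hs'.1 hs'.2
    rw [dist_comm] at e1 e2
    have := dist_triangle u (P.edge (finCycSucc i) s) (P.edge (finCycSucc i) 0)
    constructor <;> linarith

lemma fat_opp {P : PrePolygon X 4} {θ ν : ℝ} (hθ : 0 < θ) (hν : 8 ≤ ν) (hP : P.IsGeodesicPolygon)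
    (hF : P.IsFat2 θ ν) (i : Fin 4) {u v : X} (hu : u ∈ P.edgeSet i)
    (hv : v ∈ P.edgeSet (finCycSucc (finCycSucc i))) : θ ≤ dist u v := by
  by_contra hd
  push Not at hd
  have hνθ : 8 * θ ≤ ν * θ := mul_le_mul_of_nonneg_right hν hθ.le
  have hgi := hP.2 i
  have hgj := hP.2 (finCycSucc (finCycSucc i))
  have far := fat_far hF
  have hcyc : finCycSucc (finCycSucc (finCycSucc (finCycSucc i))) = i := by clear * - i; revert i; decide
  have hend : P.edge (finCycSucc (finCycSucc i)) (P.len (finCycSucc (finCycSucc i))) ∉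
      P.edge i '' Icc 0 (P.len i) := by
    rw [hP.1.2]
    intro hh
    have := (far (finCycSucc (finCycSucc (finCycSucc i)))).1 _ (by rw [hcyc]; exact hh)
    rw [dist_self] at this
    linarith
  obtain ⟨s, hs, rfl⟩ := hv
  have := fat_core hθ hgi hgj (fat_F1 hF i)
    (subset_iUnion P.edgeSet (finCycSucc (finCycSucc i))) hend hu hs hd
  rw [hP.1.2 i] at this
  rcases this with (h | h) | ⟨s', hs', hss, h | h⟩
  · have f := (far i).2 _ ⟨s, hs, rfl⟩
    have := dist_triangle_left (P.edge i 0) (P.edge (finCycSucc (finCycSucc i)) s) u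
    linarith
  · have f := (far (finCycSucc i)).1 _ ⟨s, hs, rfl⟩
    have := dist_triangle_left (P.edge (finCycSucc i) 0) (P.edge (finCycSucc (finCycSucc i)) s) u
    linarith
  · have f := (far i).2 _ ⟨s', hs', rfl⟩
    rw [dist_comm] at f
    linarith
  · have f := (far (finCycSucc i)).1 _ ⟨s', hs', rfl⟩
    rw [dist_comm] at f
    linarith

/-- **Lemma.** Let `X` be geodesic and `(*)`-ATG with respect to `𝓐`, and assume that
`(X,𝓐)` satisfies (α₁), (α₂) and (Q).  Then there are `θ > 0`, `ν ≥ 8` and `χ > 0`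
such that every `(θ,ν)`-fat geodesic quadrilateral is contained in the `χ`-neighborhood
of some `A ∈ 𝓐`. -/
theorem fat_quadrilaterals_in_pieces (hX : GeodesicSpace X) (𝓐 : Set (Set X))
    (hstar : StarATG 𝓐) (h1 : Alpha1 𝓐) (h2 : Alpha2 𝓐) (hQ : PropQ 𝓐) :
    ∃ θ : ℝ, 0 < θ ∧ ∃ ν : ℝ, 8 ≤ ν ∧ ∃ χ : ℝ, 0 < χ ∧
      ∀ P : PrePolygon X 4, P.IsGeodesicPolygon → P.IsFat2 θ ν →
        ∃ A ∈ 𝓐, P.carrier ⊆ tubN χ A := by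
  obtain ⟨σ₀, δ₀, h₀⟩ := hstar 0 le_rfl
  obtain ⟨σ, δ, h⟩ := hstar (2 * (2 * |σ₀| + |δ₀|)) (by positivity)
  obtain ⟨t, ht, K₀, hK₀, hQ⟩ := hQ
  have aσ0 := abs_nonneg σ
  have aδ0 := abs_nonneg δ
  have bσ := le_abs_self σ₀
  have bσ0 := abs_nonneg σ₀
  have bδ0 := abs_nonneg δ₀
  obtain ⟨S, hSdef⟩ : ∃ S, S = |σ₀| + |σ| := ⟨_, rfl⟩
  obtain ⟨κ, hκdef⟩ : ∃ κ, κ = (2 * |σ₀| + |δ₀|) + (2 * |σ| + |δ|) := ⟨_, rfl⟩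
  have hS0 : 0 ≤ S := by linarith
  have hκ0 : 0 ≤ κ := by linarith
  obtain ⟨K, hKdef⟩ : ∃ K, K = K₀ + S + 1 := ⟨_, rfl⟩
  have htK : 0 < t * K := mul_pos ht (by linarith)
  obtain ⟨D', hD'⟩ := h1 (t * K) htK
  obtain ⟨D, hDdef⟩ : ∃ D, D = max D' 0 := ⟨_, rfl⟩
  have hD0 : 0 ≤ D := hDdef ▸ le_max_right _ _
  have hDD : D' ≤ D := hDdef ▸ le_max_left _ _
  have hO : OverlapProp 𝓐 S D := overlap_of hQ (by linarith) (by linarith)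
    (fun A hA A' hA' hne x hx y hy => (hD' A hA A' hA' hne x hx y hy).trans hDD)
  obtain ⟨θ, hθdef⟩ : ∃ θ, θ = 2 * (2 * κ + D) + 1 := ⟨_, rfl⟩
  have hθ : 0 < θ := by linarith
  have hK2 : 0 < t * (K₀ + (t * K + S + 8 * θ) + 1) := mul_pos ht (by linarith)
  refine ⟨θ, hθ, 100, by norm_num, t * (K₀ + (t * K + S + 8 * θ) + 1), hK2, ?_⟩
  intro P hP hF
  have far := fat_far hF
  have adj : ∀ i : Fin 4, ∀ u ∈ P.edgeSet i, ∀ v ∈ P.edgeSet (finCycSucc i), dist u v < θ → _ :=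
    fun i u hu v hv hd => fat_adj hθ (by norm_num) hP hF i hu hv hd
  have opp : ∀ i : Fin 4, ∀ u ∈ P.edgeSet i, ∀ v ∈ P.edgeSet (finCycSucc (finCycSucc i)), _ :=
    fun i u hu v hv => fat_opp hθ (by norm_num) hP hF i hu hv
  have s0 : finCycSucc (0 : Fin 4) = 1 := rfl
  have s1 : finCycSucc (1 : Fin 4) = 2 := rfl
  have s2 : finCycSucc (2 : Fin 4) = 3 := rfl
  have s3 : finCycSucc (3 : Fin 4) = 0 := rfl
  have j0 := hP.1.2 0
  have j1 := hP.1.2 1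
  have j2 := hP.1.2 2
  have j3 := hP.1.2 3
  have ad0 := adj 0
  have ad1 := adj 1
  have ad2 := adj 2
  have ad3 := adj 3
  have op0 := opp 0
  have op1 := opp 1
  have f0 := far 0
  have f1 := far 1
  have f2 := far 2
  have f3 := far 3
  simp only [s0, s1, s2, s3] at j0 j1 j2 j3 ad0 ad1 ad2 ad3 op0 op1 f0 f1 f2 f3
  -- the diagonal, from vertex 2 to vertex 0
  obtain ⟨g, ℓ, hg, hg0, hgℓ⟩ := hX (P.edge 2 0) (P.edge 0 0)
  have hℓ0 := hg.1
  have hU : SideProp 𝓐 g ℓ (P.edgeSet 0 ∪ P.edgeSet 1) S κ := by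
    rw [hSdef, hκdef]
    exact side hX h₀ h (hP.2 0) (hP.2 1) hg j0 (j1.trans hg0.symm) hgℓ
  have hW' : SideProp 𝓐 (fun s => g (ℓ - s)) ℓ (P.edgeSet 2 ∪ P.edgeSet 3) S κ := by
    rw [hSdef, hκdef]
    exact side hX h₀ h (hP.2 2) (hP.2 3) (geo_rev hg) j2 (by simpa using j3.trans hgℓ.symm)
      (by simpa using hg0)
  have hW : SideProp 𝓐 g ℓ (P.edgeSet 2 ∪ P.edgeSet 3) S κ := by
    simpa using hW'.rev
  have both : ∀ m ∈ Icc (0:ℝ) ℓ, (∃ u ∈ P.edgeSet 0 ∪ P.edgeSet 1, dist (g m) u ≤ 2 * κ + D) →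
      (∃ u ∈ P.edgeSet 2 ∪ P.edgeSet 3, dist (g m) u ≤ 2 * κ + D) →
      m ≤ 4 * θ ∨ ℓ - m ≤ 4 * θ := by
    rintro m hm ⟨u, hu, hu'⟩ ⟨v, hv, hv'⟩
    have huv : dist u v < θ := by
      have := dist_triangle_left u v (g m)
      linarith
    have e1 := geo_dist hg le_rfl hm.1 hm.2
    have e2 := geo_dist hg hm.1 hm.2 le_rfl
    rw [dist_comm, hg0] at e1
    rw [hgℓ] at e2
    rcases hu with hu | hu <;> rcases hv with hv | hv
    · have := op0 u hu v hv
      linarith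
    · right
      have := (ad3 v hv u hu (by rwa [dist_comm])).2
      have := dist_triangle (g m) u (P.edge 0 0)
      linarith
    · left
      have := (ad1 u hu v hv huv).1
      have := dist_triangle (g m) u (P.edge 2 0)
      linarith
    · have := op1 u hu v hv
      linarith
  have hℓ : 100 * θ ≤ ℓ := by
    have := f2.2 (P.edge 0 0) ⟨0, ⟨le_rfl, (hP.2 0).1⟩, rfl⟩
    have e := geo_dist hg le_rfl hℓ0 le_rfl
    rw [hg0, hgℓ] at e
    linarith
  have hmid : ℓ / 2 ∈ Icc (0:ℝ) ℓ := ⟨by linarith, by linarith⟩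
  -- a long piece through the midpoint
  obtain ⟨A, hA, m1, m2, k1, k2, k3, k4, k5, k6, k7⟩ :
      ∃ A ∈ 𝓐, ∃ s1 s2 : ℝ, 0 ≤ s1 ∧ s1 ≤ ℓ / 2 ∧ ℓ / 2 ≤ s2 ∧ s2 ≤ ℓ ∧ s1 + D < s2 ∧
      g s1 ∈ ctubN S A ∧ g s2 ∈ ctubN S A := by
    rcases close_or_long hD0 hκ0 hg hU hmid with hu | hu
    · rcases close_or_long hD0 hκ0 hg hW hmid with hw | hw
      · exfalso
        rcases both _ hmid hu hw with hh | hh <;> linarith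
      · exact hw
    · exact hu
  obtain ⟨e, f, c1, c2, c3, c4, c5, c6, -, -, c7⟩ :=
    hit_props (geo_almost hg le_rfl) S A ⟨k1, by linarith⟩ k6
  have hm2f := (c7 m2 ⟨by linarith, k4⟩ k7).2
  have he4 : e ≤ 4 * θ := by
    have x1 := entrance_close hO hD0 hκ0 hg hU hA c1 c4 (by linarith) c5 c6
      (fun t ht htA => (c7 t ht htA).1)
    have x2 := entrance_close hO hD0 hκ0 hg hW hA c1 c4 (by linarith) c5 c6
      (fun t ht htA => (c7 t ht htA).1)
    rcases both e ⟨c1, by linarith⟩ x1 x2 with hh | hh <;> linarith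
  have hrev : ∀ t ∈ Icc (0:ℝ) ℓ, (fun s => g (ℓ - s)) t ∈ ctubN S A → ℓ - f ≤ t := by
    intro t ht htA
    have := (c7 (ℓ - t) ⟨by linarith [ht.2], by linarith [ht.1]⟩ htA).2
    linarith
  have c5' : (fun s => g (ℓ - s)) (ℓ - e) ∈ ctubN S A := by simpa using c5
  have c6' : (fun s => g (ℓ - s)) (ℓ - f) ∈ ctubN S A := by simpa using c6
  have hf4 : ℓ - f ≤ 4 * θ := by
    have x1 := entrance_close hO hD0 hκ0 (geo_rev hg) hU.rev hA (by linarith)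
      (show ℓ - e ≤ ℓ by linarith) (by linarith) c6' c5' hrev
    have x2 := entrance_close hO hD0 hκ0 (geo_rev hg) hW' hA (by linarith)
      (show ℓ - e ≤ ℓ by linarith) (by linarith) c6' c5' hrev
    simp only [sub_sub_cancel] at x1 x2
    rcases both f ⟨by linarith, c4⟩ x1 x2 with hh | hh <;> linarith
  have hmidQ : ∀ s, e ≤ s → s ≤ f → infDist (g s) A ≤ t * K := fun s hs hs' =>
    (Q_interval hQ (by linarith) (by linarith) hg hA c1 c4 c5 c6 hs hs').le
  have v0 : infDist (P.edge 0 0) A ≤ t * K + S + 8 * θ := by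
    have e2 := geo_dist hg (by linarith) c4 le_rfl
    rw [hgℓ, dist_comm] at e2
    have := aux_dist_ctub c6 e2.le
    linarith
  have v2 : infDist (P.edge 2 0) A ≤ t * K + S + 8 * θ := by
    have e2 := geo_dist hg le_rfl c1 (by linarith)
    rw [hg0] at e2
    have := aux_dist_ctub c5 e2.le
    linarith
  have v1 : infDist (P.edge 1 0) A ≤ t * K + S + 8 * θ :=
    apex_close h₀ (by linarith) hS0 hO hD0 (by linarith) htK.le (hP.2 0) (hP.2 1) hg j0
      (j1.trans hg0.symm) hgℓ hA c1 c4 (by linarith) c5 c6 he4 hf4 hmidQ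
      (fun u hu v hv hd => (ad0 u hu v hv hd).1) (fun v hv => f0.1 v hv)
      (fun v hv => by rw [hg0]; exact f2.2 v hv)
  have v3 : infDist (P.edge 3 0) A ≤ t * K + S + 8 * θ :=
    apex_close h₀ (by linarith) hS0 hO hD0 (by linarith) htK.le (hP.2 2) (hP.2 3) (geo_rev hg) j2
      (by simpa using j3.trans hgℓ.symm) (by simpa using hg0) hA (e := ℓ - f) (f := ℓ - e)
      (by linarith) (by linarith) (by linarith) c6' c5' hf4 (by linarith)
      (fun s hs hs' => hmidQ _ (by linarith) (by linarith))
      (fun u hu v hv hd => (ad2 u hu v hv hd).1) (fun v hv => f2.1 v hv)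
      (fun v hv => by simp only [sub_zero]; rw [hgℓ]; exact f0.2 v hv)
  have hv : ∀ i, P.edge i 0 ∈ tubN (K₀ + (t * K + S + 8 * θ) + 1) A := by
    intro i
    change infDist _ A < _
    fin_cases i
    · change infDist (P.edge 0 0) A < _
      linarith
    · change infDist (P.edge 1 0) A < _
      linarith
    · change infDist (P.edge 2 0) A < _
      linarith
    · change infDist (P.edge 3 0) A < _
      linarith
  refine ⟨A, hA, ?_⟩
  intro x hx
  obtain ⟨i, s, hs, rfl⟩ := mem_iUnion.1 hx
  exact hQ A hA _ (by linarith) _ _ (hP.2 i) (hv i) (by rw [hP.1.2 i]; exact hv _) s hs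
end
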